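/- (Crossover Theorem.) Let d ≥ 1 and suppose S satisfies Assumptions Ω and J with constants M, K, ζ. If d > 2, there exist ε > 0 and C, R > 0, depending only on d, ζ, M, K, such that for every x ∈ ℤ^d with ‖x‖₂ ≥ R, |S(x) − 𝒞(x; η_x̂, Λ_x̂) e^{−m_S|x|_S} ĥ^{(μ_x̂)}(0)| ≤ C 𝒞(x; η_x̂, Λ_x̂) e^{−m_S|x|_S} ‖x‖₂^{−ε}. If d ≤ 2, then for every s₀ > 0 the same conclusion holds for all x ∈ ℤ^d with ‖x‖₂ ≥ R and m_S‖x‖₂ ≥ s₀, with ε, C, R depending additionally on s₀. -/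

import Mathlib

open scoped BigOperators ENNReal Real Topology Pointwise
open MeasureTheory Matrix Filter

noncomputable section

namespace OZpaper

variable {d : ℕ}

/-- Dot product of a real vector with a lattice point. -/
def rdotZ (μ : Fin d → ℝ) (x : Fin d → ℤ) : ℝ := ∑ i, μ i * (x i : ℝ)

/-- Dot product of two real vectors. -/
def rdot (μ x : Fin d → ℝ) : ℝ := ∑ i, μ i * x i

/-- Euclidean norm of a lattice point. -/
def enormZ (x : Fin d → ℤ) : ℝ := Real.sqrt (∑ i, ((x i : ℝ)) ^ 2)

/-- Euclidean norm of a real vector. -/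
def enormR (x : Fin d → ℝ) : ℝ := Real.sqrt (∑ i, (x i) ^ 2)

/-- ℓ¹ norm of a real vector. -/
def l1R (x : Fin d → ℝ) : ℝ := ∑ i, |x i|

/-- ℓ∞ norm of a real vector. -/
def linftyR (x : Fin d → ℝ) : ℝ := ⨆ i, |x i|

/-- The vector `t • e₁`. -/
def e1R (d : ℕ) (t : ℝ) : Fin d → ℝ := fun i => if (i : ℕ) = 0 then t else 0

/-- The lattice point `n • e₁`. -/
def e1Z (d : ℕ) (n : ℤ) : Fin d → ℤ := fun i => if (i : ℕ) = 0 then n else 0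

/-- Cast of a lattice point to a real vector. -/
def toR (x : Fin d → ℤ) : Fin d → ℝ := fun i => (x i : ℝ)

/-- ℤ^d-symmetry: invariance under coordinate permutations and sign flips. -/
def ZdSymmetric (f : (Fin d → ℤ) → ℝ) : Prop :=
  (∀ (σ : Equiv.Perm (Fin d)) (x : Fin d → ℤ), f (fun i => x (σ i)) = f x) ∧
  (∀ (ε : Fin d → Bool) (x : Fin d → ℤ), f (fun i => if ε i then -(x i) else x i) = f x)

/-- Tilted susceptibility `χ^{(μ)}`, valued in `ℝ≥0∞`. -/
def chi (S : (Fin d → ℤ) → ℝ) (μ : Fin d → ℝ) : ℝ≥0∞ :=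
  ∑' x, ENNReal.ofReal (S x * Real.exp (rdotZ μ x))

/-- The set `Ω = {μ : χ^{(μ)} < ∞}`. -/
def Omega (S : (Fin d → ℤ) → ℝ) : Set (Fin d → ℝ) := {μ | chi S μ < ⊤}

/-- The mass `m_S`. -/
def mass (S : (Fin d → ℤ) → ℝ) : ℝ := sSup {t : ℝ | 0 ≤ t ∧ chi S (e1R d t) < ⊤}

/-- Assumption Ω. -/
structure AssumptionOmega (S : (Fin d → ℤ) → ℝ) : Prop where
  nonneg : ∀ x, 0 ≤ S x
  symm : ZdSymmetric S
  open_Omega : IsOpen (Omega S)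
  zero_mem : (0 : Fin d → ℝ) ∈ Omega S
  exists_not_mem : ∃ μ₁ : ℝ, 0 < μ₁ ∧ e1R d μ₁ ∉ Omega S

/-- Fourier transform `Q̂(k) = ∑_y Q(y) e^{-i k·y}`. -/
def fourierZ (Q : (Fin d → ℤ) → ℝ) (k : Fin d → ℝ) : ℂ :=
  ∑' y, (Q y : ℂ) * Complex.exp (-Complex.I * (rdotZ k y : ℂ))

/-- ℓ^p norm of a function on ℤ^d, valued in `ℝ≥0∞`. -/
def lpNorm (f : (Fin d → ℤ) → ℝ) (p : ℝ) : ℝ≥0∞ :=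
  (∑' y, ENNReal.ofReal (|f y| ^ p)) ^ (1 / p)

/-- The exponent `p_d`. -/
def pExp (d : ℕ) (ζ : ℝ) : ℝ := if d = 1 then 2 else (d : ℝ) / ((d : ℝ) - 2 + min ζ 2)

/-- The class 𝒬_{M,K,ζ} without the (d-1)-th moment bounds. -/
structure MemQweak (M K ζ : ℝ) (Q g : (Fin d → ℤ) → ℝ) : Prop where
  Q_l1 : lpNorm Q 1 ≤ ENNReal.ofReal M
  Q_moment : lpNorm (fun y => enormZ y ^ (2 + ζ) * Q y) 1 ≤ ENNReal.ofReal M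
  infrared : ∀ k : Fin d → ℝ, (∀ i, |k i| ≤ π) →
    K * enormR k ^ 2 ≤ (fourierZ Q 0 - fourierZ Q k).re
  g_l1 : lpNorm g 1 ≤ ENNReal.ofReal M
  g_zeta : lpNorm (fun y => enormZ y ^ ζ * g y) 1 ≤ ENNReal.ofReal M
  g_two : lpNorm (fun y => enormZ y ^ (2 : ℝ) * g y) (min (pExp d ζ) 2) ≤ ENNReal.ofReal M

/-- The class 𝒬_{M,K,ζ}. -/
structure MemQ (M K ζ : ℝ) (Q g : (Fin d → ℤ) → ℝ) : Prop where
  Q_l1 : lpNorm Q 1 ≤ ENNReal.ofReal M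
  Q_moment : lpNorm (fun y => enormZ y ^ (2 + ζ) * Q y) 1 ≤ ENNReal.ofReal M
  infrared : ∀ k : Fin d → ℝ, (∀ i, |k i| ≤ π) →
    K * enormR k ^ 2 ≤ (fourierZ Q 0 - fourierZ Q k).re
  g_l1 : lpNorm g 1 ≤ ENNReal.ofReal M
  g_zeta : lpNorm (fun y => enormZ y ^ ζ * g y) 1 ≤ ENNReal.ofReal M
  g_two : lpNorm (fun y => enormZ y ^ (2 : ℝ) * g y) (min (pExp d ζ) 2) ≤ ENNReal.ofReal M
  Q_dm1 : 4 ≤ d →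
    lpNorm (fun y => enormZ y ^ ((d : ℝ) - 1) * Q y) (min ((d : ℝ) / 3) 2) ≤ ENNReal.ofReal M
  g_dm1 : 4 ≤ d →
    lpNorm (fun y => enormZ y ^ ((d : ℝ) - 1) * g y) 2 ≤ ENNReal.ofReal M

/-- Convolution on ℤ^d. -/
def conv (f g : (Fin d → ℤ) → ℝ) (x : Fin d → ℤ) : ℝ := ∑' y, f (x - y) * g y

/-- Exponential tilt `f^{(μ)}`. -/
def tilt (f : (Fin d → ℤ) → ℝ) (μ : Fin d → ℝ) : (Fin d → ℤ) → ℝ :=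
  fun x => f x * Real.exp (rdotZ μ x)

/-- `∑_y f(y) e^{μ·y}`, i.e. `f̂^{(μ)}(0)`. -/
def tiltSum (f : (Fin d → ℤ) → ℝ) (μ : Fin d → ℝ) : ℝ := ∑' y, f y * Real.exp (rdotZ μ y)

/-- Assumption J. -/
structure AssumptionJ (S J h : (Fin d → ℤ) → ℝ) (M K ζ : ℝ) : Prop where
  M_pos : 0 < M
  K_pos : 0 < K
  zeta_pos : 0 < ζ
  J_symm : ZdSymmetric J
  h_symm : ZdSymmetric h
  J_summable : Summable fun x => |J x|
  h_summable : Summable fun x => |h x|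
  OZ_eq : ∀ x, S x = h x + conv J S x
  memQ : ∀ μ ∈ closure (Omega S), MemQ M K ζ (tilt J μ) (tilt h μ)
  hhat_pos : ∀ μ ∈ closure (Omega S), 0 < tiltSum h μ

/-- Assumption J, without the (d-1)-th moment bounds of the class 𝒬. -/
structure AssumptionJweak (S J h : (Fin d → ℤ) → ℝ) (M K ζ : ℝ) : Prop where
  M_pos : 0 < M
  K_pos : 0 < K
  zeta_pos : 0 < ζ
  J_symm : ZdSymmetric J
  h_symm : ZdSymmetric h
  J_summable : Summable fun x => |J x|
  h_summable : Summable fun x => |h x|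
  OZ_eq : ∀ x, S x = h x + conv J S x
  memQ : ∀ μ ∈ closure (Omega S), MemQweak M K ζ (tilt J μ) (tilt h μ)
  hhat_pos : ∀ μ ∈ closure (Omega S), 0 < tiltSum h μ

/-- `μ` is the optimal tilt `μ_x̂` for direction `x`. -/
def IsOptTilt (S : (Fin d → ℤ) → ℝ) (x μ : Fin d → ℝ) : Prop :=
  μ ∈ frontier (Omega S) ∧ ∀ ν ∈ closure (Omega S), rdot ν x ≤ rdot μ x

/-- The norm `|x|_S = (max_{μ ∈ Ω̄} μ·x)/m_S`. -/
def normS (S : (Fin d → ℤ) → ℝ) (x : Fin d → ℝ) : ℝ :=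
  sSup ((fun μ => rdot μ x) '' closure (Omega S)) / mass S

/-- The drift vector `η` of the tilted kernel. -/
def etaOf (J : (Fin d → ℤ) → ℝ) (μ : Fin d → ℝ) : Fin d → ℝ :=
  fun j => ∑' y, (y j : ℝ) * J y * Real.exp (rdotZ μ y)

/-- The covariance matrix `Λ` of the tilted kernel. -/
def LambdaOf (J : (Fin d → ℤ) → ℝ) (μ : Fin d → ℝ) : Matrix (Fin d) (Fin d) ℝ :=
  Matrix.of fun j l => ∑' y, (y j : ℝ) * (y l : ℝ) * J y * Real.exp (rdotZ μ y)

/-- The Brownian heat kernel `ρ_t(x; η, Λ)`. -/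
def heatKer (d : ℕ) (t : ℝ) (x η : Fin d → ℝ) (Λ : Matrix (Fin d) (Fin d) ℝ) : ℝ :=
  (1 / Real.sqrt Λ.det) * (1 / (2 * π * t) ^ ((d : ℝ) / 2)) *
    Real.exp (-(1 / (2 * t)) * rdot (x - t • η) (Λ⁻¹ *ᵥ (x - t • η)))

/-- The Brownian Green function `𝒞(x; η, Λ)`. -/
def greenC (d : ℕ) (x η : Fin d → ℝ) (Λ : Matrix (Fin d) (Fin d) ℝ) : ℝ :=
  ∫ t in Set.Ioi (0 : ℝ), heatKer d t x η Λ

/-- The massive continuum Green function `𝔾_a(x)`. -/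
def massiveG (d : ℕ) (a : ℝ) (x : Fin d → ℝ) : ℝ :=
  ∫ t in Set.Ioi (0 : ℝ),
    (1 / (2 * π * t) ^ ((d : ℝ) / 2)) * Real.exp (-enormR x ^ 2 / (2 * t)) *
      Real.exp (-(t * a ^ 2) / 2)

/-- The constant `A_φ = ∫_{ℝ^d} ‖y‖₂^φ 𝔾₁(y) dy`. -/
def Aconst (d : ℕ) (φ : ℝ) : ℝ := ∫ y : Fin d → ℝ, enormR y ^ φ * massiveG d 1 y

/-- The torus `[-π, π]^d`. -/
def torus (d : ℕ) : Set (Fin d → ℝ) := Set.univ.pi fun _ => Set.Icc (-π) π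

/-- The Fourier integral `I_t(x)`. -/
def It (Q g : (Fin d → ℤ) → ℝ) (t : ℝ) (x : Fin d → ℤ) : ℂ :=
  (((2 * π) ^ d : ℝ) : ℂ)⁻¹ *
    ∫ k in torus d, Complex.exp (Complex.I * (rdotZ k x : ℂ)) * fourierZ g k *
      Complex.exp (-(t : ℂ) * (fourierZ Q 0 - fourierZ Q k))

/-- The quantity `G_Q(x)`. -/
def GQ (Q g : (Fin d → ℤ) → ℝ) (x : Fin d → ℤ) : ℂ :=
  ∫ t in Set.Ioi (0 : ℝ), It Q g t x

/-- The Kronecker delta at the origin. -/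
def deltaZ (d : ℕ) : (Fin d → ℤ) → ℝ := fun x => if x = 0 then 1 else 0

/-- n-fold convolution power. -/
def convPow (D : (Fin d → ℤ) → ℝ) : ℕ → (Fin d → ℤ) → ℝ
  | 0 => deltaZ d
  | n + 1 => conv D (convPow D n)

/-- Random-walk Green function `S_z(x) = ∑_n z^n D^{*n}(x)`. -/
def rwG (D : (Fin d → ℤ) → ℝ) (z : ℝ) (x : Fin d → ℤ) : ℝ :=
  ∑' n : ℕ, z ^ n * convPow D n x

/-- `σ² = ∑_x ‖x‖₂² J(x)`. -/
def sigmaSq (J : (Fin d → ℤ) → ℝ) : ℝ := ∑' x, enormZ x ^ 2 * J x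

/-- Susceptibility `χ = ∑_x S(x)`. -/
def suscept (S : (Fin d → ℤ) → ℝ) : ℝ := ∑' x, S x

/-- `ĥ(0) = ∑_x h(x)`. -/
def h0 (h : (Fin d → ℤ) → ℝ) : ℝ := ∑' x, h x

/-- Correlation length of order φ. -/
def xiPhi (S : (Fin d → ℤ) → ℝ) (φ : ℝ) : ℝ :=
  ((∑' x, enormZ x ^ φ * S x) / suscept S) ^ (1 / φ)

/-- A critical family of OZ systems. -/
structure CriticalFamily (d : ℕ) (δ zc M K ζ : ℝ) (S J h : ℝ → (Fin d → ℤ) → ℝ) : Prop where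
  δ_pos : 0 < δ
  assumOmega : ∀ z ∈ Set.Ico (zc - δ) zc, AssumptionOmega (S z)
  assumJ : ∀ z ∈ Set.Ico (zc - δ) zc, AssumptionJ (S z) (J z) (h z) M K ζ
  mass_tendsto : Tendsto (fun z => mass (S z)) (𝓝[<] zc) (𝓝 0)

/-- Convolution on ℤ. -/
def convZ (f g : ℤ → ℝ) (x : ℤ) : ℝ := ∑' y, f (x - y) * g y

/-- n-fold convolution power on ℤ. -/
def convZPow (f : ℤ → ℝ) : ℕ → ℤ → ℝ
  | 0 => fun x => if x = 0 then 1 else 0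
  | n + 1 => convZ f (convZPow f n)

/-- Inverse Fourier transform on the torus. -/
def invF (F : (Fin d → ℝ) → ℂ) (x : Fin d → ℤ) : ℂ :=
  (((2 * π) ^ d : ℝ) : ℂ)⁻¹ *
    ∫ k in torus d, Complex.exp (Complex.I * (rdotZ k x : ℂ)) * F k

theorem norm_exp_I_mul (r : ℝ) : ‖Complex.exp (Complex.I * (r : ℂ))‖ = 1 := by
  rw [mul_comm]; exact Complex.norm_exp_ofReal_mul_I r

theorem norm_exp_neg_I_mul (r : ℝ) : ‖Complex.exp (-Complex.I * (r : ℂ))‖ = 1 := by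
  have := norm_exp_I_mul (-r)
  push_cast at this
  rwa [mul_neg, ← neg_mul] at this

theorem norm_fourier_term (f : (Fin d → ℤ) → ℝ) (k : Fin d → ℝ) (y : Fin d → ℤ) :
    ‖(f y : ℂ) * Complex.exp (-Complex.I * (rdotZ k y : ℂ))‖ = |f y| := by
  rw [norm_mul, norm_exp_neg_I_mul, mul_one, Complex.norm_real, Real.norm_eq_abs]

theorem summable_fourier_term {f : (Fin d → ℤ) → ℝ} (hf : Summable fun y => |f y|)
    (k : Fin d → ℝ) :
    Summable fun y => (f y : ℂ) * Complex.exp (-Complex.I * (rdotZ k y : ℂ)) :=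
  Summable.of_norm (by simpa only [norm_fourier_term] using hf)

theorem norm_fourierZ_le {f : (Fin d → ℤ) → ℝ} (hf : Summable fun y => |f y|)
    (k : Fin d → ℝ) : ‖fourierZ f k‖ ≤ ∑' y, |f y| := by
  refine (norm_tsum_le_tsum_norm ?_).trans (le_of_eq ?_)
  · simpa only [norm_fourier_term] using hf
  · simp only [norm_fourier_term]

theorem continuous_rdotZ (x : Fin d → ℤ) : Continuous fun k : Fin d → ℝ => rdotZ k x := by
  unfold rdotZ; fun_prop

theorem continuous_fourierZ {f : (Fin d → ℤ) → ℝ} (hf : Summable fun y => |f y|) :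
    Continuous (fourierZ f) := by
  refine continuous_tsum (u := fun y => |f y|) (fun y => ?_) hf fun y k => ?_
  · have := continuous_rdotZ y
    fun_prop
  · rw [norm_fourier_term]

theorem fourierZ_zero (f : (Fin d → ℤ) → ℝ) : fourierZ f 0 = ((∑' y, f y : ℝ) : ℂ) := by
  simp [fourierZ, rdotZ, Complex.ofReal_tsum]

theorem isCompact_torus : IsCompact (torus d) :=
  isCompact_univ_pi fun _ => isCompact_Icc

theorem measurableSet_torus : MeasurableSet (torus d) := isCompact_torus.measurableSet

theorem volume_torus_lt_top : volume (torus d) < ⊤ := isCompact_torus.measure_lt_top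

theorem restrict_torus :
    (volume.restrict (torus d)) = Measure.pi fun _ : Fin d => (volume : Measure ℝ).restrict (Set.Icc (-π) π) := by
  rw [torus, volume_pi, Measure.restrict_pi_pi]

theorem integral_Icc_exp (n : ℤ) :
    ∫ t in Set.Icc (-π) π, Complex.exp (Complex.I * ((t * (n : ℝ) : ℝ) : ℂ)) =
      if n = 0 then ((2 * π : ℝ) : ℂ) else 0 := by
  rw [integral_Icc_eq_integral_Ioc, ← intervalIntegral.integral_of_le (by linarith [Real.pi_pos])]
  split_ifs with h
  · subst h
    simp
    ring
  · have hc : (Complex.I * (n : ℂ)) ≠ 0 := by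
      simp [Complex.I_ne_zero, h]
    have := integral_exp_mul_complex (a := -π) (b := π) hc
    have h2 : ∀ t : ℝ, Complex.exp (Complex.I * ((t * (n : ℝ) : ℝ) : ℂ)) =
        Complex.exp (Complex.I * (n : ℂ) * t) := by
      intro t; push_cast; ring_nf
    simp_rw [h2]
    rw [this, div_eq_zero_iff]
    left
    rw [sub_eq_zero, Complex.exp_eq_exp_iff_exists_int]
    exact ⟨n, by push_cast; ring⟩

theorem integral_torus_exp (x : Fin d → ℤ) :
    ∫ k in torus d, Complex.exp (Complex.I * (rdotZ k x : ℂ)) =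
      if x = 0 then (((2 * π) ^ d : ℝ) : ℂ) else 0 := by
  have h : ∀ k : Fin d → ℝ, Complex.exp (Complex.I * (rdotZ k x : ℂ)) =
      ∏ i, Complex.exp (Complex.I * ((k i * (x i : ℝ) : ℝ) : ℂ)) := by
    intro k
    rw [← Complex.exp_sum, ← Finset.mul_sum, rdotZ, Complex.ofReal_sum]
  simp_rw [h]
  rw [restrict_torus, integral_fintype_prod_eq_prod (𝕜 := ℂ)
    (fun (i : Fin d) (t : ℝ) => Complex.exp (Complex.I * ((t * (x i : ℝ) : ℝ) : ℂ)))]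
  simp_rw [integral_Icc_exp]
  split_ifs with hx
  · subst hx; simp
  · obtain ⟨i, hi⟩ := Function.ne_iff.1 hx
    exact Finset.prod_eq_zero (Finset.mem_univ i) (if_neg (by simpa using hi))

theorem integrableOn_torus {F : (Fin d → ℝ) → ℂ} (hF : Continuous F) :
    IntegrableOn F (torus d) :=
  hF.continuousOn.integrableOn_compact isCompact_torus

theorem rdotZ_sub (k : Fin d → ℝ) (x y : Fin d → ℤ) :
    rdotZ k (x - y) = rdotZ k x - rdotZ k y := by
  simp [rdotZ, mul_sub, Finset.sum_sub_distrib]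

theorem twoPiPow_ne : (((2 * π) ^ d : ℝ) : ℂ) ≠ 0 := by
  have : (2 * π) ^ d ≠ 0 := by positivity
  exact_mod_cast this

theorem invF_fourierZ {f : (Fin d → ℤ) → ℝ} (hf : Summable fun y => |f y|) (x : Fin d → ℤ) :
    invF (fourierZ f) x = f x := by
  have hcont : ∀ y : Fin d → ℤ, Continuous fun k : Fin d → ℝ =>
      Complex.exp (Complex.I * (rdotZ k x : ℂ)) *
        ((f y : ℂ) * Complex.exp (-Complex.I * (rdotZ k y : ℂ))) := by
    intro y
    have := continuous_rdotZ x
    have := continuous_rdotZ y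
    fun_prop
  have hn : ∀ (y : Fin d → ℤ) (k : Fin d → ℝ),
      ‖Complex.exp (Complex.I * (rdotZ k x : ℂ)) *
        ((f y : ℂ) * Complex.exp (-Complex.I * (rdotZ k y : ℂ)))‖ = |f y| := by
    intro y k
    rw [norm_mul, norm_exp_I_mul, one_mul, norm_fourier_term]
  have h1 : ∫ k in torus d, Complex.exp (Complex.I * (rdotZ k x : ℂ)) * fourierZ f k =
      ∑' y, ∫ k in torus d, Complex.exp (Complex.I * (rdotZ k x : ℂ)) *
        ((f y : ℂ) * Complex.exp (-Complex.I * (rdotZ k y : ℂ))) := by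
    rw [integral_tsum_of_summable_integral_norm]
    · refine integral_congr_ae (Eventually.of_forall fun k => ?_)
      simp only [fourierZ]
      rw [tsum_mul_left]
    · intro y; exact integrableOn_torus (hcont y)
    · simp_rw [hn]
      simp only [integral_const, smul_eq_mul]
      exact hf.mul_left _
  have h2 : ∀ y, ∫ k in torus d, Complex.exp (Complex.I * (rdotZ k x : ℂ)) *
        ((f y : ℂ) * Complex.exp (-Complex.I * (rdotZ k y : ℂ))) =
        if y = x then (((2 * π) ^ d : ℝ) : ℂ) * f x else 0 := by
    intro y
    have h3 : ∀ k : Fin d → ℝ, Complex.exp (Complex.I * (rdotZ k x : ℂ)) *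
        ((f y : ℂ) * Complex.exp (-Complex.I * (rdotZ k y : ℂ))) =
        f y * Complex.exp (Complex.I * (rdotZ k (x - y) : ℂ)) := by
      intro k
      rw [mul_left_comm, ← Complex.exp_add, rdotZ_sub]
      push_cast; ring_nf
    simp_rw [h3]
    rw [integral_const_mul, integral_torus_exp]
    simp only [sub_eq_zero, @eq_comm _ x y]
    split_ifs with h
    · rw [h, mul_comm]
    · simp
  rw [invF, h1]
  simp_rw [h2]
  rw [tsum_ite_eq, inv_mul_cancel_left₀ twoPiPow_ne]

theorem norm_invF_le {F : (Fin d → ℝ) → ℂ} {B : (Fin d → ℝ) → ℝ} (x : Fin d → ℤ)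
    (hB : IntegrableOn B (torus d))
    (h : ∀ k ∈ torus d, ‖F k‖ ≤ B k) :
    ‖invF F x‖ ≤ ∫ k in torus d, B k := by
  have h1 : ‖∫ k in torus d, Complex.exp (Complex.I * (rdotZ k x : ℂ)) * F k‖ ≤
      ∫ k in torus d, B k := by
    refine norm_integral_le_of_norm_le hB ?_
    refine (ae_restrict_iff' measurableSet_torus).2 (Eventually.of_forall fun k hk => ?_)
    rw [norm_mul, norm_exp_I_mul, one_mul]
    exact h k hk
  rw [invF, norm_mul, norm_inv, Complex.norm_real, Real.norm_of_nonneg (by positivity)]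
  have h2 : ((2 * π) ^ d)⁻¹ ≤ 1 := by
    apply inv_le_one_of_one_le₀
    apply one_le_pow₀
    linarith [Real.pi_gt_three]
  calc _ ≤ 1 * ∫ k in torus d, B k := by gcongr
    _ = _ := one_mul _

theorem summable_conv_aux {f g : (Fin d → ℤ) → ℝ} (hf : Summable fun y => |f y|)
    (hg : Summable fun y => |g y|) :
    Summable fun p : (Fin d → ℤ) × (Fin d → ℤ) => f (p.1 - p.2) * g p.2 := by
  have h := (summable_mul_of_summable_norm (f := f) (g := g) (by simpa using hf) (by simpa using hg))
  let e : (Fin d → ℤ) × (Fin d → ℤ) ≃ (Fin d → ℤ) × (Fin d → ℤ) :=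
    { toFun := fun p => (p.1 - p.2, p.2)
      invFun := fun p => (p.1 + p.2, p.2)
      left_inv := fun p => by simp
      right_inv := fun p => by simp }
  exact (e.summable_iff (f := fun p : (Fin d → ℤ) × (Fin d → ℤ) => f p.1 * g p.2)).2 h

theorem summable_conv {f g : (Fin d → ℤ) → ℝ} (hf : Summable fun y => |f y|)
    (hg : Summable fun y => |g y|) : Summable fun x => |conv f g x| := by
  exact (summable_conv_aux hf hg).prod.abs

theorem tsum_abs_conv_le {f g : (Fin d → ℤ) → ℝ} (hf : Summable fun y => |f y|)
    (hg : Summable fun y => |g y|) :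
    ∑' x, |conv f g x| ≤ (∑' y, |f y|) * ∑' y, |g y| := by
  have h := summable_conv_aux (f := fun y => |f y|) (g := fun y => |g y|)
    (by simpa using hf) (by simpa using hg)
  have h1 : ∑' x, |conv f g x| ≤ ∑' x, ∑' y, |f (x - y)| * |g y| := by
    refine (summable_conv hf hg).tsum_le_tsum (fun x => ?_) h.prod
    have := norm_tsum_le_tsum_norm (f := fun y => f (x - y) * g y)
      (by simpa [abs_mul] using h.prod_factor x)
    simpa [conv, abs_mul] using this
  refine h1.trans (le_of_eq ?_)
  rw [← Summable.tsum_comm (f := fun x y => |f (x - y)| * |g y|) h, ← tsum_mul_left]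
  congr 1; ext y
  rw [tsum_mul_right]
  congr 1
  exact (Equiv.subRight y).tsum_eq fun x => |f x|

theorem fourierZ_conv {f g : (Fin d → ℤ) → ℝ} (hf : Summable fun y => |f y|)
    (hg : Summable fun y => |g y|) (k : Fin d → ℝ) :
    fourierZ (conv f g) k = fourierZ f k * fourierZ g k := by
  have h := summable_conv_aux hf hg
  have h0 := h.abs
  have h2 : Summable fun p : (Fin d → ℤ) × (Fin d → ℤ) =>
      ((f (p.1 - p.2) : ℂ) * Complex.exp (-Complex.I * (rdotZ k (p.1 - p.2) : ℂ))) *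
        ((g p.2 : ℂ) * Complex.exp (-Complex.I * (rdotZ k p.2 : ℂ))) := by
    refine Summable.of_norm (h0.congr fun p => ?_)
    rw [norm_mul, norm_fourier_term, norm_fourier_term, abs_mul]
  have h3 : fourierZ (conv f g) k = ∑' x, ∑' y,
      ((f (x - y) : ℂ) * Complex.exp (-Complex.I * (rdotZ k (x - y) : ℂ))) *
        ((g y : ℂ) * Complex.exp (-Complex.I * (rdotZ k y : ℂ))) := by
    rw [fourierZ]
    congr 1; ext x
    rw [conv, Complex.ofReal_tsum, ← tsum_mul_right]
    congr 1; ext y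
    rw [mul_mul_mul_comm, ← Complex.exp_add, rdotZ_sub]
    push_cast; ring_nf
  rw [h3, ← Summable.tsum_comm (f := fun x y : Fin d → ℤ =>
    ((f (x - y) : ℂ) * Complex.exp (-Complex.I * (rdotZ k (x - y) : ℂ))) *
        ((g y : ℂ) * Complex.exp (-Complex.I * (rdotZ k y : ℂ)))) h2]
  simp_rw [tsum_mul_right]
  have h4 : ∀ y : Fin d → ℤ, ∑' x, ((f (x - y) : ℂ) * Complex.exp (-Complex.I * (rdotZ k (x - y) : ℂ))) = fourierZ f k := by
    intro y
    exact (Equiv.subRight y).tsum_eq fun x => (f x : ℂ) * Complex.exp (-Complex.I * (rdotZ k x : ℂ))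
  simp_rw [h4]
  rw [tsum_mul_left]; rfl

theorem conv_tilt (f g : (Fin d → ℤ) → ℝ) (l : Fin d → ℝ) :
    conv (tilt f l) (tilt g l) = tilt (conv f g) l := by
  ext x
  simp only [conv, tilt]
  rw [← tsum_mul_right]
  congr 1; ext y
  rw [mul_mul_mul_comm, ← Real.exp_add, rdotZ_sub]
  ring_nf

/-- The exponential `exp(t Q *) g` of the convolution operator. -/
def cexpZ (Q g : (Fin d → ℤ) → ℝ) (t : ℝ) (x : Fin d → ℤ) : ℝ :=
  ∑' n : ℕ, t ^ n / n.factorial * (conv Q)^[n] g x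

theorem summable_iterate {Q g : (Fin d → ℤ) → ℝ} (hQ : Summable fun y => |Q y|)
    (hg : Summable fun y => |g y|) (n : ℕ) : Summable fun y => |(conv Q)^[n] g y| := by
  induction n with
  | zero => simpa using hg
  | succ n ih => simp only [Function.iterate_succ_apply']; exact summable_conv hQ ih

theorem tsum_iterate_le {Q g : (Fin d → ℤ) → ℝ} (hQ : Summable fun y => |Q y|)
    (hg : Summable fun y => |g y|) (n : ℕ) :
    ∑' y, |(conv Q)^[n] g y| ≤ (∑' y, |Q y|) ^ n * ∑' y, |g y| := by
  induction n with
  | zero => simp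
  | succ n ih =>
    simp only [Function.iterate_succ_apply']
    refine (tsum_abs_conv_le hQ (summable_iterate hQ hg n)).trans ?_
    rw [pow_succ', mul_assoc]
    gcongr

theorem fourierZ_iterate {Q g : (Fin d → ℤ) → ℝ} (hQ : Summable fun y => |Q y|)
    (hg : Summable fun y => |g y|) (n : ℕ) (k : Fin d → ℝ) :
    fourierZ ((conv Q)^[n] g) k = fourierZ Q k ^ n * fourierZ g k := by
  induction n with
  | zero => simp
  | succ n ih =>
    rw [Function.iterate_succ_apply', fourierZ_conv hQ (summable_iterate hQ hg n), ih, pow_succ']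
    ring

theorem summable_cexp_aux {Q g : (Fin d → ℤ) → ℝ} (hQ : Summable fun y => |Q y|)
    (hg : Summable fun y => |g y|) {t : ℝ} (ht : 0 ≤ t) :
    Summable fun p : ℕ × (Fin d → ℤ) => |t ^ p.1 / p.1.factorial * (conv Q)^[p.1] g p.2| := by
  rw [summable_prod_of_nonneg (fun p => abs_nonneg _)]
  constructor
  · intro n
    simp only [abs_mul]
    exact (summable_iterate hQ hg n).mul_left _
  · have h1 : Summable fun n : ℕ => (t * ∑' y, |Q y|) ^ n / n.factorial * ∑' y, |g y| :=
      (Real.summable_pow_div_factorial _).mul_right _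
    refine h1.of_nonneg_of_le (fun n => tsum_nonneg fun y => abs_nonneg _) fun n => ?_
    simp only [abs_mul]
    rw [tsum_mul_left, abs_of_nonneg (by positivity), mul_pow, mul_div_right_comm, mul_assoc]
    gcongr
    exact tsum_iterate_le hQ hg n

theorem summable_cexp {Q g : (Fin d → ℤ) → ℝ} (hQ : Summable fun y => |Q y|)
    (hg : Summable fun y => |g y|) {t : ℝ} (ht : 0 ≤ t) : Summable fun y => |cexpZ Q g t y| := by
  have := ((summable_cexp_aux hQ hg ht).of_abs.prod_symm.prod).abs
  exact this

theorem fourierZ_cexp {Q g : (Fin d → ℤ) → ℝ} (hQ : Summable fun y => |Q y|)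
    (hg : Summable fun y => |g y|) {t : ℝ} (ht : 0 ≤ t) (k : Fin d → ℝ) :
    fourierZ (cexpZ Q g t) k = Complex.exp (t * fourierZ Q k) * fourierZ g k := by
  have h := summable_cexp_aux hQ hg ht
  have h2 : Summable fun p : (Fin d → ℤ) × ℕ =>
      ((t ^ p.2 / p.2.factorial * (conv Q)^[p.2] g p.1 : ℝ) : ℂ) *
        Complex.exp (-Complex.I * (rdotZ k p.1 : ℂ)) := by
    refine Summable.of_norm (h.prod_symm.congr fun p => ?_)
    rw [norm_mul, norm_exp_neg_I_mul, mul_one, Complex.norm_real, Real.norm_eq_abs]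
    rfl
  have h3 : fourierZ (cexpZ Q g t) k = ∑' y, ∑' n : ℕ, ((t ^ n / n.factorial * (conv Q)^[n] g y : ℝ) : ℂ) *
        Complex.exp (-Complex.I * (rdotZ k y : ℂ)) := by
    rw [fourierZ]
    congr 1; ext y
    rw [cexpZ, Complex.ofReal_tsum, ← tsum_mul_right]
  rw [h3, ← Summable.tsum_comm (f := fun (y : Fin d → ℤ) (n : ℕ) =>
    ((t ^ n / n.factorial * (conv Q)^[n] g y : ℝ) : ℂ) *
        Complex.exp (-Complex.I * (rdotZ k y : ℂ))) h2]
  have h4 : ∀ n : ℕ, ∑' y, ((t ^ n / n.factorial * (conv Q)^[n] g y : ℝ) : ℂ) *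
        Complex.exp (-Complex.I * (rdotZ k y : ℂ)) =
        ((t * fourierZ Q k) ^ n / n.factorial) * fourierZ g k := by
    intro n
    have : ∀ y, ((t ^ n / n.factorial * (conv Q)^[n] g y : ℝ) : ℂ) *
        Complex.exp (-Complex.I * (rdotZ k y : ℂ)) = ((t:ℂ) ^ n / n.factorial) *
        (((conv Q)^[n] g y : ℂ) * Complex.exp (-Complex.I * (rdotZ k y : ℂ))) := by
      intro y; push_cast; ring
    simp_rw [this]
    rw [tsum_mul_left]
    change _ * fourierZ ((conv Q)^[n] g) k = _
    rw [fourierZ_iterate hQ hg, mul_pow]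
    ring
  simp_rw [h4]
  rw [tsum_mul_right, Complex.exp_eq_exp_ℂ, NormedSpace.exp_eq_tsum_div]

theorem iterate_tilt (Q g : (Fin d → ℤ) → ℝ) (l : Fin d → ℝ) (n : ℕ) :
    (conv (tilt Q l))^[n] (tilt g l) = tilt ((conv Q)^[n] g) l := by
  induction n with
  | zero => rfl
  | succ n ih => rw [Function.iterate_succ_apply', ih, conv_tilt, Function.iterate_succ_apply']

theorem cexpZ_tilt (Q g : (Fin d → ℤ) → ℝ) (l : Fin d → ℝ) (t : ℝ) :
    cexpZ (tilt Q l) (tilt g l) t = tilt (cexpZ Q g t) l := by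
  ext x
  simp only [cexpZ, iterate_tilt]
  rw [tilt, cexpZ, ← tsum_mul_right]
  simp only [tilt, mul_assoc]

theorem tilt_deltaZ (l : Fin d → ℝ) : tilt (deltaZ d) l = deltaZ d := by
  ext x
  by_cases h : x = 0 <;> simp [tilt, deltaZ, h, rdotZ]

theorem summable_deltaZ : Summable fun y => |deltaZ d y| := by
  refine summable_of_ne_finset_zero (s := {0}) fun y hy => ?_
  simp [deltaZ] at hy ⊢
  exact hy

theorem fourierZ_deltaZ (k : Fin d → ℝ) : fourierZ (deltaZ d) k = 1 := by
  rw [fourierZ, tsum_eq_single 0]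
  · simp [deltaZ, rdotZ]
  · intro y hy; simp [deltaZ, hy]

/-- A summable function is determined by its Fourier transform. -/
theorem eq_invF_of_fourierZ {f : (Fin d → ℤ) → ℝ} (hf : Summable fun y => |f y|)
    {F : (Fin d → ℝ) → ℂ} (h : ∀ k, fourierZ f k = F k) (x : Fin d → ℤ) : invF F x = f x := by
  rw [← invF_fourierZ hf, funext h]

theorem sum_sq_le_of_fourier {p : (Fin d → ℤ) → ℝ} (hp : Summable fun y => |p y|)
    {A : ℝ} {B : (Fin d → ℝ) → ℝ} (hB : IntegrableOn B (torus d))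
    (hA : ∀ k ∈ torus d, ‖fourierZ p k‖ ≤ A) (h : ∀ k ∈ torus d, ‖fourierZ p k‖ ≤ B k) :
    ∑' y, p y ^ 2 ≤ A * ∫ k in torus d, B k := by
  have hr : Summable fun y => |p (-y)| := (Equiv.neg (Fin d → ℤ)).summable_iff.2 hp
  have h1 : ∀ k, fourierZ (fun y => p (-y)) k = fourierZ p (-k) := by
    intro k
    rw [fourierZ, ← (Equiv.neg (Fin d → ℤ)).tsum_eq]
    simp [fourierZ, rdotZ]
  have h2 : conv (fun y => p (-y)) p 0 = ∑' y, p y ^ 2 := by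
    simp [conv, sq]
  have h3 : ‖invF (fourierZ (conv (fun y => p (-y)) p)) 0‖ ≤ ∫ k in torus d, A * B k := by
    refine norm_invF_le _ (hB.const_mul A) fun k hk => ?_
    rw [fourierZ_conv hr hp, norm_mul, h1]
    have hk' : -k ∈ torus d := by
      intro i hi
      have := hk i hi
      simp only [Pi.neg_apply, Set.mem_Icc] at this ⊢
      constructor <;> linarith [this.1, this.2]
    exact mul_le_mul (hA _ hk') (h k hk) (norm_nonneg _) ((norm_nonneg _).trans (hA _ hk'))
  rw [invF_fourierZ (summable_conv hr hp), h2, integral_const_mul, Complex.norm_real] at h3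
  exact (le_abs_self _).trans h3

theorem enormR_sq (k : Fin d → ℝ) : enormR k ^ 2 = ∑ i, k i ^ 2 :=
  Real.sq_sqrt (Finset.sum_nonneg fun _ _ => sq_nonneg _)

theorem enormR_nonneg (k : Fin d → ℝ) : 0 ≤ enormR k := Real.sqrt_nonneg _

theorem enormZ_nonneg (k : Fin d → ℤ) : 0 ≤ enormZ k := Real.sqrt_nonneg _

theorem enormR_toR (x : Fin d → ℤ) : enormR (toR x) = enormZ x := rfl

theorem rdot_toR (μ : Fin d → ℝ) (x : Fin d → ℤ) : rdot μ (toR x) = rdotZ μ x := rfl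

theorem continuous_enormR : Continuous fun k : Fin d → ℝ => enormR k := by
  unfold enormR; fun_prop

theorem integral_gaussian_enormR (b : ℝ) (hb : 0 < b) :
    ∫ k : Fin d → ℝ, Real.exp (-b * enormR k ^ 2) = (π / b) ^ ((d : ℝ) / 2) := by
  have h : ∀ k : Fin d → ℝ, Real.exp (-b * enormR k ^ 2) = ∏ i, Real.exp (-b * k i ^ 2) := by
    intro k
    rw [← Real.exp_sum, ← Finset.mul_sum, enormR_sq]
  simp_rw [h]
  rw [integral_fintype_prod_volume_eq_pow (fun t : ℝ => Real.exp (-b * t ^ 2)), integral_gaussian,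
    Fintype.card_fin, Real.sqrt_eq_rpow, ← Real.rpow_natCast, ← Real.rpow_mul (by positivity)]
  ring_nf

theorem integrable_gaussian_enormR (b : ℝ) (hb : 0 < b) :
    Integrable fun k : Fin d → ℝ => Real.exp (-b * enormR k ^ 2) := by
  have h : ∀ k : Fin d → ℝ, Real.exp (-b * enormR k ^ 2) = ∏ i, Real.exp (-b * k i ^ 2) := by
    intro k
    rw [← Real.exp_sum, ← Finset.mul_sum, enormR_sq]
  simp_rw [h]
  exact Integrable.fintype_prod (f := fun (_ : Fin d) (t : ℝ) => Real.exp (-b * t ^ 2))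
    fun i => integrable_exp_neg_mul_sq hb

theorem integral_torus_gaussian_le (b : ℝ) (hb : 0 < b) :
    ∃ C : ℝ, 0 < C ∧ ∀ t : ℝ, 0 ≤ t →
      ∫ k in torus d, Real.exp (-(t * b) * enormR k ^ 2) ≤ C * (max 1 t) ^ (-(d : ℝ) / 2) := by
  have hvol : 0 ≤ (volume (torus d)).toReal := ENNReal.toReal_nonneg
  have hpow : 0 < (π / b) ^ ((d : ℝ) / 2) := by positivity
  refine ⟨(volume (torus d)).toReal + (π / b) ^ ((d : ℝ) / 2), by positivity, fun t ht => ?_⟩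
  rcases le_total t 1 with h | h
  · rw [max_eq_left h, Real.one_rpow, mul_one]
    have : ∫ k in torus d, Real.exp (-(t * b) * enormR k ^ 2) ≤ ∫ k in torus d, (1 : ℝ) := by
      refine integral_mono_of_nonneg (Eventually.of_forall fun k => by positivity) ?_
        (Eventually.of_forall fun k => ?_)
      · exact integrableOn_const (by exact volume_torus_lt_top.ne)
      · simp only [Real.exp_le_one_iff]
        have : 0 ≤ t * b * enormR k ^ 2 := by positivity
        linarith
    refine this.trans ?_
    simp [Measure.real]
    exact hpow.le
  · rw [max_eq_right h]
    have ht' : 0 < t := by linarith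
    have h1 : ∫ k in torus d, Real.exp (-(t * b) * enormR k ^ 2) ≤
        ∫ k : Fin d → ℝ, Real.exp (-(t * b) * enormR k ^ 2) :=
      setIntegral_le_integral (integrable_gaussian_enormR _ (by positivity))
        (Eventually.of_forall fun k => by positivity)
    rw [integral_gaussian_enormR _ (by positivity)] at h1
    refine h1.trans ?_
    have h2 : (π / (t * b)) ^ ((d : ℝ) / 2) = (π / b) ^ ((d : ℝ) / 2) * t ^ (-(d : ℝ) / 2) := by
      rw [neg_div, Real.rpow_neg ht'.le, mul_comm t b, ← div_div, Real.div_rpow (by positivity) ht'.le,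
        div_eq_mul_inv]
    rw [h2]
    gcongr
    linarith

/-- Two-sided quadratic form bounds for a symmetric matrix. -/
structure FormBounds (a b : ℝ) (Λ : Matrix (Fin d) (Fin d) ℝ) : Prop where
  symm : Λ.IsSymm
  lower : ∀ v, a * enormR v ^ 2 ≤ rdot v (Λ *ᵥ v)
  upper : ∀ v, rdot v (Λ *ᵥ v) ≤ b * enormR v ^ 2

theorem rdot_eq_dotProduct (v w : Fin d → ℝ) : rdot v w = v ⬝ᵥ w := rfl

theorem enormR_sq_eq_dotProduct (v : Fin d → ℝ) : enormR v ^ 2 = v ⬝ᵥ v := by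
  rw [enormR_sq]; simp [dotProduct, sq]

theorem enormR_eq_norm (v : Fin d → ℝ) : enormR v = ‖WithLp.toLp 2 v‖ := by
  rw [EuclideanSpace.norm_eq]; simp [enormR]

theorem abs_rdot_le (v w : Fin d → ℝ) : |rdot v w| ≤ enormR v * enormR w := by
  have := abs_real_inner_le_norm (WithLp.toLp 2 w : EuclideanSpace ℝ (Fin d)) (WithLp.toLp 2 v)
  rw [← enormR_eq_norm, ← enormR_eq_norm, mul_comm] at this
  simpa [rdot, PiLp.inner_apply, dotProduct] using this

theorem enormR_pos {v : Fin d → ℝ} (h : v ≠ 0) : 0 < enormR v := by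
  rw [enormR_eq_norm, norm_pos_iff]
  simpa using h

theorem FormBounds.posDef {a b : ℝ} (ha : 0 < a) {Λ : Matrix (Fin d) (Fin d) ℝ}
    (h : FormBounds a b Λ) : Λ.PosDef := by
  refine Matrix.PosDef.of_dotProduct_mulVec_pos (by
    rw [Matrix.IsHermitian, Matrix.conjTranspose_eq_transpose_of_trivial]; exact h.symm) fun v hv => ?_
  have h1 := h.lower v
  have h2 := enormR_pos hv
  rw [star_trivial]
  rw [rdot_eq_dotProduct] at h1
  have : 0 < a * enormR v ^ 2 := by positivity
  linarith


open scoped MatrixOrder in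
theorem exists_symm_sqrt {Λ : Matrix (Fin d) (Fin d) ℝ} (hΛ : Λ.PosDef) :
    ∃ B : Matrix (Fin d) (Fin d) ℝ, Bᵀ = B ∧ B * B = Λ := by
  refine ⟨CFC.sqrt Λ, ?_, CFC.sqrt_mul_sqrt_self Λ hΛ.posSemidef.nonneg⟩
  have := (CFC.sqrt_nonneg Λ).posSemidef.1
  rwa [Matrix.IsHermitian, Matrix.conjTranspose_eq_transpose_of_trivial] at this

theorem gaussian_fourier_matrix {Λ : Matrix (Fin d) (Fin d) ℝ} (hΛ : Λ.PosDef) (w : Fin d → ℝ)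
    {t : ℝ} (ht : 0 < t) :
    ((((2 * π) ^ d : ℝ) : ℂ)⁻¹ * ∫ k : Fin d → ℝ, Complex.exp (Complex.I * (rdot k w : ℂ)) *
      Complex.exp (-((t / 2 * rdot k (Λ *ᵥ k) : ℝ) : ℂ))) =
    (((1 / Real.sqrt Λ.det) * (1 / (2 * π * t) ^ ((d : ℝ) / 2)) *
      Real.exp (-(1 / (2 * t)) * rdot w (Λ⁻¹ *ᵥ w)) : ℝ) : ℂ) := by
  obtain ⟨B, hBs, hBB⟩ := exists_symm_sqrt hΛ
  have hdet : B.det ^ 2 = Λ.det := by rw [← hBB, Matrix.det_mul, sq]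
  have hdpos := hΛ.det_pos
  have hB0 : B.det ≠ 0 := by
    intro h; rw [h] at hdet; norm_num at hdet; linarith
  have hBu : IsUnit B.det := isUnit_iff_ne_zero.2 hB0
  set w' : Fin d → ℝ := B⁻¹ *ᵥ w with hw'
  have hBw : B *ᵥ w' = w := by
    rw [hw', Matrix.mulVec_mulVec, Matrix.mul_nonsing_inv _ hBu, Matrix.one_mulVec]
  let f : (Fin d → ℝ) → ℂ := fun l =>
    Complex.exp (-((t / 2 : ℝ) : ℂ) * ∑ i, (l i : ℂ) ^ 2 + ∑ i, (Complex.I * (w' i : ℂ)) * l i)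
  have hf : Continuous f := by fun_prop
  have h1 : ∀ k : Fin d → ℝ, Complex.exp (Complex.I * (rdot k w : ℂ)) *
      Complex.exp (-((t / 2 * rdot k (Λ *ᵥ k) : ℝ) : ℂ)) = f (Matrix.toLin' B k) := by
    intro k
    rw [← Complex.exp_add]
    simp only [f, Matrix.toLin'_apply]
    congr 1
    have e1 : rdot k w = ∑ i, w' i * (B *ᵥ k) i := by
      rw [← hBw]
      change k ⬝ᵥ (B *ᵥ w') = w' ⬝ᵥ (B *ᵥ k)
      rw [dotProduct_mulVec, ← Matrix.mulVec_transpose, hBs, dotProduct_comm]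
    have e2 : rdot k (Λ *ᵥ k) = ∑ i, (B *ᵥ k) i ^ 2 := by
      rw [← hBB, ← Matrix.mulVec_mulVec]
      change k ⬝ᵥ (B *ᵥ (B *ᵥ k)) = _
      rw [dotProduct_mulVec, ← Matrix.mulVec_transpose, hBs]
      simp [dotProduct, sq]
    rw [e1, e2]
    push_cast
    rw [Finset.mul_sum, add_comm]
    congr 1
    · ring
    · exact Finset.sum_congr rfl fun i _ => by ring
  simp_rw [h1]
  have hmap := Real.map_matrix_volume_pi_eq_smul_volume_pi hB0
  have hmeas : AEMeasurable (Matrix.toLin' B) (volume : Measure (Fin d → ℝ)) :=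
    (LinearMap.continuous_of_finiteDimensional _).measurable.aemeasurable
  have h2 : ∫ k : Fin d → ℝ, f (Matrix.toLin' B k) = ((|B.det|⁻¹ : ℝ) : ℂ) * ∫ l, f l := by
    rw [← MeasureTheory.integral_map hmeas hf.aestronglyMeasurable, hmap, integral_smul_measure,
      ENNReal.toReal_ofReal (abs_nonneg _), abs_inv, Complex.real_smul]
  rw [h2]
  simp only [f]
  rw [GaussianFourier.integral_cexp_neg_mul_sum_add (by simpa using ht) (fun i => Complex.I * (w' i : ℂ))]
  have h3 : rdot w (Λ⁻¹ *ᵥ w) = ∑ i, w' i ^ 2 := by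
    have : Λ⁻¹ = B⁻¹ * B⁻¹ := by rw [← hBB, Matrix.mul_inv_rev]
    rw [this, ← Matrix.mulVec_mulVec]
    change w ⬝ᵥ (B⁻¹ *ᵥ (B⁻¹ *ᵥ w)) = _
    rw [dotProduct_mulVec, ← Matrix.mulVec_transpose, Matrix.transpose_nonsing_inv, hBs]
    simp [dotProduct, sq, hw']
  have h4 : Real.sqrt Λ.det = |B.det| := by rw [← hdet, Real.sqrt_sq_eq_abs]
  rw [h3, h4]
  have h5 : Complex.exp ((∑ i, (Complex.I * (w' i : ℂ)) ^ 2) / (4 * ((t / 2 : ℝ) : ℂ))) =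
      ((Real.exp (-(1 / (2 * t)) * ∑ i, w' i ^ 2) : ℝ) : ℂ) := by
    rw [Complex.ofReal_exp]
    congr 1
    push_cast
    simp_rw [mul_pow, Complex.I_sq]
    rw [← Finset.mul_sum]
    have : (t : ℂ) ≠ 0 := by exact_mod_cast ht.ne'
    field_simp
    norm_num
  rw [h5]
  have h6 : ((π : ℂ) / ((t / 2 : ℝ) : ℂ)) ^ ((Fintype.card (Fin d) : ℂ) / 2) =
      (((π / (t / 2)) ^ ((d : ℝ) / 2) : ℝ) : ℂ) := by
    rw [Complex.ofReal_cpow (by positivity)]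
    simp
  rw [h6]
  have h7 : (π / (t / 2)) ^ ((d : ℝ) / 2) = (2 * π) ^ d * (1 / (2 * π * t) ^ ((d : ℝ) / 2)) := by
    have : π / (t / 2) = (2 * π) ^ (2:ℝ) / (2 * π * t) := by
      rw [Real.rpow_two]; field_simp
    rw [this, Real.div_rpow (by positivity) (by positivity), ← Real.rpow_mul (by positivity)]
    rw [show (2 : ℝ) * ((d : ℝ) / 2) = d by ring, Real.rpow_natCast]
    ring
  rw [h7]
  have := @twoPiPow_ne d
  push_cast at this ⊢
  field_simp

theorem FormBounds.mulVec_inv_bounds {a b : ℝ} (ha : 0 < a) (hb : 0 < b)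
    {Λ : Matrix (Fin d) (Fin d) ℝ}
    (h : FormBounds a b Λ) (w : Fin d → ℝ) :
    rdot w (Λ⁻¹ *ᵥ w) ≤ enormR w ^ 2 / a ∧ enormR w ^ 2 / b ≤ rdot w (Λ⁻¹ *ᵥ w) := by
  have hu : IsUnit Λ.det := isUnit_iff_ne_zero.2 (h.posDef ha).det_pos.ne'
  set v : Fin d → ℝ := Λ⁻¹ *ᵥ w with hv
  have hw : Λ *ᵥ v = w := by
    rw [hv, Matrix.mulVec_mulVec, Matrix.mul_nonsing_inv _ hu, Matrix.one_mulVec]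
  have e0 : rdot w v = rdot v (Λ *ᵥ v) := by
    rw [hw]; exact dotProduct_comm _ _
  have h1 := h.lower v
  have h2 := (abs_le.1 (abs_rdot_le w v)).2
  have nw := enormR_nonneg w
  have nv := enormR_nonneg v
  constructor
  · rw [le_div_iff₀ ha, e0] at *
    have h3 : a * enormR v ≤ enormR w := by
      rcases nv.eq_or_lt with h0 | h0
      · rw [← h0]; simpa using nw
      · nlinarith
    nlinarith
  · have key : ∀ s : ℝ, 0 ≤ rdot (v - s • w) (Λ *ᵥ (v - s • w)) := fun s =>
      le_trans (by positivity) (h.lower _)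
    have hexp : ∀ s : ℝ, rdot (v - s • w) (Λ *ᵥ (v - s • w)) =
        rdot w v - 2 * s * enormR w ^ 2 + s ^ 2 * rdot w (Λ *ᵥ w) := by
      intro s
      rw [enormR_sq_eq_dotProduct]
      simp only [rdot_eq_dotProduct, Matrix.mulVec_sub, Matrix.mulVec_smul, hw, sub_dotProduct,
        dotProduct_sub, smul_dotProduct, dotProduct_smul, smul_eq_mul]
      have : v ⬝ᵥ (Λ *ᵥ w) = w ⬝ᵥ w := by
        rw [dotProduct_mulVec, ← Matrix.mulVec_transpose, h.symm.eq, hw]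
      rw [this, dotProduct_comm v w]
      ring
    have k1 := key (1 / b)
    rw [hexp] at k1
    have h4 := h.upper w
    have h5 : (1 / b) ^ 2 * rdot w (Λ *ᵥ w) ≤ (1 / b) ^ 2 * (b * enormR w ^ 2) := by gcongr
    have h6 : (1 / b) ^ 2 * (b * enormR w ^ 2) = enormR w ^ 2 / b := by field_simp
    have h7 : 2 * (1 / b) * enormR w ^ 2 = 2 * (enormR w ^ 2 / b) := by ring
    linarith

theorem FormBounds.det_bounds {a b : ℝ} (ha : 0 < a)
    {Λ : Matrix (Fin d) (Fin d) ℝ} (h : FormBounds a b Λ) :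
    a ^ d ≤ Λ.det ∧ Λ.det ≤ b ^ d := by
  have hp := h.posDef ha
  have hH := hp.1
  have hdet := hH.det_eq_prod_eigenvalues
  have hev : ∀ i, a ≤ hH.eigenvalues i ∧ hH.eigenvalues i ≤ b := by
    intro i
    have e := hH.eigenvalues_eq i
    have hn : enormR (hH.eigenvectorBasis i).ofLp = 1 := by
      rw [enormR_eq_norm]; simp
    have l := h.lower (hH.eigenvectorBasis i).ofLp
    have u := h.upper (hH.eigenvectorBasis i).ofLp
    rw [hn] at l u
    simp only [star_trivial, RCLike.re_to_real] at e
    rw [rdot_eq_dotProduct, ← e] at l u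
    constructor <;> linarith
  simp only [RCLike.ofReal_real_eq_id, id] at hdet
  rw [hdet]
  constructor
  · calc a ^ d = ∏ i : Fin d, a := by simp
      _ ≤ _ := Finset.prod_le_prod (fun _ _ => ha.le) fun i _ => (hev i).1
  · calc ∏ i : Fin d, hH.eigenvalues i ≤ ∏ i : Fin d, b :=
        Finset.prod_le_prod (fun i _ => ha.le.trans (hev i).1) fun i _ => (hev i).2
      _ = _ := by simp

/-- Upper Gaussian bound for the heat kernel. -/
theorem FormBounds.heatKer_le {a b : ℝ} (ha : 0 < a) (hb : 0 < b)
    {Λ : Matrix (Fin d) (Fin d) ℝ} (h : FormBounds a b Λ) {t : ℝ} (ht : 0 < t) (x η : Fin d → ℝ) :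
    heatKer d t x η Λ ≤ 1 / Real.sqrt (a ^ d) * (1 / (2 * π * t) ^ ((d : ℝ) / 2)) *
      Real.exp (-(enormR (x - t • η) ^ 2 / (2 * b * t))) := by
  unfold heatKer
  have h1 := (h.mulVec_inv_bounds ha hb (x - t • η)).2
  have h2 := (h.det_bounds ha).1
  gcongr
  calc -(1 / (2 * t)) * rdot (x - t • η) (Λ⁻¹ *ᵥ (x - t • η))
      ≤ -(1 / (2 * t)) * (enormR (x - t • η) ^ 2 / b) := by
        apply mul_le_mul_of_nonpos_left h1
        have : 0 < 1 / (2 * t) := by positivity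
        linarith
    _ = _ := by field_simp

/-- Lower Gaussian bound for the heat kernel. -/
theorem FormBounds.le_heatKer {a b : ℝ} (ha : 0 < a) (hb : 0 < b)
    {Λ : Matrix (Fin d) (Fin d) ℝ} (h : FormBounds a b Λ) {t : ℝ} (ht : 0 < t) (x η : Fin d → ℝ) :
    1 / Real.sqrt (b ^ d) * (1 / (2 * π * t) ^ ((d : ℝ) / 2)) *
      Real.exp (-(enormR (x - t • η) ^ 2 / (2 * a * t))) ≤ heatKer d t x η Λ := by
  unfold heatKer
  have h1 := (h.mulVec_inv_bounds ha hb (x - t • η)).1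
  have h2 := (h.det_bounds ha).2
  have h3 := (h.posDef ha).det_pos
  gcongr
  calc -(1 / (2 * t)) * rdot (x - t • η) (Λ⁻¹ *ᵥ (x - t • η))
      ≥ -(1 / (2 * t)) * (enormR (x - t • η) ^ 2 / a) := by
        apply mul_le_mul_of_nonpos_left h1
        have : 0 < 1 / (2 * t) := by positivity
        linarith
    _ = _ := by field_simp

theorem FormBounds.heatKer_pos {a b : ℝ} (ha : 0 < a)
    {Λ : Matrix (Fin d) (Fin d) ℝ} (h : FormBounds a b Λ) {t : ℝ} (ht : 0 < t) (x η : Fin d → ℝ) :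
    0 < heatKer d t x η Λ := by
  unfold heatKer
  have := (h.posDef ha).det_pos
  positivity

/-- Drift vector of a kernel. -/
def drift (Q : (Fin d → ℤ) → ℝ) : Fin d → ℝ := fun j => ∑' y, (y j : ℝ) * Q y

/-- Quantitative assumptions on a (tilted) kernel with total mass at most one. -/
structure Kern (M K : ℝ) (Q : (Fin d → ℤ) → ℝ) : Prop where
  one_le : 1 ≤ M
  K_pos : 0 < K
  summable : Summable fun y => |Q y|
  summable_sq : Summable fun y => enormZ y ^ 2 * |Q y|
  sq_le : ∑' y, enormZ y ^ 2 * |Q y| ≤ M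
  infrared : ∀ k ∈ torus d, K * enormR k ^ 2 ≤ (fourierZ Q 0 - fourierZ Q k).re
  le_one : ∑' y, Q y ≤ 1

theorem abs_rdotZ_le (k : Fin d → ℝ) (y : Fin d → ℤ) : |rdotZ k y| ≤ enormR k * enormZ y :=
  abs_rdot_le k (toR y)

theorem enormZ_zero : enormZ (0 : Fin d → ℤ) = 0 := by simp [enormZ]

theorem one_le_enormZ {y : Fin d → ℤ} (hy : y ≠ 0) : 1 ≤ enormZ y := by
  obtain ⟨i, hi⟩ := Function.ne_iff.1 hy
  have h1 : (1 : ℝ) ≤ (y i : ℝ) ^ 2 := by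
    have : (1 : ℤ) ≤ y i ^ 2 := by
      have := sq_pos_of_ne_zero (a := y i) hi
      omega
    exact_mod_cast this
  have h2 : (y i : ℝ) ^ 2 ≤ ∑ j, (y j : ℝ) ^ 2 :=
    Finset.single_le_sum (f := fun j => (y j : ℝ) ^ 2) (fun j _ => sq_nonneg _) (Finset.mem_univ i)
  rw [enormZ, Real.le_sqrt (by norm_num) (by positivity)]
  linarith

theorem abs_coord_le (y : Fin d → ℤ) (j : Fin d) : |(y j : ℝ)| ≤ enormZ y := by
  rw [← Real.sqrt_sq_eq_abs]
  exact Real.sqrt_le_sqrt (Finset.single_le_sum (f := fun j => (y j : ℝ) ^ 2)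
    (fun j _ => sq_nonneg _) (Finset.mem_univ j))

theorem enormZ_le_sq (y : Fin d → ℤ) : enormZ y ≤ enormZ y ^ 2 := by
  by_cases hy : y = 0
  · simp [hy, enormZ_zero]
  · nlinarith [one_le_enormZ hy]

theorem summable_enormZ_mul {Q : (Fin d → ℤ) → ℝ} (h : Summable fun y => enormZ y ^ 2 * |Q y|) :
    Summable fun y => enormZ y * |Q y| :=
  h.of_nonneg_of_le (fun y => mul_nonneg (enormZ_nonneg y) (abs_nonneg _))
    fun y => mul_le_mul_of_nonneg_right (enormZ_le_sq y) (abs_nonneg _)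

theorem summable_coord_mul {Q : (Fin d → ℤ) → ℝ} (h : Summable fun y => enormZ y ^ 2 * |Q y|)
    (j : Fin d) : Summable fun y => (y j : ℝ) * Q y := by
  refine Summable.of_norm_bounded (summable_enormZ_mul h) fun y => ?_
  rw [Real.norm_eq_abs, abs_mul]
  exact mul_le_mul_of_nonneg_right (abs_coord_le y j) (abs_nonneg _)

theorem hasSum_rdotZ_mul {Q : (Fin d → ℤ) → ℝ} (h : Summable fun y => enormZ y ^ 2 * |Q y|)
    (l : Fin d → ℝ) : HasSum (fun y => rdotZ l y * Q y) (rdot l (drift Q)) := by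
  have := hasSum_sum (s := Finset.univ)
    (fun j _ => ((summable_coord_mul h j).hasSum.mul_left (l j)))
  have e : (fun y => rdotZ l y * Q y) = fun y => ∑ i, l i * ((y i : ℝ) * Q y) := by
    ext y
    simp only [rdotZ, Finset.sum_mul, mul_assoc]
  rw [e]
  exact this

theorem hasSum_re_fourierZ {f : (Fin d → ℤ) → ℝ} (hf : Summable fun y => |f y|) (k : Fin d → ℝ) :
    HasSum (fun y => f y * Real.cos (rdotZ k y)) (fourierZ f k).re := by
  have h := Complex.hasSum_re (summable_fourier_term hf k).hasSum
  convert h using 1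
  · ext y
    rw [Complex.re_ofReal_mul]
    congr 1
    rw [show -Complex.I * (rdotZ k y : ℂ) = ((-rdotZ k y : ℝ) : ℂ) * Complex.I by push_cast; ring,
      Complex.exp_ofReal_mul_I_re, Real.cos_neg]
  · rfl

/-- Truncation of a kernel to the ball of radius `N`. -/
def trunc (Q : (Fin d → ℤ) → ℝ) (N : ℝ) (y : Fin d → ℤ) : ℝ := if enormZ y ≤ N then Q y else 0

theorem summable_trunc {Q : (Fin d → ℤ) → ℝ} (h : Summable fun y => |Q y|) (N : ℝ) :
    Summable fun y => |trunc Q N y| := by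
  refine h.of_nonneg_of_le (fun y => abs_nonneg _) fun y => ?_
  unfold trunc; split_ifs <;> simp

theorem summable_tilt_trunc {Q : (Fin d → ℤ) → ℝ} (h : Summable fun y => |Q y|) (N : ℝ)
    (l : Fin d → ℝ) : Summable fun y => |tilt (trunc Q N) l y| := by
  refine (h.mul_right (Real.exp (enormR l * N))).of_nonneg_of_le (fun y => abs_nonneg _) fun y => ?_
  unfold tilt trunc
  split_ifs with hy
  · rw [abs_mul, Real.abs_exp]
    gcongr
    exact (le_abs_self _).trans ((abs_rdotZ_le l y).trans (by gcongr; exact enormR_nonneg l))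
  · simp; positivity

theorem Kern.re_tilt_trunc {M K : ℝ} {Q : (Fin d → ℤ) → ℝ} (h : Kern M K Q) {N : ℝ} (hN : 1 ≤ N)
    {l : Fin d → ℝ} (hl : enormR l * N ≤ min 1 (K / (2 * M))) {k : Fin d → ℝ} (hk : k ∈ torus d) :
    (fourierZ (tilt (trunc Q N) l) k).re ≤
      1 - K / 2 * enormR k ^ 2 + rdot l (drift Q) + 2 * M / N ^ 2 := by
  have hM := h.one_le
  have hK := h.K_pos
  have hN0 : 0 < N := by linarith
  set c := min 1 (K / (2 * M)) with hc
  have hc0 : 0 ≤ c := by positivity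
  have hl1 : enormR l * N ≤ 1 := hl.trans (min_le_left _ _)
  have hcM : c * M ≤ K / 2 := by
    calc c * M ≤ K / (2 * M) * M := by gcongr; exact min_le_right _ _
      _ = K / 2 := by field_simp
  have H1 := hasSum_re_fourierZ (summable_tilt_trunc h.summable N l) k
  have H2 := ((hasSum_re_fourierZ h.summable k).add (hasSum_rdotZ_mul h.summable_sq l)).add
    (h.summable_sq.hasSum.mul_left (2 / N ^ 2 + c * enormR k ^ 2))
  have H3 := hasSum_le (fun y => ?_) H1 H2
  · have h4 := h.infrared k hk
    rw [Complex.sub_re, fourierZ_zero, Complex.ofReal_re] at h4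
    have h5 : (2 / N ^ 2 + c * enormR k ^ 2) * ∑' y, enormZ y ^ 2 * |Q y| ≤
        (2 / N ^ 2 + c * enormR k ^ 2) * M := by
      gcongr; exact h.sq_le
    have h6 : (2 / N ^ 2 + c * enormR k ^ 2) * M = 2 * M / N ^ 2 + c * M * enormR k ^ 2 := by ring
    have h7 : c * M * enormR k ^ 2 ≤ K / 2 * enormR k ^ 2 := by gcongr
    linarith [h.le_one]
  · set u := rdotZ l y with hu
    set v := rdotZ k y with hv
    have hul : |u| ≤ enormR l * enormZ y := abs_rdotZ_le l y
    have hvl : |v| ≤ enormR k * enormZ y := abs_rdotZ_le k y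
    have hl2 : enormR l ≤ c / N := by rwa [le_div_iff₀ hN0]
    have hl3 : enormR l ≤ 1 / N := by rwa [le_div_iff₀ hN0]
    have nl := enormR_nonneg l
    have ny := enormZ_nonneg y
    have nk := enormR_nonneg k
    have hQ := abs_nonneg (Q y)
    have cos1 := Real.cos_le_one v
    have cos2 := Real.neg_one_le_cos v
    by_cases hy : enormZ y ≤ N
    · have hu1 : |u| ≤ c := hul.trans ((by gcongr : enormR l * enormZ y ≤ enormR l * N).trans hl)
      have hu2 : |u| ≤ 1 := hu1.trans (min_le_left _ _)
      have hu3 : |u| ≤ 1 / N * enormZ y := hul.trans (by gcongr)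
      have e1 := Real.abs_exp_sub_one_sub_id_le hu2
      have e2 : |Real.exp u - 1| ≤ 2 * |u| := Real.abs_exp_sub_one_le hu2
      have c1 : 1 - Real.cos v ≤ v ^ 2 / 2 := by linarith [Real.one_sub_sq_div_two_le_cos (x := v)]
      have c2 : v ^ 2 ≤ enormR k ^ 2 * enormZ y ^ 2 := by
        rw [← mul_pow, ← sq_abs]; gcongr
      have u2 : u ^ 2 ≤ 1 / N ^ 2 * enormZ y ^ 2 := by
        rw [← _root_.one_div_pow, ← mul_pow, ← sq_abs]; gcongr
      simp only [tilt, trunc, if_pos hy]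
      rw [← hu]
      have key : Q y * ((Real.exp u - 1 - u) - (Real.exp u - 1) * (1 - Real.cos v)) ≤
          |Q y| * (u ^ 2 + 2 * |u| * (v ^ 2 / 2)) := by
        refine (le_abs_self _).trans ?_
        rw [abs_mul]
        gcongr
        refine (abs_sub _ _).trans ?_
        rw [abs_mul, abs_of_nonneg (by linarith : 0 ≤ 1 - Real.cos v)]
        gcongr
      have key2 : |Q y| * (u ^ 2 + 2 * |u| * (v ^ 2 / 2)) ≤
          |Q y| * ((2 / N ^ 2 + c * enormR k ^ 2) * enormZ y ^ 2) := by
        gcongr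
        have : 2 * |u| * (v ^ 2 / 2) ≤ c * (enormR k ^ 2 * enormZ y ^ 2) := by
          have : |u| * v ^ 2 ≤ c * (enormR k ^ 2 * enormZ y ^ 2) := by gcongr
          linarith
        have h0 : 0 ≤ 1 / N ^ 2 * enormZ y ^ 2 := by positivity
        have : (2 / N ^ 2 + c * enormR k ^ 2) * enormZ y ^ 2 = 2 * (1 / N ^ 2 * enormZ y ^ 2) +
          c * (enormR k ^ 2 * enormZ y ^ 2) := by ring
        linarith
      nlinarith
    · push Not at hy
      simp only [tilt, trunc, if_neg hy.not_ge]
      have hu3 : |u| ≤ 1 / N * enormZ y := hul.trans (by gcongr)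
      have r1 : 1 ≤ 1 / N * enormZ y := by
        rw [one_div, inv_mul_eq_div, le_div_iff₀ hN0]; linarith
      have r2 : 1 / N * enormZ y ≤ 1 / N ^ 2 * enormZ y ^ 2 := by
        rw [← _root_.one_div_pow, ← mul_pow]; nlinarith
      have key : -(|Q y| * (1 + |u|)) ≤ Q y * (Real.cos v + u) := by
        refine le_trans ?_ (neg_abs_le _)
        rw [abs_mul]
        gcongr
        exact (abs_add_le _ _).trans (by gcongr; exact Real.abs_cos_le_one v)
      have key2 : |Q y| * (1 + |u|) ≤ |Q y| * ((2 / N ^ 2 + c * enormR k ^ 2) * enormZ y ^ 2) := by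
        gcongr
        have : (2 / N ^ 2 + c * enormR k ^ 2) * enormZ y ^ 2 = 2 * (1 / N ^ 2 * enormZ y ^ 2) +
          c * (enormR k ^ 2 * enormZ y ^ 2) := by ring
        have : 0 ≤ c * (enormR k ^ 2 * enormZ y ^ 2) := by positivity
        linarith
      nlinarith

/-- The truncated continuous-time heat kernel. -/
def pker (Q : (Fin d → ℤ) → ℝ) (t : ℝ) (z : Fin d → ℤ) : ℝ :=
  Real.exp (-t) * cexpZ (trunc Q (Real.sqrt (max 1 t))) (deltaZ d) t z

theorem summable_pker {Q : (Fin d → ℤ) → ℝ} (h : Summable fun y => |Q y|) {t : ℝ} (ht : 0 ≤ t) :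
    Summable fun z => |pker Q t z| := by
  simp only [pker, abs_mul]
  exact (summable_cexp (summable_trunc h _) summable_deltaZ ht).mul_left _

theorem fourierZ_const_mul (c : ℝ) (f : (Fin d → ℤ) → ℝ) (k : Fin d → ℝ) :
    fourierZ (fun y => c * f y) k = c * fourierZ f k := by
  simp only [fourierZ, Complex.ofReal_mul, mul_assoc]
  rw [tsum_mul_left]

theorem tilt_pker (Q : (Fin d → ℤ) → ℝ) (t : ℝ) (l : Fin d → ℝ) :
    tilt (pker Q t) l = fun z =>
      Real.exp (-t) * cexpZ (tilt (trunc Q (Real.sqrt (max 1 t))) l) (deltaZ d) t z := by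
  conv_rhs => rw [← tilt_deltaZ l, cexpZ_tilt]
  ext z
  simp only [tilt, pker, mul_assoc]

theorem fourierZ_tilt_pker {Q : (Fin d → ℤ) → ℝ} (h : Summable fun y => |Q y|) {t : ℝ}
    (ht : 0 ≤ t) (l k : Fin d → ℝ) :
    fourierZ (tilt (pker Q t) l) k =
      Complex.exp (-t * (1 - fourierZ (tilt (trunc Q (Real.sqrt (max 1 t))) l) k)) := by
  rw [tilt_pker, fourierZ_const_mul, fourierZ_cexp (summable_tilt_trunc h _ l) summable_deltaZ ht,
    fourierZ_deltaZ, mul_one, Complex.ofReal_exp, ← Complex.exp_add]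
  congr 1
  push_cast; ring

theorem summable_tilt_pker {Q : (Fin d → ℤ) → ℝ} (h : Summable fun y => |Q y|) {t : ℝ}
    (ht : 0 ≤ t) (l : Fin d → ℝ) : Summable fun z => |tilt (pker Q t) l z| := by
  rw [tilt_pker]
  simp only [abs_mul]
  exact (summable_cexp (summable_tilt_trunc h _ l) summable_deltaZ ht).mul_left _

theorem Kern.norm_fourier_tilt_pker_le {M K : ℝ} {Q : (Fin d → ℤ) → ℝ} (h : Kern M K Q) {t : ℝ}
    (ht : 0 ≤ t) {l : Fin d → ℝ} (hl : enormR l * Real.sqrt (max 1 t) ≤ min 1 (K / (2 * M)))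
    {k : Fin d → ℝ} (hk : k ∈ torus d) :
    ‖fourierZ (tilt (pker Q t) l) k‖ ≤
      Real.exp (t * rdot l (drift Q) + 2 * M) * Real.exp (-(t * (K / 2)) * enormR k ^ 2) := by
  rw [fourierZ_tilt_pker h.summable ht, Complex.norm_exp, ← Real.exp_add, Real.exp_le_exp]
  have hN : 1 ≤ Real.sqrt (max 1 t) := by
    rw [Real.one_le_sqrt]; exact le_max_left _ _
  have h1 := h.re_tilt_trunc hN hl hk
  rw [Real.sq_sqrt (by positivity)] at h1
  rw [← Complex.ofReal_neg, Complex.re_ofReal_mul, Complex.sub_re, Complex.one_re]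
  have h2 : t * (2 * M / max 1 t) ≤ 2 * M := by
    rw [mul_div_assoc', div_le_iff₀ (by positivity), mul_comm]
    have := h.one_le
    gcongr
    exact le_max_right _ _
  nlinarith [mul_le_mul_of_nonneg_left h1 ht]

theorem continuous_gaussian_enormR (b : ℝ) :
    Continuous fun k : Fin d → ℝ => Real.exp (b * enormR k ^ 2) := by
  have := @continuous_enormR d
  fun_prop

theorem integrableOn_torus_real {F : (Fin d → ℝ) → ℝ} (hF : Continuous F) :
    IntegrableOn F (torus d) :=
  hF.continuousOn.integrableOn_compact isCompact_torus

/-- Gaussian-exponential bounds for the truncated heat kernel. -/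
theorem exists_pker_bound (d : ℕ) (M K : ℝ) (hM : 1 ≤ M) (hK : 0 < K) :
    ∃ C c : ℝ, 0 < C ∧ 0 < c ∧ ∀ Q : (Fin d → ℤ) → ℝ, Kern M K Q → ∀ t : ℝ, 0 ≤ t →
      (∀ z, |pker Q t z| ≤ C * (max 1 t) ^ (-(d : ℝ) / 2) *
        Real.exp (-(c * enormR (toR z - t • drift Q) / Real.sqrt (max 1 t)))) ∧
      ∑' z, pker Q t z ^ 2 ≤ C * (max 1 t) ^ (-(d : ℝ) / 2) := by
  obtain ⟨C₀, hC₀, H⟩ := integral_torus_gaussian_le (d := d) (K / 2) (by positivity)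
  set c := min 1 (K / (2 * M)) with hc
  have hc0 : 0 < c := by positivity
  have he : 1 ≤ Real.exp (2 * M) := Real.one_le_exp (by linarith)
  refine ⟨Real.exp (2 * M) * Real.exp (2 * M) * C₀, c, by positivity, hc0, fun Q hQ t ht => ⟨fun z => ?_, ?_⟩⟩
  · set N := Real.sqrt (max 1 t) with hN
    have hN1 : 1 ≤ N := by rw [hN, Real.one_le_sqrt]; exact le_max_left _ _
    have hN0 : 0 < N := by linarith
    set w : Fin d → ℝ := toR z - t • drift Q with hw
    obtain ⟨l, hl1, hl2⟩ : ∃ l : Fin d → ℝ, enormR l * N ≤ c ∧ rdot l w = c * enormR w / N := by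
      by_cases h0 : w = 0
      · exact ⟨0, by simp [enormR, hc0.le], by simp [h0, enormR, rdot]⟩
      · have hw0 := enormR_pos h0
        refine ⟨(c / N / enormR w) • w, ?_, ?_⟩
        · have : enormR ((c / N / enormR w) • w) = c / N := by
            rw [enormR_eq_norm, WithLp.toLp_smul, norm_smul, ← enormR_eq_norm, Real.norm_of_nonneg
              (by positivity)]
            field_simp
          rw [this]; field_simp; exact le_rfl
        · rw [rdot_eq_dotProduct, smul_dotProduct, ← enormR_sq_eq_dotProduct, smul_eq_mul]
          field_simp
    have h1 : |tilt (pker Q t) l z| ≤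
        Real.exp (t * rdot l (drift Q) + 2 * M) * (C₀ * (max 1 t) ^ (-(d : ℝ) / 2)) := by
      have h2 := norm_invF_le (F := fourierZ (tilt (pker Q t) l)) z
        (integrableOn_torus_real ((continuous_gaussian_enormR (-(t * (K / 2)))).const_mul
          (Real.exp (t * rdot l (drift Q) + 2 * M))))
        (fun k hk => hQ.norm_fourier_tilt_pker_le ht hl1 hk)
      rw [invF_fourierZ (summable_tilt_pker hQ.summable ht l), Complex.norm_real,
        integral_const_mul] at h2
      refine h2.trans ?_
      gcongr
      exact H t ht
    have h3 : pker Q t z = tilt (pker Q t) l z * Real.exp (-rdotZ l z) := by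
      rw [tilt, mul_assoc, ← Real.exp_add]; simp
    rw [h3, abs_mul, Real.abs_exp]
    have h4 : rdotZ l z = t * rdot l (drift Q) + c * enormR w / N := by
      rw [← hl2, hw, ← rdot_toR]
      simp only [rdot_eq_dotProduct, dotProduct_sub, dotProduct_smul, smul_eq_mul]
      ring
    calc |tilt (pker Q t) l z| * Real.exp (-rdotZ l z)
        ≤ Real.exp (t * rdot l (drift Q) + 2 * M) * (C₀ * (max 1 t) ^ (-(d : ℝ) / 2)) *
          Real.exp (-rdotZ l z) := by gcongr
      _ = Real.exp (2 * M) * C₀ * (max 1 t) ^ (-(d : ℝ) / 2) *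
          Real.exp (-(c * enormR w / N)) := by
        have : Real.exp (t * rdot l (drift Q) + 2 * M) * Real.exp (-rdotZ l z) =
          Real.exp (2 * M) * Real.exp (-(c * enormR w / N)) := by
          rw [← Real.exp_add, ← Real.exp_add, h4]; congr 1; ring
        linear_combination (C₀ * (max 1 t) ^ (-(d : ℝ) / 2)) * this
      _ ≤ _ := by
        gcongr
        nlinarith [Real.exp_pos (2 * M)]
  · have hp : tilt (pker Q t) 0 = pker Q t := by ext; simp [tilt, rdotZ]
    have h1 : ∀ k ∈ torus d, ‖fourierZ (pker Q t) k‖ ≤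
        Real.exp (2 * M) * Real.exp (-(t * (K / 2)) * enormR k ^ 2) := by
      intro k hk
      have := hQ.norm_fourier_tilt_pker_le ht (l := 0) (by simp [enormR]; positivity) hk
      simpa [hp, rdot] using this
    have h2 := sum_sq_le_of_fourier (A := Real.exp (2 * M)) (summable_pker hQ.summable ht)
      (integrableOn_torus_real ((continuous_gaussian_enormR (-(t * (K / 2)))).const_mul
        (Real.exp (2 * M)))) (fun k hk => (h1 k hk).trans ?_) h1
    · rw [integral_const_mul] at h2
      refine h2.trans ?_
      rw [mul_assoc _ C₀, mul_assoc]
      gcongr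
      exact H t ht
    · have : Real.exp (-(t * (K / 2)) * enormR k ^ 2) ≤ 1 := by
        rw [Real.exp_le_one_iff]
        have : 0 ≤ t * (K / 2) * enormR k ^ 2 := by positivity
        linarith
      nlinarith [Real.exp_pos (2 * M)]

section WeightedIteration

variable {G : Type*} [AddCommGroup G]

/-- Iterated convolution of extended nonnegative functions. -/
def eiter (q g : G → ℝ≥0∞) : ℕ → G → ℝ≥0∞
  | 0 => g
  | j + 1 => fun z => ∑' w, q (z - w) * eiter q g j w

theorem tsum_eiter_le (q g : G → ℝ≥0∞) (j : ℕ) :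
    ∑' z, eiter q g j z ≤ (∑' z, q z) ^ j * ∑' z, g z := by
  induction j with
  | zero => simp [eiter]
  | succ j ih =>
    simp only [eiter]
    rw [ENNReal.tsum_comm]
    have : ∀ w, ∑' z, q (z - w) * eiter q g j w = (∑' z, q z) * eiter q g j w := fun w => by
      rw [ENNReal.tsum_mul_right, ← (Equiv.subRight w).tsum_eq q]; rfl
    simp_rw [this]
    rw [ENNReal.tsum_mul_left, pow_succ', mul_assoc]
    gcongr

theorem weighted_eiter_le (q g W P : G → ℝ≥0∞) {c a b₀ b₁ : ℝ≥0∞}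
    (hW : ∀ z w, W (z + w) ≤ c * (W z + W w)) (hc : 1 ≤ c) (hq : c * ∑' z, q z ≤ a)
    (hb₀ : ∀ x, ∑' z, W z * g z * P (x - z) ≤ b₀) (hb₁ : ∀ x, ∑' z, W z * q z * P (x - z) ≤ b₁)
    (j : ℕ) (x : G) :
    ∑' z, W z * eiter q g j z * P (x - z) ≤
      a ^ j * b₀ + j * a ^ (j - 1) * (c * (∑' z, g z) * b₁) := by
  have hq' : ∑' z, q z ≤ a := le_trans (le_mul_of_one_le_left' hc) hq
  induction j generalizing x with
  | zero => simpa [eiter] using hb₀ x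
  | succ j ih =>
    set V := eiter q g j with hV
    have h1 : ∑' z, W z * eiter q g (j + 1) z * P (x - z) ≤
        ∑' z, ∑' w, (c * (V w * (W (z - w) * q (z - w) * P (x - z))) +
          c * (q (z - w) * (W w * V w * P (x - z)))) := by
      refine ENNReal.tsum_le_tsum fun z => ?_
      simp only [eiter]
      rw [← ENNReal.tsum_mul_left, ← ENNReal.tsum_mul_right]
      refine ENNReal.tsum_le_tsum fun w => ?_
      have := hW (z - w) w
      rw [sub_add_cancel] at this
      calc W z * (q (z - w) * V w) * P (x - z)
          ≤ (c * (W (z - w) + W w)) * (q (z - w) * V w) * P (x - z) := by gcongr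
        _ = _ := by ring
    refine h1.trans ?_
    simp_rw [ENNReal.tsum_add, ENNReal.tsum_mul_left]
    have h2 : ∑' z, ∑' w, V w * (W (z - w) * q (z - w) * P (x - z)) ≤ (∑' w, V w) * b₁ := by
      rw [ENNReal.tsum_comm, ← ENNReal.tsum_mul_right]
      refine ENNReal.tsum_le_tsum fun w => ?_
      rw [ENNReal.tsum_mul_left]
      gcongr
      refine le_trans (le_of_eq ?_) (hb₁ (x - w))
      rw [← (Equiv.addRight w).tsum_eq]
      refine tsum_congr fun z => ?_
      simp only [Equiv.coe_addRight, add_sub_cancel_right]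
      rw [sub_sub, add_comm w z]
    have h3 : ∑' z, ∑' w, q (z - w) * (W w * V w * P (x - z)) ≤
        (∑' z, q z) * (a ^ j * b₀ + j * a ^ (j - 1) * (c * (∑' z, g z) * b₁)) := by
      have : ∀ z, ∑' w, q (z - w) * (W w * V w * P (x - z)) =
          ∑' v, q v * (W (z - v) * V (z - v) * P (x - z)) := fun z => by
        rw [← (Equiv.subLeft z).tsum_eq]
        simp
      simp_rw [this]
      rw [ENNReal.tsum_comm, ← ENNReal.tsum_mul_right]
      refine ENNReal.tsum_le_tsum fun v => ?_
      rw [ENNReal.tsum_mul_left]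
      gcongr
      refine le_trans (le_of_eq ?_) (ih (x - v))
      rw [← (Equiv.addRight v).tsum_eq]
      refine tsum_congr fun z => ?_
      simp only [Equiv.coe_addRight, add_sub_cancel_right]
      rw [sub_sub, add_comm v z]
    have h4 : ∑' w, V w ≤ a ^ j * ∑' z, g z :=
      (tsum_eiter_le q g j).trans (by gcongr)
    calc c * ∑' z, ∑' w, V w * (W (z - w) * q (z - w) * P (x - z)) +
          c * ∑' z, ∑' w, q (z - w) * (W w * V w * P (x - z))
        ≤ c * ((a ^ j * ∑' z, g z) * b₁) +
          c * ((∑' z, q z) * (a ^ j * b₀ + j * a ^ (j - 1) * (c * (∑' z, g z) * b₁))) := by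
          gcongr
          exact h2.trans (by gcongr)
      _ = a ^ j * (c * (∑' z, g z) * b₁) +
          (c * ∑' z, q z) * (a ^ j * b₀ + j * a ^ (j - 1) * (c * (∑' z, g z) * b₁)) := by ring
      _ ≤ a ^ j * (c * (∑' z, g z) * b₁) +
          a * (a ^ j * b₀ + j * a ^ (j - 1) * (c * (∑' z, g z) * b₁)) := by gcongr
      _ = _ := by
        rcases j with _ | j
        · simp; ring
        · push_cast
          ring

end WeightedIteration

theorem young_bounded {a φ b p : ℝ} (ha : 0 ≤ a) (hφ : 0 ≤ φ) (hb : 0 < b) (hφb : φ ≤ b)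
    (hp : 1 ≤ p) (hp2 : p ≤ 2) : a * φ ≤ b ^ (1 / p) * (a ^ p + φ ^ 2 / b) := by
  rcases hp.eq_or_lt with rfl | hp1
  · have : 0 ≤ φ ^ 2 / b := by positivity
    simp only [Real.rpow_one, div_one]
    nlinarith [mul_le_mul_of_nonneg_left hφb ha, mul_nonneg hb.le this]
  · have hc := Real.HolderConjugate.conjExponent hp1
    set p' := Real.conjExponent p with hp'
    have hp'2 : 2 ≤ p' := by
      rw [hp', Real.conjExponent, le_div_iff₀ (by linarith)]; linarith
    set ψ := φ / b with hψ
    have hψ0 : 0 ≤ ψ := by positivity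
    have hψ1 : ψ ≤ 1 := by rw [hψ, div_le_one hb]; exact hφb
    have hy := Real.young_inequality_of_nonneg ha (mul_nonneg (Real.rpow_nonneg hb.le (1 / p')) hψ0) hc
    have hb1 : b = b ^ (1 / p) * b ^ (1 / p') := by
      rw [← Real.rpow_add hb, one_div, one_div, hc.inv_add_inv_eq_one, Real.rpow_one]
    have e1 : a * φ = b ^ (1 / p) * (a * (b ^ (1 / p') * ψ)) := by
      have : φ = b * ψ := by rw [hψ]; field_simp
      rw [this]; nth_rewrite 1 [hb1]; ring
    rw [e1]
    have hp0 : (0:ℝ) < p' := by linarith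
    have e2 : (b ^ (1 / p') * ψ) ^ p' = b * ψ ^ p' := by
      rw [Real.mul_rpow (Real.rpow_nonneg hb.le _) hψ0, ← Real.rpow_mul hb.le,
        one_div_mul_cancel hp0.ne', Real.rpow_one]
    have e3 : ψ ^ p' ≤ ψ ^ 2 := by
      rw [← Real.rpow_two]
      exact Real.rpow_le_rpow_of_exponent_ge_of_imp hψ0 hψ1 hp'2 (fun _ h => by linarith)
    have e4 : φ ^ 2 / b = b * ψ ^ 2 := by rw [hψ]; field_simp
    rw [e2] at hy
    have h1 : a ^ p / p ≤ a ^ p := div_le_self (Real.rpow_nonneg ha _) hp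
    have h2 : b * ψ ^ p' / p' ≤ b * ψ ^ p' :=
      div_le_self (mul_nonneg hb.le (Real.rpow_nonneg hψ0 _)) (by linarith)
    rw [e4]
    gcongr
    have : b * ψ ^ p' ≤ b * ψ ^ 2 := by gcongr
    linarith

/-- Convolution of an `ℓ^p` function with a bounded square-summable one. -/
theorem tsum_conv_le_of_lpNorm {f φ : (Fin d → ℤ) → ℝ} {b p M : ℝ} (hb : 0 < b) (hM : 0 ≤ M)
    (hφ : ∀ z, |φ z| ≤ b) (hs : Summable fun z => |φ z|) (hφ2 : ∑' z, φ z ^ 2 ≤ b)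
    (hp : 1 ≤ p) (hp2 : p ≤ 2) (hf : lpNorm f p ≤ ENNReal.ofReal M) (x : Fin d → ℤ) :
    ∑' z, ENNReal.ofReal |f z| * ENNReal.ofReal |φ (x - z)| ≤
      ENNReal.ofReal (b ^ (1 / p) * (M ^ p + 1)) := by
  have h1 : ∑' z, ENNReal.ofReal (|f z| ^ p) ≤ ENNReal.ofReal (M ^ p) := by
    have := ENNReal.rpow_le_rpow hf (by linarith : 0 ≤ p)
    rwa [lpNorm, ← ENNReal.rpow_mul, one_div_mul_cancel (by linarith), ENNReal.rpow_one,
      ENNReal.ofReal_rpow_of_nonneg hM (by linarith)] at this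
  have hs2 : Summable fun z => φ z ^ 2 := by
    refine (hs.mul_left b).of_nonneg_of_le (fun z => sq_nonneg _) fun z => ?_
    rw [← sq_abs, sq]
    exact mul_le_mul_of_nonneg_right (hφ z) (abs_nonneg _)
  have h2 : ∑' z, ENNReal.ofReal (φ (x - z) ^ 2 / b) ≤ 1 := by
    have := (Equiv.subLeft x).tsum_eq fun z => ENNReal.ofReal (φ z ^ 2 / b)
    simp only [Equiv.subLeft_apply] at this
    rw [this, ← ENNReal.ofReal_tsum_of_nonneg (fun z => by positivity) (hs2.div_const b),
      tsum_div_const, ENNReal.ofReal_le_one, div_le_one hb]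
    exact hφ2
  calc ∑' z, ENNReal.ofReal |f z| * ENNReal.ofReal |φ (x - z)|
      ≤ ∑' z, ENNReal.ofReal (b ^ (1 / p)) * (ENNReal.ofReal (|f z| ^ p) +
          ENNReal.ofReal (φ (x - z) ^ 2 / b)) := by
        refine ENNReal.tsum_le_tsum fun z => ?_
        rw [← ENNReal.ofReal_mul (abs_nonneg _), ← ENNReal.ofReal_add (by positivity) (by positivity),
          ← ENNReal.ofReal_mul (by positivity)]
        apply ENNReal.ofReal_le_ofReal
        have := young_bounded (abs_nonneg (f z)) (abs_nonneg (φ (x - z))) hb (hφ _) hp hp2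
        rwa [sq_abs] at this
    _ ≤ ENNReal.ofReal (b ^ (1 / p)) * (ENNReal.ofReal (M ^ p) + 1) := by
        rw [ENNReal.tsum_mul_left, ENNReal.tsum_add]
        gcongr
    _ = _ := by
        rw [ENNReal.ofReal_mul (by positivity), ENNReal.ofReal_add (by positivity) (by norm_num),
          ENNReal.ofReal_one]

theorem tsum_ofReal_exp {a t : ℝ} (ha : 0 ≤ a) (ht : 0 ≤ t) :
    ∑' j : ℕ, ENNReal.ofReal (t ^ j / j.factorial) * ENNReal.ofReal a ^ j =
      ENNReal.ofReal (Real.exp (t * a)) := by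
  have h : HasSum (fun j : ℕ => (t * a) ^ j / j.factorial) (Real.exp (t * a)) := by
    have := NormedSpace.expSeries_div_hasSum_exp (t * a)
    rwa [← Real.exp_eq_exp_ℝ] at this
  rw [← h.tsum_eq, ENNReal.ofReal_tsum_of_nonneg (fun j => by positivity) h.summable]
  refine tsum_congr fun j => ?_
  rw [← ENNReal.ofReal_pow ha, ← ENNReal.ofReal_mul (by positivity), mul_pow]
  congr 1; ring

theorem tsum_ofReal_exp_deriv {a t : ℝ} (ha : 0 ≤ a) (ht : 0 ≤ t) :
    ∑' j : ℕ, ENNReal.ofReal (t ^ j / j.factorial) * (j * ENNReal.ofReal a ^ (j - 1)) =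
      ENNReal.ofReal (t * Real.exp (t * a)) := by
  rw [tsum_eq_zero_add' ENNReal.summable]
  simp only [Nat.cast_zero, zero_mul, mul_zero, zero_add]
  rw [ENNReal.ofReal_mul ht, ← tsum_ofReal_exp ha ht, ← ENNReal.tsum_mul_left]
  refine tsum_congr fun j => ?_
  rw [Nat.add_sub_cancel, ← mul_assoc, ← mul_assoc, ← ENNReal.ofReal_natCast,
    ← ENNReal.ofReal_mul (by positivity), ← ENNReal.ofReal_mul (by positivity)]
  congr 2
  rw [Nat.factorial_succ, pow_succ]
  push_cast
  field_simp

/-- The Fourier integral of the continuous-time semigroup with generator `Q - 1`. -/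
def semiI (Q g : (Fin d → ℤ) → ℝ) (t : ℝ) (x : Fin d → ℤ) : ℂ :=
  invF (fun k => Complex.exp (-t * (1 - fourierZ Q k)) * fourierZ g k) x

theorem fourierZ_add {f g : (Fin d → ℤ) → ℝ} (hf : Summable fun y => |f y|)
    (hg : Summable fun y => |g y|) (k : Fin d → ℝ) :
    fourierZ (fun y => f y + g y) k = fourierZ f k + fourierZ g k := by
  simp only [fourierZ]
  rw [← (summable_fourier_term hf k).tsum_add (summable_fourier_term hg k)]
  refine tsum_congr fun y => ?_
  push_cast; ring

theorem summable_sub_trunc {Q : (Fin d → ℤ) → ℝ} (h : Summable fun y => |Q y|) (N : ℝ) :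
    Summable fun y => |Q y - trunc Q N y| :=
  (h.of_abs.sub (summable_trunc h N).of_abs).abs

theorem semiI_eq_conv {Q g : (Fin d → ℤ) → ℝ} (hQ : Summable fun y => |Q y|)
    (hg : Summable fun y => |g y|) {t : ℝ} (ht : 0 ≤ t) (x : Fin d → ℤ) :
    semiI Q g t x = ((conv (pker Q t)
      (cexpZ (fun y => Q y - trunc Q (Real.sqrt (max 1 t)) y) g t) x : ℝ) : ℂ) := by
  have h1 := summable_pker hQ ht
  have h2 := summable_sub_trunc hQ (Real.sqrt (max 1 t))
  have h3 := summable_cexp h2 hg ht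
  refine eq_invF_of_fourierZ (summable_conv h1 h3) (fun k => ?_) x
  have hp : tilt (pker Q t) 0 = pker Q t := by ext; simp [tilt, rdotZ]
  have hq : tilt (trunc Q (Real.sqrt (max 1 t))) 0 = trunc Q (Real.sqrt (max 1 t)) := by
    ext; simp [tilt, rdotZ]
  rw [fourierZ_conv h1 h3, fourierZ_cexp h2 hg ht, ← mul_assoc]
  congr 1
  have h4 := fourierZ_tilt_pker hQ ht 0 k
  rw [hp, hq] at h4
  have h5 := fourierZ_add (summable_trunc hQ (Real.sqrt (max 1 t))) h2 k
  simp only [add_sub_cancel] at h5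
  rw [h4, ← Complex.exp_add]
  congr 1
  rw [show fourierZ Q k = fourierZ (fun y => Q y) k from rfl, h5]
  ring

theorem ofReal_abs_tsum_le {ι : Type*} (f : ι → ℝ) :
    ENNReal.ofReal |∑' i, f i| ≤ ∑' i, ENNReal.ofReal |f i| := by
  have := enorm_tsum_le_tsum_enorm (f := f)
  simpa [Real.enorm_eq_ofReal_abs] using this

theorem ofReal_abs_iterate_le (Q g : (Fin d → ℤ) → ℝ) (j : ℕ) (z : Fin d → ℤ) :
    ENNReal.ofReal |(conv Q)^[j] g z| ≤
      eiter (fun y => ENNReal.ofReal |Q y|) (fun y => ENNReal.ofReal |g y|) j z := by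
  induction j generalizing z with
  | zero => simp [eiter]
  | succ j ih =>
    rw [Function.iterate_succ_apply', conv, eiter]
    refine (ofReal_abs_tsum_le _).trans (ENNReal.tsum_le_tsum fun w => ?_)
    rw [abs_mul, ENNReal.ofReal_mul (abs_nonneg _)]
    gcongr
    exact ih w

theorem ofReal_abs_cexpZ_le (Q g : (Fin d → ℤ) → ℝ) {t : ℝ} (ht : 0 ≤ t) (z : Fin d → ℤ) :
    ENNReal.ofReal |cexpZ Q g t z| ≤ ∑' j : ℕ, ENNReal.ofReal (t ^ j / j.factorial) *
      eiter (fun y => ENNReal.ofReal |Q y|) (fun y => ENNReal.ofReal |g y|) j z := by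
  refine (ofReal_abs_tsum_le _).trans (ENNReal.tsum_le_tsum fun j => ?_)
  rw [abs_mul, ENNReal.ofReal_mul (abs_nonneg _), abs_of_nonneg (by positivity)]
  gcongr
  exact ofReal_abs_iterate_le Q g j z

theorem enormR_add_le (v w : Fin d → ℝ) : enormR (v + w) ≤ enormR v + enormR w := by
  simp only [enormR_eq_norm, WithLp.toLp_add]
  exact norm_add_le _ _

theorem pow_add_le_two_pow {a b : ℝ} (ha : 0 ≤ a) (hb : 0 ≤ b) (n : ℕ) :
    (a + b) ^ n ≤ 2 ^ n * (a ^ n + b ^ n) := by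
  have h1 : a + b ≤ 2 * max a b := by
    linarith [le_max_left a b, le_max_right a b]
  calc (a + b) ^ n ≤ (2 * max a b) ^ n := by gcongr
    _ = 2 ^ n * (max a b) ^ n := mul_pow _ _ _
    _ ≤ 2 ^ n * (a ^ n + b ^ n) := by
      gcongr
      rcases max_choice a b with h | h <;> rw [h]
      · linarith [pow_nonneg hb n]
      · linarith [pow_nonneg ha n]

theorem toR_add (z w : Fin d → ℤ) : toR (z + w) = toR z + toR w := by
  ext i; simp [toR]

theorem Kern.tail_sub_trunc {M K : ℝ} {Q : (Fin d → ℤ) → ℝ} (h : Kern M K Q) {N : ℝ} (hN : 1 ≤ N) :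
    ∑' y, ENNReal.ofReal |Q y - trunc Q N y| ≤ ENNReal.ofReal (M / N ^ 2) := by
  have hN0 : 0 < N := by linarith
  have h1 : ∀ y, |Q y - trunc Q N y| ≤ enormZ y ^ 2 * |Q y| / N ^ 2 := by
    intro y
    unfold trunc
    split_ifs with hy
    · simp; positivity
    · push Not at hy
      rw [sub_zero, le_div_iff₀ (by positivity), mul_comm]
      gcongr
  calc ∑' y, ENNReal.ofReal |Q y - trunc Q N y|
      ≤ ∑' y, ENNReal.ofReal (enormZ y ^ 2 * |Q y| / N ^ 2) :=
        ENNReal.tsum_le_tsum fun y => ENNReal.ofReal_le_ofReal (h1 y)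
    _ = ENNReal.ofReal (∑' y, enormZ y ^ 2 * |Q y| / N ^ 2) :=
        (ENNReal.ofReal_tsum_of_nonneg (fun y => by positivity) (h.summable_sq.div_const _)).symm
    _ ≤ _ := by
        apply ENNReal.ofReal_le_ofReal
        rw [tsum_div_const]
        gcongr
        exact h.sq_le

theorem abs_sub_trunc_le (Q : (Fin d → ℤ) → ℝ) (N : ℝ) (y : Fin d → ℤ) :
    |Q y - trunc Q N y| ≤ |Q y| := by
  unfold trunc; split_ifs <;> simp

set_option maxHeartbeats 1600000 in
/-- Polynomial decay of the semigroup away from the drift. -/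
theorem exists_tail_bound (d n : ℕ) (M K p q : ℝ) (hM : 1 ≤ M) (hK : 0 < K) (hp : 1 ≤ p)
    (hp2 : p ≤ 2) (hq : 1 ≤ q) (hq2 : q ≤ 2) :
    ∃ C : ℝ, 0 < C ∧ ∀ Q g : (Fin d → ℤ) → ℝ, Kern M K Q → (Summable fun y => |g y|) →
      ∑' y, |g y| ≤ M → lpNorm (fun y => enormZ y ^ n * Q y) p ≤ ENNReal.ofReal M →
      lpNorm (fun y => enormZ y ^ n * g y) q ≤ ENNReal.ofReal M → ∀ t : ℝ, 0 ≤ t →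
      ∀ x : Fin d → ℤ, enormR (toR x - t • drift Q) ^ n * ‖semiI Q g t x‖ ≤
        C * ((max 1 t) ^ (((n : ℝ) - d) / 2) + t * (max 1 t) ^ (-(d : ℝ) / (2 * p)) +
          (max 1 t) ^ (-(d : ℝ) / (2 * q))) := by
  obtain ⟨C₀, c, hC₀, hc, HP⟩ := exists_pker_bound d M K hM hK
  set C₁ := C₀ + 1 with hC₁
  have hC₁1 : 1 ≤ C₁ := by linarith
  set E := Real.exp (2 ^ n * M) with hE
  have hE0 : 0 < E := Real.exp_pos _
  refine ⟨2 ^ n * E * (C₀ * n.factorial / c ^ n * M + C₁ * (M ^ 2 + 1) +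
    2 ^ n * M * (C₁ * (M ^ 2 + 1))), by positivity, fun Q g hQ hg hgM hQp hgq t ht x => ?_⟩
  obtain ⟨P1, P2⟩ := HP Q hQ t ht
  set τ := max 1 t with hτ
  have hτ1 : 1 ≤ τ := le_max_left _ _
  have hτ0 : 0 < τ := by linarith
  set N := Real.sqrt τ with hN
  have hN1 : 1 ≤ N := by rw [hN, Real.one_le_sqrt]; exact hτ1
  have hN0 : 0 < N := by linarith
  have hNsq : N ^ 2 = τ := Real.sq_sqrt hτ0.le
  set b := C₁ * τ ^ (-(d : ℝ) / 2) with hb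
  have hb0 : 0 < b := by positivity
  have hbp : ∀ s : ℝ, 1 ≤ s → s ≤ 2 → b ^ (1 / s) * (M ^ s + 1) ≤
      C₁ * (M ^ 2 + 1) * τ ^ (-(d : ℝ) / (2 * s)) := by
    intro s hs hs2
    have e1 : b ^ (1 / s) ≤ C₁ * τ ^ (-(d : ℝ) / (2 * s)) := by
      rw [hb, Real.mul_rpow (by linarith) (by positivity), ← Real.rpow_mul hτ0.le]
      have : C₁ ^ (1 / s) ≤ C₁ := by
        calc C₁ ^ (1 / s) ≤ C₁ ^ (1 : ℝ) := by
              apply Real.rpow_le_rpow_of_exponent_le hC₁1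
              rw [div_le_one (by linarith)]; exact hs
          _ = C₁ := Real.rpow_one _
      rw [show -(d : ℝ) / 2 * (1 / s) = -(d : ℝ) / (2 * s) by field_simp]
      gcongr
    have e2 : M ^ s ≤ M ^ 2 := by
      rw [← Real.rpow_two]; exact Real.rpow_le_rpow_of_exponent_le hM hs2
    calc _ ≤ (C₁ * τ ^ (-(d : ℝ) / (2 * s))) * (M ^ 2 + 1) := by gcongr
      _ = _ := by ring
  have hPb : ∀ z, |pker Q t z| ≤ b := by
    intro z
    refine (P1 z).trans ?_
    have : Real.exp (-(c * enormR (toR z - t • drift Q) / N)) ≤ 1 := by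
      rw [Real.exp_le_one_iff, neg_nonpos]
      have := enormR_nonneg (toR z - t • drift Q)
      positivity
    calc _ ≤ C₀ * τ ^ (-(d : ℝ) / 2) * 1 := by gcongr
      _ ≤ b := by rw [mul_one, hb]; gcongr; linarith
  have hP2b : ∑' z, pker Q t z ^ 2 ≤ b := P2.trans (by rw [hb]; gcongr; linarith)
  have hPs := summable_pker hQ.summable ht
  set Q₂ := fun y => Q y - trunc Q N y with hQ₂
  set W : (Fin d → ℤ) → ℝ≥0∞ := fun z => ENNReal.ofReal (enormZ z ^ n) with hW
  set P : (Fin d → ℤ) → ℝ≥0∞ := fun z => ENNReal.ofReal |pker Q t z| with hP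
  set V := eiter (fun y => ENNReal.ofReal |Q₂ y|) (fun y => ENNReal.ofReal |g y|) with hV
  have hWsub : ∀ z w, W (z + w) ≤ ENNReal.ofReal (2 ^ n) * (W z + W w) := by
    intro z w
    simp only [hW]
    rw [← ENNReal.ofReal_add (pow_nonneg (enormZ_nonneg _) _) (pow_nonneg (enormZ_nonneg _) _),
      ← ENNReal.ofReal_mul (by positivity)]
    apply ENNReal.ofReal_le_ofReal
    refine le_trans ?_ (pow_add_le_two_pow (enormZ_nonneg z) (enormZ_nonneg w) n)
    have := enormR_add_le (toR z) (toR w)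
    rw [← toR_add, enormR_toR, enormR_toR, enormR_toR] at this
    exact pow_le_pow_left₀ (enormZ_nonneg _) this n
  set a : ℝ := 2 ^ n * (M / τ) with ha
  have ha0 : 0 ≤ a := by positivity
  have hta : t * a ≤ 2 ^ n * M := by
    rw [ha]
    have : t / τ ≤ 1 := by rw [div_le_one hτ0]; exact le_max_right _ _
    calc t * (2 ^ n * (M / τ)) = 2 ^ n * M * (t / τ) := by ring
      _ ≤ 2 ^ n * M * 1 := by gcongr
      _ = _ := mul_one _
  have hexp : Real.exp (t * a) ≤ E := by rw [hE]; gcongr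
  have htail : ∑' y, ENNReal.ofReal |Q₂ y| ≤ ENNReal.ofReal (M / τ) := by
    rw [← hNsq]; exact hQ.tail_sub_trunc hN1
  have hqa : ENNReal.ofReal (2 ^ n) * ∑' y, ENNReal.ofReal |Q₂ y| ≤ ENNReal.ofReal a := by
    rw [ha, ENNReal.ofReal_mul (by positivity)]
    gcongr
  have hqa' : ∑' y, ENNReal.ofReal |Q₂ y| ≤ ENNReal.ofReal a := by
    refine htail.trans (ENNReal.ofReal_le_ofReal ?_)
    rw [ha]
    have : (1 : ℝ) ≤ 2 ^ n := one_le_pow₀ (by norm_num)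
    have : 0 ≤ M / τ := by positivity
    nlinarith
  have hgE : ∑' y, ENNReal.ofReal |g y| ≤ ENNReal.ofReal M := by
    rw [← ENNReal.ofReal_tsum_of_nonneg (fun y => abs_nonneg _) hg]
    exact ENNReal.ofReal_le_ofReal hgM
  have hb₀ : ∀ x, ∑' z, W z * ENNReal.ofReal |g z| * P (x - z) ≤
      ENNReal.ofReal (b ^ (1 / q) * (M ^ q + 1)) := by
    intro x
    refine le_trans (ENNReal.tsum_le_tsum fun z => ?_)
      (tsum_conv_le_of_lpNorm hb0 (by linarith) hPb hPs hP2b hq hq2 hgq x)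
    rw [abs_mul, abs_of_nonneg (pow_nonneg (enormZ_nonneg z) n),
      ENNReal.ofReal_mul (pow_nonneg (enormZ_nonneg z) n)]
  have hb₁ : ∀ x, ∑' z, W z * ENNReal.ofReal |Q₂ z| * P (x - z) ≤
      ENNReal.ofReal (b ^ (1 / p) * (M ^ p + 1)) := by
    intro x
    refine le_trans (ENNReal.tsum_le_tsum fun z => ?_)
      (tsum_conv_le_of_lpNorm hb0 (by linarith) hPb hPs hP2b hp hp2 hQp x)
    rw [abs_mul, abs_of_nonneg (pow_nonneg (enormZ_nonneg z) n),
      ENNReal.ofReal_mul (pow_nonneg (enormZ_nonneg z) n)]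
    exact mul_le_mul' (mul_le_mul' le_rfl (ENNReal.ofReal_le_ofReal (abs_sub_trunc_le Q N z))) le_rfl
  have hVl1 : ∀ j, ∑' z, V j z ≤ ENNReal.ofReal a ^ j * ENNReal.ofReal M := fun j =>
    (tsum_eiter_le _ _ j).trans (by gcongr)
  have hVW := weighted_eiter_le (fun y => ENNReal.ofReal |Q₂ y|) (fun y => ENNReal.ofReal |g y|) W P
    hWsub (by rw [ENNReal.one_le_ofReal]; exact one_le_pow₀ (by norm_num)) hqa hb₀ hb₁
  set A : ℝ := C₀ * n.factorial / c ^ n * τ ^ (((n : ℝ) - d) / 2) with hA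
  have hA0 : 0 ≤ A := by positivity
  have hWη : ∀ z, ENNReal.ofReal (enormR (toR z - t • drift Q) ^ n) * P z ≤ ENNReal.ofReal A := by
    intro z
    have hw := enormR_nonneg (toR z - t • drift Q)
    set w := enormR (toR z - t • drift Q) with hwdef
    simp only [hP]
    rw [← ENNReal.ofReal_mul (by positivity)]
    apply ENNReal.ofReal_le_ofReal
    have e1 : (c * w / N) ^ n * Real.exp (-(c * w / N)) ≤ n.factorial := by
      have := Real.pow_div_factorial_le_exp (c * w / N) (by positivity) n
      rw [Real.exp_neg, ← div_eq_mul_inv, div_le_iff₀ (Real.exp_pos _)]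
      rw [div_le_iff₀ (by positivity)] at this
      linarith
    have e2 : w ^ n = N ^ n / c ^ n * (c * w / N) ^ n := by
      rw [div_pow, mul_pow]; field_simp
    have e3 : τ ^ (-(d : ℝ) / 2) * N ^ n = τ ^ (((n : ℝ) - d) / 2) := by
      rw [hN, Real.sqrt_eq_rpow, ← Real.rpow_natCast, ← Real.rpow_mul hτ0.le, ← Real.rpow_add hτ0]
      congr 1; ring
    calc w ^ n * |pker Q t z|
        ≤ w ^ n * (C₀ * τ ^ (-(d : ℝ) / 2) * Real.exp (-(c * w / N))) := by gcongr; exact P1 z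
      _ = C₀ / c ^ n * (τ ^ (-(d : ℝ) / 2) * N ^ n) * ((c * w / N) ^ n * Real.exp (-(c * w / N))) := by
          rw [e2]; ring
      _ ≤ C₀ / c ^ n * (τ ^ (-(d : ℝ) / 2) * N ^ n) * n.factorial := by gcongr
      _ = A := by rw [e3, hA]; ring
  have hmain : ENNReal.ofReal (enormR (toR x - t • drift Q) ^ n * ‖semiI Q g t x‖) ≤
      ENNReal.ofReal (2 ^ n) * (ENNReal.ofReal A * (ENNReal.ofReal (Real.exp (t * a)) * ENNReal.ofReal M) +
        (ENNReal.ofReal (Real.exp (t * a)) * ENNReal.ofReal (b ^ (1 / q) * (M ^ q + 1)) +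
          ENNReal.ofReal (t * Real.exp (t * a)) * (ENNReal.ofReal (2 ^ n) * ENNReal.ofReal M *
            ENNReal.ofReal (b ^ (1 / p) * (M ^ p + 1))))) := by
    rw [semiI_eq_conv hQ.summable hg ht, Complex.norm_real, Real.norm_eq_abs,
      ENNReal.ofReal_mul (pow_nonneg (enormR_nonneg _) _)]
    have s1 : ENNReal.ofReal |conv (pker Q t) (cexpZ Q₂ g t) x| ≤
        ∑' y, ∑' j : ℕ, ENNReal.ofReal (t ^ j / j.factorial) * (P (x - y) * V j y) := by
      refine (ofReal_abs_tsum_le _).trans (ENNReal.tsum_le_tsum fun y => ?_)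
      rw [abs_mul, ENNReal.ofReal_mul (abs_nonneg _)]
      refine (mul_le_mul_right (ofReal_abs_cexpZ_le Q₂ g ht y) _).trans (le_of_eq ?_)
      rw [← ENNReal.tsum_mul_left]
      refine tsum_congr fun j => ?_
      simp only [hP, hV]; ring
    have s2 : ∀ y, ENNReal.ofReal (enormR (toR x - t • drift Q) ^ n) ≤ ENNReal.ofReal (2 ^ n) *
        (ENNReal.ofReal (enormR (toR (x - y) - t • drift Q) ^ n) + W y) := by
      intro y
      simp only [hW]
      rw [← ENNReal.ofReal_add (pow_nonneg (enormR_nonneg _) _) (pow_nonneg (enormZ_nonneg _) _),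
        ← ENNReal.ofReal_mul (by positivity)]
      apply ENNReal.ofReal_le_ofReal
      refine le_trans ?_ (pow_add_le_two_pow (enormR_nonneg _) (enormZ_nonneg y) n)
      apply pow_le_pow_left₀ (enormR_nonneg _)
      have := enormR_add_le (toR (x - y) - t • drift Q) (toR y)
      rw [sub_add_eq_add_sub, ← toR_add, sub_add_cancel] at this
      exact this
    calc ENNReal.ofReal (enormR (toR x - t • drift Q) ^ n) *
          ENNReal.ofReal |conv (pker Q t) (cexpZ Q₂ g t) x|
        ≤ ENNReal.ofReal (enormR (toR x - t • drift Q) ^ n) *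
          ∑' y, ∑' j : ℕ, ENNReal.ofReal (t ^ j / j.factorial) * (P (x - y) * V j y) := by gcongr
      _ = ∑' j : ℕ, ENNReal.ofReal (t ^ j / j.factorial) * ∑' y,
          ENNReal.ofReal (enormR (toR x - t • drift Q) ^ n) * (P (x - y) * V j y) := by
          rw [ENNReal.tsum_comm, ← ENNReal.tsum_mul_left]
          refine tsum_congr fun j => ?_
          rw [ENNReal.tsum_mul_left, ENNReal.tsum_mul_left]
          ring
      _ ≤ ∑' j : ℕ, ENNReal.ofReal (t ^ j / j.factorial) * (ENNReal.ofReal (2 ^ n) *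
          (ENNReal.ofReal A * (ENNReal.ofReal a ^ j * ENNReal.ofReal M) +
          (ENNReal.ofReal a ^ j * ENNReal.ofReal (b ^ (1 / q) * (M ^ q + 1)) +
          j * ENNReal.ofReal a ^ (j - 1) * (ENNReal.ofReal (2 ^ n) * ENNReal.ofReal M *
            ENNReal.ofReal (b ^ (1 / p) * (M ^ p + 1)))))) := by
          refine ENNReal.tsum_le_tsum fun j => ?_
          gcongr
          calc ∑' y, ENNReal.ofReal (enormR (toR x - t • drift Q) ^ n) * (P (x - y) * V j y)
              ≤ ∑' y, (ENNReal.ofReal (2 ^ n) * (ENNReal.ofReal A * V j y) +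
                  ENNReal.ofReal (2 ^ n) * (W y * V j y * P (x - y))) := by
                refine ENNReal.tsum_le_tsum fun y => ?_
                calc _ ≤ ENNReal.ofReal (2 ^ n) *
                    (ENNReal.ofReal (enormR (toR (x - y) - t • drift Q) ^ n) + W y) *
                      (P (x - y) * V j y) := by gcongr; exact s2 y
                  _ = ENNReal.ofReal (2 ^ n) *
                    ((ENNReal.ofReal (enormR (toR (x - y) - t • drift Q) ^ n) * P (x - y)) * V j y) +
                      ENNReal.ofReal (2 ^ n) * (W y * V j y * P (x - y)) := by ring
                  _ ≤ _ := by gcongr; exact hWη _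
            _ = ENNReal.ofReal (2 ^ n) * (ENNReal.ofReal A * ∑' y, V j y +
                  ∑' y, W y * V j y * P (x - y)) := by
                rw [ENNReal.tsum_add, ENNReal.tsum_mul_left, ENNReal.tsum_mul_left,
                  ENNReal.tsum_mul_left, mul_add]
            _ ≤ _ := by
                gcongr
                · exact hVl1 j
                · refine (hVW j x).trans ?_
                  gcongr
      _ = _ := by
          rw [← tsum_ofReal_exp ha0 ht, ← tsum_ofReal_exp_deriv ha0 ht]
          simp only [← ENNReal.tsum_mul_right, ← ENNReal.tsum_mul_left, ← ENNReal.tsum_add]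
          refine tsum_congr fun j => ?_
          ring
  have hnn : 0 ≤ 2 ^ n * (A * (Real.exp (t * a) * M) + (Real.exp (t * a) * (b ^ (1 / q) * (M ^ q + 1)) +
      t * Real.exp (t * a) * (2 ^ n * M * (b ^ (1 / p) * (M ^ p + 1))))) := by positivity
  have hreal : enormR (toR x - t • drift Q) ^ n * ‖semiI Q g t x‖ ≤
      2 ^ n * (A * (Real.exp (t * a) * M) + (Real.exp (t * a) * (b ^ (1 / q) * (M ^ q + 1)) +
      t * Real.exp (t * a) * (2 ^ n * M * (b ^ (1 / p) * (M ^ p + 1))))) := by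
    rw [← ENNReal.ofReal_le_ofReal_iff hnn]
    refine hmain.trans (le_of_eq ?_)
    simp only [← ENNReal.ofReal_mul (show (0:ℝ) ≤ 2 ^ n by positivity)]
    rw [← ENNReal.ofReal_mul (by positivity), ← ENNReal.ofReal_mul (by positivity),
      ← ENNReal.ofReal_mul (by positivity), ← ENNReal.ofReal_mul (by positivity),
      ← ENNReal.ofReal_mul (by positivity),
      ← ENNReal.ofReal_add (by positivity) (by positivity),
      ← ENNReal.ofReal_add (by positivity) (by positivity), ← ENNReal.ofReal_mul (by positivity)]
  refine hreal.trans ?_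
  have f1 := hbp q hq hq2
  have f2 := hbp p hp hp2
  set T0 := τ ^ (((n : ℝ) - d) / 2)
  set T1 := τ ^ (-(d : ℝ) / (2 * p))
  set T2 := τ ^ (-(d : ℝ) / (2 * q))
  have hT0 : 0 ≤ T0 := by positivity
  have hT1 : 0 ≤ T1 := by positivity
  have hT2 : 0 ≤ T2 := by positivity
  calc 2 ^ n * (A * (Real.exp (t * a) * M) + (Real.exp (t * a) * (b ^ (1 / q) * (M ^ q + 1)) +
      t * Real.exp (t * a) * (2 ^ n * M * (b ^ (1 / p) * (M ^ p + 1)))))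
      ≤ 2 ^ n * (A * (E * M) + (E * (C₁ * (M ^ 2 + 1) * T2) +
      t * E * (2 ^ n * M * (C₁ * (M ^ 2 + 1) * T1)))) := by gcongr
    _ = 2 ^ n * E * ((C₀ * n.factorial / c ^ n * M) * T0 + (C₁ * (M ^ 2 + 1)) * T2 +
        (2 ^ n * M * (C₁ * (M ^ 2 + 1))) * (t * T1)) := by rw [hA]; ring
    _ ≤ _ := by
      rw [mul_assoc (2 ^ n * E)]
      gcongr
      have u1 : 0 ≤ C₀ * n.factorial / c ^ n * M := by positivity
      have u2 : 0 ≤ C₁ * (M ^ 2 + 1) := by positivity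
      have u3 : 0 ≤ 2 ^ n * M * (C₁ * (M ^ 2 + 1)) := by positivity
      have hT1' : 0 ≤ t * T1 := by positivity
      set U1 := C₀ * n.factorial / c ^ n * M
      set U2 := C₁ * (M ^ 2 + 1)
      set U3 := 2 ^ n * M * U2
      have := mul_nonneg u1 hT1'
      have := mul_nonneg u1 hT2
      have := mul_nonneg u2 hT1'
      have := mul_nonneg u2 hT0
      have := mul_nonneg u3 hT0
      have := mul_nonneg u3 hT2
      nlinarith

/-- The consequences of membership in the class `𝒬` used for the asymptotics, with moments of order
`2 + θ` and natural-number powers in the weights. -/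
structure KernPair (M K θ p : ℝ) (Q g : (Fin d → ℤ) → ℝ) : Prop where
  kern : Kern M K Q
  summable_moment : Summable fun y => enormZ y ^ (2 + θ) * |Q y|
  moment_le : ∑' y, enormZ y ^ (2 + θ) * |Q y| ≤ M
  summable_g : Summable fun y => |g y|
  g_le : ∑' y, |g y| ≤ M
  summable_gθ : Summable fun y => enormZ y ^ θ * |g y|
  gθ_le : ∑' y, enormZ y ^ θ * |g y| ≤ M
  Q_two : lpNorm (fun y => enormZ y ^ 2 * Q y) 1 ≤ ENNReal.ofReal M
  g_two : lpNorm (fun y => enormZ y ^ 2 * g y) p ≤ ENNReal.ofReal M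
  Q_dm1 : 4 ≤ d →
    lpNorm (fun y => enormZ y ^ (d - 1) * Q y) (min ((d : ℝ) / 3) 2) ≤ ENNReal.ofReal M
  g_dm1 : 4 ≤ d → lpNorm (fun y => enormZ y ^ (d - 1) * g y) 2 ≤ ENNReal.ofReal M

theorem lpNorm_one_iff {f : (Fin d → ℤ) → ℝ} {M : ℝ} (hM : 0 ≤ M) :
    lpNorm f 1 ≤ ENNReal.ofReal M ↔ (Summable fun y => |f y|) ∧ ∑' y, |f y| ≤ M := by
  have e : lpNorm f 1 = ∑' y, ENNReal.ofReal |f y| := by simp [lpNorm]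
  rw [e]
  constructor
  · intro h
    have hs : Summable fun y => |f y| := by
      have := ENNReal.summable_toReal (h.trans_lt ENNReal.ofReal_lt_top).ne
      simpa using this
    refine ⟨hs, ?_⟩
    rwa [← ENNReal.ofReal_tsum_of_nonneg (fun y => abs_nonneg _) hs,
      ENNReal.ofReal_le_ofReal_iff hM] at h
  · rintro ⟨hs, h⟩
    rw [← ENNReal.ofReal_tsum_of_nonneg (fun y => abs_nonneg _) hs]
    exact ENNReal.ofReal_le_ofReal h

theorem enormZ_rpow_le (y : Fin d → ℤ) {a b : ℝ} (ha : 0 < a) (hab : a ≤ b) :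
    enormZ y ^ a ≤ enormZ y ^ b := by
  rcases eq_or_ne y 0 with rfl | hy
  · rw [enormZ_zero, Real.zero_rpow ha.ne', Real.zero_rpow (by linarith)]
  · exact Real.rpow_le_rpow_of_exponent_le (one_le_enormZ hy) hab

theorem weighted_l1 {f : (Fin d → ℤ) → ℝ} {M a b : ℝ} (hM : 0 ≤ M) (ha : 0 < a) (hab : a ≤ b)
    (h : lpNorm (fun y => enormZ y ^ b * f y) 1 ≤ ENNReal.ofReal M) :
    (Summable fun y => enormZ y ^ a * |f y|) ∧ ∑' y, enormZ y ^ a * |f y| ≤ M := by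
  obtain ⟨h1, h2⟩ := (lpNorm_one_iff hM).1 h
  simp only [abs_mul, abs_of_nonneg (Real.rpow_nonneg (enormZ_nonneg _) _)] at h1 h2
  have hle : ∀ y, enormZ y ^ a * |f y| ≤ enormZ y ^ b * |f y| := fun y =>
    mul_le_mul_of_nonneg_right (enormZ_rpow_le y ha hab) (abs_nonneg _)
  have hs : Summable fun y => enormZ y ^ a * |f y| :=
    Summable.of_nonneg_of_le (fun y => mul_nonneg (Real.rpow_nonneg (enormZ_nonneg _) _)
      (abs_nonneg _)) hle h1
  exact ⟨hs, (hs.tsum_le_tsum hle h1).trans h2⟩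

theorem mem_torus_iff {k : Fin d → ℝ} : k ∈ torus d ↔ ∀ i, |k i| ≤ π := by
  simp only [torus, Set.mem_univ_pi, Set.mem_Icc, abs_le]

theorem MemQ.kernPair {M K ζ : ℝ} {Q g : (Fin d → ℤ) → ℝ} (h : MemQ M K ζ Q g) (hK : 0 < K)
    (hζ : 0 < ζ) (hd : 1 ≤ d) (h1 : ∑' y, Q y ≤ 1) :
    KernPair (max M 1) K (min ζ 1) (min (pExp d ζ) 2) Q g := by
  have hM : M ≤ max M 1 := le_max_left _ _
  have hM0 : (0 : ℝ) ≤ max M 1 := by linarith [le_max_right M 1]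
  have hMo : ENNReal.ofReal M ≤ ENNReal.ofReal (max M 1) := ENNReal.ofReal_le_ofReal hM
  have hθ0 : 0 < min ζ 1 := lt_min hζ one_pos
  have hθ : min ζ 1 ≤ ζ := min_le_left _ _
  have a1 := ((lpNorm_one_iff hM0).1 (h.Q_l1.trans hMo)).1
  obtain ⟨b1, b2⟩ := (lpNorm_one_iff hM0).1 (h.g_l1.trans hMo)
  obtain ⟨c1, c2⟩ := weighted_l1 hM0 (show 0 < 2 + min ζ 1 by linarith)
    (show 2 + min ζ 1 ≤ 2 + ζ by linarith) (h.Q_moment.trans hMo)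
  obtain ⟨d1, d2⟩ := weighted_l1 hM0 hθ0 hθ (h.g_zeta.trans hMo)
  obtain ⟨e1, e2⟩ := weighted_l1 hM0 (show (0 : ℝ) < 2 by norm_num)
    (show 2 ≤ 2 + ζ by linarith) (h.Q_moment.trans hMo)
  simp only [Real.rpow_two] at e1 e2
  have hnat : ∀ y : Fin d → ℤ, enormZ y ^ ((d : ℝ) - 1) = enormZ y ^ (d - 1) := fun y => by
    rw [← Real.rpow_natCast, Nat.cast_sub hd, Nat.cast_one]
  refine ⟨⟨le_max_right _ _, hK, a1, e1, e2, fun k hk => h.infrared k (mem_torus_iff.1 hk), h1⟩,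
    c1, c2, b1, b2, d1, d2, ?_, ?_, fun h4 => ?_, fun h4 => ?_⟩
  · rw [lpNorm_one_iff hM0]
    simp only [abs_mul, abs_of_nonneg (pow_nonneg (enormZ_nonneg _) 2)]
    exact ⟨e1, e2⟩
  · have := h.g_two.trans hMo
    simpa only [Real.rpow_two] using this
  · have := (h.Q_dm1 h4).trans hMo
    simpa only [hnat] using this
  · have := (h.g_dm1 h4).trans hMo
    simpa only [hnat] using this

/-- The two conditions on the exponent for the weighted `g` bound. -/
structure TailExp (d : ℕ) (p : ℝ) : Prop where
  one_le : 1 ≤ p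
  le_two : p ≤ 2
  div_le : (d : ℝ) / 2 - 1 ≤ d / (2 * p)

theorem tailExp_min_pExp (hd : 1 ≤ d) {ζ : ℝ} (hζ : 0 < ζ) : TailExp d (min (pExp d ζ) 2) := by
  have hd' : (1 : ℝ) ≤ d := by exact_mod_cast hd
  by_cases h1 : d = 1
  · subst h1
    have : pExp 1 ζ = 2 := by simp [pExp]
    rw [this, min_self]
    exact ⟨by norm_num, le_rfl, by norm_num⟩
  · have h2 : (2 : ℝ) ≤ d := by exact_mod_cast (show 2 ≤ d by omega)
    have hm : 0 < min ζ 2 := lt_min hζ two_pos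
    have hm2 : min ζ 2 ≤ 2 := min_le_right _ _
    have e : pExp d ζ = d / ((d : ℝ) - 2 + min ζ 2) := by simp [pExp, h1]
    have hpos : 0 < (d : ℝ) - 2 + min ζ 2 := by linarith
    have hp1 : 1 ≤ pExp d ζ := by rw [e, le_div_iff₀ hpos]; linarith
    refine ⟨le_min hp1 (by norm_num), min_le_right _ _, ?_⟩
    have hq : 0 < min (pExp d ζ) 2 := lt_min (by linarith) two_pos
    calc (d : ℝ) / 2 - 1 ≤ d / (2 * pExp d ζ) := by
          rw [e]
          rw [show (d : ℝ) / (2 * (d / (d - 2 + min ζ 2))) = (d - 2 + min ζ 2) / 2 by field_simp]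
          linarith
      _ ≤ _ := by gcongr; exact min_le_left _ _

theorem Kern.re_fourierZ_ge {M K : ℝ} {Q : (Fin d → ℤ) → ℝ} (h : Kern M K Q) {k : Fin d → ℝ}
    (hk : k ∈ torus d) : K * enormR k ^ 2 ≤ (1 - fourierZ Q k).re := by
  have := h.infrared k hk
  have h1 := h.le_one
  rw [fourierZ_zero, Complex.sub_re, Complex.ofReal_re] at this
  rw [Complex.sub_re, Complex.one_re]; linarith

theorem exists_semiI_bound (d : ℕ) (M K : ℝ) (hM : 1 ≤ M) (hK : 0 < K) :
    ∃ C : ℝ, 0 < C ∧ ∀ Q g : (Fin d → ℤ) → ℝ, Kern M K Q → (Summable fun y => |g y|) →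
      ∑' y, |g y| ≤ M → ∀ t : ℝ, 0 ≤ t → ∀ x : Fin d → ℤ,
        ‖semiI Q g t x‖ ≤ C * (max 1 t) ^ (-(d : ℝ) / 2) := by
  obtain ⟨C, hC, H⟩ := integral_torus_gaussian_le (d := d) K hK
  refine ⟨M * C, by positivity, fun Q g hQ hg hgM t ht x => ?_⟩
  have hint : IntegrableOn (fun k => M * Real.exp (-(t * K) * enormR k ^ 2)) (torus d) :=
    (integrableOn_torus_real (continuous_gaussian_enormR _)).const_mul _
  refine (norm_invF_le x hint fun k hk => ?_).trans ?_
  · rw [norm_mul, mul_comm]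
    gcongr
    · exact (norm_fourierZ_le hg k).trans hgM
    · rw [Complex.norm_exp, Real.exp_le_exp]
      have := hQ.re_fourierZ_ge hk
      have e : (-(t : ℂ) * (1 - fourierZ Q k)).re = -(t * (1 - fourierZ Q k).re) := by
        simp [Complex.mul_re]
      rw [e]
      nlinarith
  · rw [integral_const_mul, mul_assoc]
    gcongr
    exact H t ht

theorem exists_semiI_tail_two (d : ℕ) (M K θ p : ℝ) (hM : 1 ≤ M) (hK : 0 < K) (hp : TailExp d p) :
    ∃ C : ℝ, 0 < C ∧ ∀ Q g : (Fin d → ℤ) → ℝ, KernPair M K θ p Q g → ∀ t : ℝ, 0 ≤ t →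
      ∀ x : Fin d → ℤ, enormR (toR x - t • drift Q) ^ 2 * ‖semiI Q g t x‖ ≤
        C * (max 1 t) ^ (1 - (d : ℝ) / 2) := by
  obtain ⟨C, hC, H⟩ := exists_tail_bound d 2 M K 1 p hM hK le_rfl (by norm_num) hp.one_le hp.le_two
  refine ⟨C * 3, by positivity, fun Q g h t ht x => ?_⟩
  refine (H Q g h.kern h.summable_g h.g_le h.Q_two h.g_two t ht x).trans ?_
  rw [mul_assoc]
  have hτ : 1 ≤ max 1 t := le_max_left _ _
  have hτ0 : 0 < max 1 t := by linarith
  gcongr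
  have e1 : (((2 : ℕ) : ℝ) - d) / 2 = 1 - (d : ℝ) / 2 := by push_cast; ring
  have e2 : t * (max 1 t) ^ (-(d : ℝ) / (2 * 1)) ≤ (max 1 t) ^ (1 - (d : ℝ) / 2) := by
    rw [show 1 - (d : ℝ) / 2 = 1 + -(d : ℝ) / (2 * 1) by ring, Real.rpow_add hτ0, Real.rpow_one]
    gcongr
    exact le_max_right _ _
  have e3 : (max 1 t) ^ (-(d : ℝ) / (2 * p)) ≤ (max 1 t) ^ (1 - (d : ℝ) / 2) := by
    apply Real.rpow_le_rpow_of_exponent_le hτ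
    have := hp.div_le
    rw [neg_div]; linarith
  rw [e1]; linarith

theorem exists_semiI_tail_dm1 (d : ℕ) (M K θ p : ℝ) (hM : 1 ≤ M) (hK : 0 < K) (hp : TailExp d p)
    (hd : 3 ≤ d) :
    ∃ C : ℝ, 0 < C ∧ ∀ Q g : (Fin d → ℤ) → ℝ, KernPair M K θ p Q g → ∀ t : ℝ, 0 ≤ t →
      ∀ x : Fin d → ℤ, enormR (toR x - t • drift Q) ^ (d - 1) * ‖semiI Q g t x‖ ≤
        C * (max 1 t) ^ (-(1 / 2) : ℝ) := by
  rcases eq_or_lt_of_le hd with rfl | hd4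
  · obtain ⟨C, hC, H⟩ := exists_semiI_tail_two 3 M K θ p hM hK hp
    refine ⟨C, hC, fun Q g h t ht x => ?_⟩
    refine (H Q g h t ht x).trans (le_of_eq ?_)
    norm_num
  have h4 : (4 : ℝ) ≤ d := by exact_mod_cast hd4
  obtain ⟨C, hC, H⟩ := exists_tail_bound d (d - 1) M K (min ((d : ℝ) / 3) 2) 2 hM hK
    (le_min (by linarith) (by norm_num)) (min_le_right _ _) (by norm_num) le_rfl
  refine ⟨C * 3, by positivity, fun Q g h t ht x => ?_⟩
  refine (H Q g h.kern h.summable_g h.g_le (h.Q_dm1 hd4) (h.g_dm1 hd4) t ht x).trans ?_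
  rw [mul_assoc]
  have hτ : 1 ≤ max 1 t := le_max_left _ _
  have hτ0 : 0 < max 1 t := by linarith
  gcongr
  have e1 : (((d - 1 : ℕ) : ℝ) - d) / 2 = -(1 / 2) := by
    rw [Nat.cast_sub (by omega)]; push_cast; ring
  have hm : 0 < min ((d : ℝ) / 3) 2 := lt_min (by linarith) two_pos
  have e0 : 3 / 2 ≤ (d : ℝ) / (2 * min ((d : ℝ) / 3) 2) := by
    rw [le_div_iff₀ (by positivity)]
    have := min_le_left ((d : ℝ) / 3) 2
    linarith
  have e2 : t * (max 1 t) ^ (-(d : ℝ) / (2 * min ((d : ℝ) / 3) 2)) ≤ (max 1 t) ^ (-(1 / 2) : ℝ) := by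
    calc _ ≤ (max 1 t) ^ (1 : ℝ) * (max 1 t) ^ (-(d : ℝ) / (2 * min ((d : ℝ) / 3) 2)) := by
          rw [Real.rpow_one]; gcongr; exact le_max_right _ _
      _ = (max 1 t) ^ (1 + -(d : ℝ) / (2 * min ((d : ℝ) / 3) 2)) := by rw [← Real.rpow_add hτ0]
      _ ≤ _ := by
        apply Real.rpow_le_rpow_of_exponent_le hτ
        rw [neg_div]; linarith
  have e3 : (max 1 t) ^ (-(d : ℝ) / (2 * 2)) ≤ (max 1 t) ^ (-(1 / 2) : ℝ) := by
    apply Real.rpow_le_rpow_of_exponent_le hτ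
    linarith
  rw [e1]; linarith

theorem norm_exp_neg_sub_exp_neg_le {a b : ℂ} {c : ℝ} (ha : c ≤ a.re) (hb : c ≤ b.re) :
    ‖Complex.exp (-a) - Complex.exp (-b)‖ ≤ Real.exp (-c) * ‖a - b‖ := by
  have hs : Convex ℝ {z : ℂ | c ≤ z.re} := convex_halfSpace_re_ge c
  refine hs.norm_image_sub_le_of_norm_hasDerivWithin_le (f := fun z => Complex.exp (-z))
    (f' := fun z => Complex.exp (-z) * -1) (fun z _ => ?_) (fun z hz => ?_) hb ha
  · exact ((hasDerivAt_id z).neg.cexp).hasDerivWithinAt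
  · rw [mul_neg_one, norm_neg, Complex.norm_exp, Complex.neg_re, Real.exp_le_exp]
    exact neg_le_neg hz

theorem norm_exp_taylor_two_le {θ : ℝ} (hθ0 : 0 < θ) (hθ : θ ≤ 1) (u : ℝ) :
    ‖Complex.exp (-Complex.I * (u : ℂ)) - (1 - Complex.I * u - (u : ℂ) ^ 2 / 2)‖ ≤
      4 * |u| ^ (2 + θ) := by
  have hz : ‖-Complex.I * (u : ℂ)‖ = |u| := by simp
  rcases le_total |u| 1 with h | h
  · have h1 := Complex.exp_bound' (x := -Complex.I * (u : ℂ)) (n := 3)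
      (by rw [hz]; push_cast; linarith)
    have e : ∑ m ∈ Finset.range 3, (-Complex.I * (u : ℂ)) ^ m / (m.factorial : ℂ) =
        1 - Complex.I * u - (u : ℂ) ^ 2 / 2 := by
      simp [Finset.sum_range_succ, Nat.factorial, mul_pow]; ring
    rw [e, hz] at h1
    refine h1.trans ?_
    have h3 : |u| ^ 3 ≤ |u| ^ (2 + θ) := by
      rcases eq_or_lt_of_le (abs_nonneg u) with h0 | h0
      · rw [← h0, Real.zero_rpow (by linarith)]; norm_num
      · rw [← Real.rpow_natCast]
        apply Real.rpow_le_rpow_of_exponent_ge h0 h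
        push_cast; linarith
    have : (0 : ℝ) ≤ |u| ^ 3 := by positivity
    have e6 : ((Nat.factorial 3 : ℕ) : ℝ) = 6 := by norm_num [Nat.factorial]
    rw [e6]; linarith
  · have h2 : |u| ^ 2 ≤ |u| ^ (2 + θ) := by
      rw [← Real.rpow_two]
      exact Real.rpow_le_rpow_of_exponent_le h (by linarith)
    have e1 : ‖Complex.I * (u : ℂ)‖ = |u| := by simp
    have e2 : ‖(u : ℂ) ^ 2 / 2‖ = |u| ^ 2 / 2 := by simp
    calc _ ≤ ‖Complex.exp (-Complex.I * (u : ℂ))‖ + (‖(1 : ℂ)‖ + ‖Complex.I * (u : ℂ)‖ +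
          ‖(u : ℂ) ^ 2 / 2‖) := (norm_sub_le _ _).trans
            (by gcongr; exact (norm_sub_le _ _).trans (by gcongr; exact norm_sub_le _ _))
      _ = 1 + (1 + |u| + |u| ^ 2 / 2) := by rw [norm_exp_neg_I_mul, e1, e2, norm_one]
      _ ≤ 4 * |u| ^ 2 := by nlinarith
      _ ≤ _ := by linarith

theorem norm_exp_neg_I_mul_sub_one_le {θ : ℝ} (hθ0 : 0 < θ) (hθ : θ ≤ 1) (u : ℝ) :
    ‖Complex.exp (-Complex.I * (u : ℂ)) - 1‖ ≤ 2 * |u| ^ θ := by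
  rcases le_total |u| 1 with h | h
  · have := Real.norm_exp_I_mul_ofReal_sub_one_le (x := -u)
    rw [norm_neg, Real.norm_eq_abs] at this
    push_cast at this
    rw [mul_neg, ← neg_mul] at this
    refine this.trans ?_
    have h3 : |u| ≤ |u| ^ θ := by
      rcases eq_or_lt_of_le (abs_nonneg u) with h0 | h0
      · rw [← h0, Real.zero_rpow (by linarith)]
      · calc |u| = |u| ^ (1 : ℝ) := (Real.rpow_one _).symm
          _ ≤ _ := Real.rpow_le_rpow_of_exponent_ge h0 h hθ
    have := abs_nonneg u
    linarith
  · have h2 : 1 ≤ |u| ^ θ := Real.one_le_rpow h hθ0.le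
    calc _ ≤ ‖Complex.exp (-Complex.I * (u : ℂ))‖ + ‖(1 : ℂ)‖ := norm_sub_le _ _
      _ = 2 := by rw [norm_exp_neg_I_mul, norm_one]; norm_num
      _ ≤ _ := by linarith

/-- Second moment matrix of a kernel. -/
def covar (Q : (Fin d → ℤ) → ℝ) : Matrix (Fin d) (Fin d) ℝ :=
  Matrix.of fun j l => ∑' y, (y j : ℝ) * (y l : ℝ) * Q y

theorem summable_coord_coord_mul {Q : (Fin d → ℤ) → ℝ}
    (h : Summable fun y => enormZ y ^ 2 * |Q y|) (j l : Fin d) :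
    Summable fun y : Fin d → ℤ => (y j : ℝ) * (y l : ℝ) * Q y := by
  refine Summable.of_norm_bounded h fun y => ?_
  rw [Real.norm_eq_abs, abs_mul, abs_mul, sq]
  gcongr
  · exact enormZ_nonneg y
  · exact abs_coord_le y j
  · exact abs_coord_le y l

theorem hasSum_rdotZ_sq_mul {Q : (Fin d → ℤ) → ℝ} (h : Summable fun y => enormZ y ^ 2 * |Q y|)
    (k : Fin d → ℝ) : HasSum (fun y => rdotZ k y ^ 2 * Q y) (rdot k (covar Q *ᵥ k)) := by
  have := hasSum_sum (s := Finset.univ) (fun j _ => (hasSum_sum (s := Finset.univ)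
    (fun l _ => ((summable_coord_coord_mul h j l).hasSum.mul_right (k l)))).mul_left (k j))
  have e : (fun y => rdotZ k y ^ 2 * Q y) = fun y : Fin d → ℤ => ∑ j, k j * ∑ l, (y j : ℝ) * (y l : ℝ) * Q y * k l := by
    ext y
    simp only [rdotZ, sq, Finset.sum_mul, Finset.mul_sum]
    rw [Finset.sum_comm]
    refine Finset.sum_congr rfl fun j _ => Finset.sum_congr rfl fun l _ => ?_
    ring
  rw [e]
  exact this

/-- The quadratic approximation to `1 - Q̂` near the origin. -/
def quadSymbol (Q : (Fin d → ℤ) → ℝ) (k : Fin d → ℝ) : ℂ :=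
  Complex.I * (rdot k (drift Q) : ℂ) + ((1 / 2 * rdot k (covar Q *ᵥ k) : ℝ) : ℂ)

theorem rpow_abs_rdotZ_le (k : Fin d → ℝ) (y : Fin d → ℤ) {a : ℝ} (ha : 0 ≤ a) :
    |rdotZ k y| ^ a ≤ enormR k ^ a * enormZ y ^ a := by
  rw [← Real.mul_rpow (enormR_nonneg _) (enormZ_nonneg _)]
  exact Real.rpow_le_rpow (abs_nonneg _) (abs_rdotZ_le k y) ha

theorem KernPair.norm_symbol_sub_le {M K θ p : ℝ} {Q g : (Fin d → ℤ) → ℝ} (h : KernPair M K θ p Q g)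
    (hθ0 : 0 < θ) (hθ : θ ≤ 1) (k : Fin d → ℝ) :
    ‖(fourierZ Q 0 - fourierZ Q k) - quadSymbol Q k‖ ≤ 4 * M * enormR k ^ (2 + θ) := by
  have s0 : HasSum (fun y => (Q y : ℂ)) (fourierZ Q 0) := by
    rw [fourierZ_zero]
    exact Complex.hasSum_ofReal.2 (Summable.of_abs h.kern.summable).hasSum
  have s1 : HasSum (fun y => ((rdotZ k y * Q y : ℝ) : ℂ)) ((rdot k (drift Q) : ℝ) : ℂ) :=
    Complex.hasSum_ofReal.2 (hasSum_rdotZ_mul h.kern.summable_sq k)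
  have s2 : HasSum (fun y => ((rdotZ k y ^ 2 * Q y : ℝ) : ℂ)) ((rdot k (covar Q *ᵥ k) : ℝ) : ℂ) :=
    Complex.hasSum_ofReal.2 (hasSum_rdotZ_sq_mul h.kern.summable_sq k)
  have s3 := (summable_fourier_term h.kern.summable k).hasSum
  have s := ((s0.sub s3).sub ((s1.mul_left Complex.I).add (s2.mul_left (1 / 2))))
  have e : (fourierZ Q 0 - fourierZ Q k) - quadSymbol Q k = (fourierZ Q 0 - ∑' y, (Q y : ℂ) * Complex.exp (-Complex.I * (rdotZ k y : ℂ))) -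
      (Complex.I * ((rdot k (drift Q) : ℝ) : ℂ) + 1 / 2 * ((rdot k (covar Q *ᵥ k) : ℝ) : ℂ)) := by
    rw [quadSymbol, fourierZ, fourierZ]; push_cast; ring
  rw [e, ← s.tsum_eq]
  have hb : ∀ y, ‖(Q y : ℂ) - (Q y : ℂ) * Complex.exp (-Complex.I * (rdotZ k y : ℂ)) -
      (Complex.I * ((rdotZ k y * Q y : ℝ) : ℂ) + 1 / 2 * ((rdotZ k y ^ 2 * Q y : ℝ) : ℂ))‖ ≤
      4 * enormR k ^ (2 + θ) * (enormZ y ^ (2 + θ) * |Q y|) := by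
    intro y
    have : (Q y : ℂ) - (Q y : ℂ) * Complex.exp (-Complex.I * (rdotZ k y : ℂ)) -
      (Complex.I * ((rdotZ k y * Q y : ℝ) : ℂ) + 1 / 2 * ((rdotZ k y ^ 2 * Q y : ℝ) : ℂ)) =
      -(Q y : ℂ) * (Complex.exp (-Complex.I * (rdotZ k y : ℂ)) -
        (1 - Complex.I * rdotZ k y - (rdotZ k y : ℂ) ^ 2 / 2)) := by push_cast; ring
    rw [this, norm_mul, norm_neg, Complex.norm_real, Real.norm_eq_abs]
    calc _ ≤ |Q y| * (4 * (enormR k ^ (2 + θ) * enormZ y ^ (2 + θ))) := by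
          gcongr
          exact (norm_exp_taylor_two_le hθ0 hθ _).trans
            (by gcongr; exact rpow_abs_rdotZ_le k y (by linarith))
      _ = _ := by ring
  refine (tsum_of_norm_bounded (h.summable_moment.hasSum.mul_left _) hb).trans ?_
  have := Real.rpow_nonneg (enormR_nonneg k) (2 + θ)
  have := h.moment_le
  nlinarith

theorem KernPair.norm_fourier_g_sub_le {M K θ p : ℝ} {Q g : (Fin d → ℤ) → ℝ}
    (h : KernPair M K θ p Q g) (hθ0 : 0 < θ) (hθ : θ ≤ 1) (k : Fin d → ℝ) :
    ‖fourierZ g k - ((∑' y, g y : ℝ) : ℂ)‖ ≤ 2 * M * enormR k ^ θ := by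
  have s0 : HasSum (fun y => (g y : ℂ)) (((∑' y, g y : ℝ)) : ℂ) :=
    Complex.hasSum_ofReal.2 (Summable.of_abs h.summable_g).hasSum
  have s3 := (summable_fourier_term h.summable_g k).hasSum
  have s := s3.sub s0
  rw [fourierZ, ← s.tsum_eq]
  have hb : ∀ y, ‖(g y : ℂ) * Complex.exp (-Complex.I * (rdotZ k y : ℂ)) - (g y : ℂ)‖ ≤
      2 * enormR k ^ θ * (enormZ y ^ θ * |g y|) := by
    intro y
    rw [← mul_sub_one, norm_mul, Complex.norm_real, Real.norm_eq_abs]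
    calc _ ≤ |g y| * (2 * (enormR k ^ θ * enormZ y ^ θ)) := by
          gcongr
          exact (norm_exp_neg_I_mul_sub_one_le hθ0 hθ _).trans
            (by gcongr; exact rpow_abs_rdotZ_le k y hθ0.le)
      _ = _ := by ring
  refine (tsum_of_norm_bounded (h.summable_gθ.hasSum.mul_left _) hb).trans ?_
  have := Real.rpow_nonneg (enormR_nonneg k) θ
  have := h.gθ_le
  nlinarith

theorem enormR_smul (c : ℝ) (v : Fin d → ℝ) : enormR (c • v) = |c| * enormR v := by
  rw [enormR_eq_norm, enormR_eq_norm, WithLp.toLp_smul, norm_smul, Real.norm_eq_abs]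

theorem rdot_smul_left (c : ℝ) (v w : Fin d → ℝ) : rdot (c • v) w = c * rdot v w := by
  simp [rdot_eq_dotProduct]

theorem rdot_smul_right (c : ℝ) (v w : Fin d → ℝ) : rdot v (c • w) = c * rdot v w := by
  simp [rdot_eq_dotProduct]

theorem quadSymbol_re (Q : (Fin d → ℤ) → ℝ) (k : Fin d → ℝ) :
    (quadSymbol Q k).re = 1 / 2 * rdot k (covar Q *ᵥ k) := by
  simp [quadSymbol]

theorem KernPair.formBounds {M K θ p : ℝ} {Q g : (Fin d → ℤ) → ℝ} (h : KernPair M K θ p Q g)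
    (hθ0 : 0 < θ) (hθ : θ ≤ 1) : FormBounds (2 * K) M (covar Q) := by
  refine ⟨?_, fun k => ?_, fun k => ?_⟩
  · ext j l
    simp only [covar, Matrix.transpose_apply, Matrix.of_apply]
    refine tsum_congr fun y => by ring
  · have hlim : Tendsto (fun s : ℝ => 2 * K * enormR k ^ 2 - 8 * M * s ^ θ * enormR k ^ (2 + θ))
        (𝓝[>] 0) (𝓝 (2 * K * enormR k ^ 2 - 8 * M * 0 * enormR k ^ (2 + θ))) := by
      have : Tendsto (fun s : ℝ => s ^ θ) (𝓝[>] 0) (𝓝 0) := by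
        have := (Real.continuousAt_rpow_const 0 θ (Or.inr hθ0.le)).tendsto
        rw [Real.zero_rpow hθ0.ne'] at this
        exact this.mono_left nhdsWithin_le_nhds
      exact ((this.const_mul _).mul_const _).const_sub _
    rw [mul_zero, zero_mul, sub_zero] at hlim
    refine le_of_tendsto hlim ?_
    have hev : ∀ᶠ s : ℝ in 𝓝[>] 0, ∀ i, |(s • k) i| ≤ π := by
      rw [eventually_all]
      intro i
      have : Tendsto (fun s : ℝ => |(s • k) i|) (𝓝[>] 0) (𝓝 |((0 : ℝ) • k) i|) := by
        apply Tendsto.mono_left _ nhdsWithin_le_nhds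
        exact (by fun_prop : Continuous fun s : ℝ => |(s • k) i|).tendsto 0
      simp only [zero_smul, Pi.zero_apply, abs_zero] at this
      exact (this.eventually_lt_const Real.pi_pos).mono fun s hs => hs.le
    filter_upwards [hev, self_mem_nhdsWithin] with s hs hs0
    have hs0 : 0 < s := hs0
    have a1 := h.kern.infrared _ (mem_torus_iff.2 hs)
    have a2 := (Complex.abs_re_le_norm _).trans (h.norm_symbol_sub_le hθ0 hθ (s • k))
    rw [Complex.sub_re, quadSymbol_re] at a2
    rw [enormR_smul, abs_of_pos hs0] at a1 a2
    rw [Matrix.mulVec_smul, rdot_smul_left, rdot_smul_right, Real.mul_rpow hs0.le (enormR_nonneg _),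
      Real.rpow_add hs0, Real.rpow_two] at a2
    have a3 := (abs_le.1 a2).2
    have a4 : s ^ 2 * (2 * K * enormR k ^ 2 - 8 * M * s ^ θ * enormR k ^ (2 + θ)) ≤
        s ^ 2 * rdot k (covar Q *ᵥ k) := by nlinarith
    exact le_of_mul_le_mul_left a4 (by positivity)
  · have s2 := hasSum_rdotZ_sq_mul h.kern.summable_sq k
    have s3 := (h.kern.summable_sq.hasSum.mul_left (enormR k ^ 2))
    refine (hasSum_le (fun y => ?_) s2 s3).trans ?_
    · have := abs_rdotZ_le k y
      have h2 : rdotZ k y ^ 2 ≤ (enormR k * enormZ y) ^ 2 := by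
        rw [← sq_abs]; exact pow_le_pow_left₀ (abs_nonneg _) this 2
      calc rdotZ k y ^ 2 * Q y ≤ rdotZ k y ^ 2 * |Q y| := by gcongr; exact le_abs_self _
        _ ≤ (enormR k * enormZ y) ^ 2 * |Q y| := by gcongr
        _ = _ := by ring
    · rw [mul_comm]
      gcongr
      exact h.kern.sq_le

theorem KernPair.norm_tsum_g_le {M K θ p : ℝ} {Q g : (Fin d → ℤ) → ℝ} (h : KernPair M K θ p Q g) :
    |∑' y, g y| ≤ M := by
  have := norm_tsum_le_tsum_norm (f := g) (by simpa using h.summable_g)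
  simp only [Real.norm_eq_abs] at this
  exact this.trans h.g_le

theorem continuous_quadSymbol (Q : (Fin d → ℤ) → ℝ) : Continuous (quadSymbol Q) := by
  unfold quadSymbol rdot Matrix.mulVec dotProduct
  fun_prop

theorem rpow_le_one_add_sq {v a : ℝ} (hv : 0 ≤ v) (ha : 0 ≤ a) (ha2 : a ≤ 2) : v ^ a ≤ 1 + v ^ 2 := by
  rcases le_total v 1 with h | h
  · exact (Real.rpow_le_one hv h ha).trans (by nlinarith)
  · rw [← Real.rpow_two]
    exact (Real.rpow_le_rpow_of_exponent_le h ha2).trans (by linarith)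

theorem rpow_mul_exp_le {v a K : ℝ} (hv : 0 ≤ v) (ha : 0 ≤ a) (ha2 : a ≤ 2) (hK : 0 < K) :
    v ^ a * Real.exp (-(K * v)) ≤ (1 + 8 / K ^ 2) * Real.exp (-(K / 2 * v)) := by
  have e : Real.exp (-(K * v)) = Real.exp (-(K / 2 * v)) * Real.exp (-(K / 2 * v)) := by
    rw [← Real.exp_add]; congr 1; ring
  rw [e, ← mul_assoc]
  gcongr
  rw [Real.exp_neg, ← div_eq_mul_inv, div_le_iff₀ (Real.exp_pos _)]
  refine (rpow_le_one_add_sq hv ha ha2).trans ?_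
  have h1 := Real.quadratic_le_exp_of_nonneg (show 0 ≤ K / 2 * v by positivity)
  have h2 : 1 + v ^ 2 ≤ (1 + 8 / K ^ 2) * (1 + K / 2 * v + (K / 2 * v) ^ 2 / 2) := by
    have e : (1 + 8 / K ^ 2) * (1 + K / 2 * v + (K / 2 * v) ^ 2 / 2) =
      1 + v ^ 2 + (K / 2 * v + (K / 2 * v) ^ 2 / 2 + 8 / K ^ 2 * (1 + K / 2 * v)) := by
      field_simp; ring
    rw [e]
    have : 0 ≤ K / 2 * v + (K / 2 * v) ^ 2 / 2 + 8 / K ^ 2 * (1 + K / 2 * v) := by positivity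
    linarith
  exact h2.trans (by gcongr)

/-- Local central limit theorem with rate. -/
theorem exists_lclt (d : ℕ) (M K θ p : ℝ) (hM : 1 ≤ M) (hK : 0 < K) (hθ0 : 0 < θ) (hθ : θ ≤ 1) :
    ∃ C : ℝ, 0 < C ∧ ∀ Q g : (Fin d → ℤ) → ℝ, KernPair M K θ p Q g → ∑' y, Q y = 1 →
      ∀ t : ℝ, 0 < t → ∀ x : Fin d → ℤ,
        ‖semiI Q g t x - (((∑' y, g y) * heatKer d t (toR x) (drift Q) (covar Q) : ℝ) : ℂ)‖ ≤
          C * t ^ (-(d : ℝ) / 2 - θ / 2) := by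
  set B := (4 * M ^ 2 + 2 * M) * (1 + 8 / K ^ 2) with hB
  refine ⟨B * (2 * π / K) ^ ((d : ℝ) / 2), by positivity, fun Q g h h1 t ht x => ?_⟩
  have hM0 : 0 < M := by linarith
  have hF := h.formBounds hθ0 hθ
  have hpd := hF.posDef (show 0 < 2 * K by positivity)
  set G := ∑' y, g y with hG
  have hGM : |G| ≤ M := h.norm_tsum_g_le
  have hgauss := gaussian_fourier_matrix hpd (toR x - t • drift Q) ht
  have hsub : ∀ k, rdot k (toR x - t • drift Q) = rdotZ k x - t * rdot k (drift Q) := by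
    intro k
    rw [← rdot_smul_right, ← rdot_toR]
    simp [rdot_eq_dotProduct, dotProduct_sub]
  have hker : ∀ k : Fin d → ℝ, Complex.exp (Complex.I * (rdot k (toR x - t • drift Q) : ℂ)) *
      Complex.exp (-((t / 2 * rdot k (covar Q *ᵥ k) : ℝ) : ℂ)) =
      Complex.exp (Complex.I * (rdotZ k x : ℂ)) * Complex.exp (-(t * quadSymbol Q k)) := by
    intro k
    rw [← Complex.exp_add, ← Complex.exp_add, hsub, quadSymbol]
    congr 1
    push_cast; ring
  simp only [hker] at hgauss
  have hrho : (((G * heatKer d t (toR x) (drift Q) (covar Q) : ℝ)) : ℂ) =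
      (((2 * π) ^ d : ℝ) : ℂ)⁻¹ * ∫ k : Fin d → ℝ,
        (G : ℂ) * (Complex.exp (Complex.I * (rdotZ k x : ℂ)) * Complex.exp (-(t * quadSymbol Q k))) := by
    rw [Complex.ofReal_mul, heatKer, ← hgauss, integral_const_mul]; ring
  have hre : ∀ k, K * enormR k ^ 2 ≤ (quadSymbol Q k).re := fun k => by
    rw [quadSymbol_re]; have := hF.lower k; linarith
  have hnq : ∀ k, ‖Complex.exp (-(t * quadSymbol Q k))‖ ≤ Real.exp (-(t * K) * enormR k ^ 2) := by
    intro k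
    rw [Complex.norm_exp, Real.exp_le_exp, Complex.neg_re, Complex.re_ofReal_mul]
    have := hre k; nlinarith
  have hint2 : Integrable fun k : Fin d → ℝ =>
      (G : ℂ) * (Complex.exp (Complex.I * (rdotZ k x : ℂ)) * Complex.exp (-(t * quadSymbol Q k))) := by
    refine Integrable.const_mul ?_ _
    refine (integrable_gaussian_enormR (t * K) (by positivity)).mono' ?_ ?_
    · have := continuous_quadSymbol Q
      have := continuous_rdotZ x
      exact (by fun_prop : Continuous fun k => Complex.exp (Complex.I * (rdotZ k x : ℂ)) *
        Complex.exp (-(t * quadSymbol Q k))).aestronglyMeasurable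
    · refine ae_of_all _ fun k => ?_
      rw [norm_mul, norm_exp_I_mul, one_mul]; exact hnq k
  set Φ : (Fin d → ℝ) → ℂ := fun k => Complex.exp (Complex.I * (rdotZ k x : ℂ)) *
    (Complex.exp (-t * (1 - fourierZ Q k)) * fourierZ g k) with hΦ
  have hΦc : Continuous Φ := by
    have a1 := continuous_fourierZ h.kern.summable
    have a2 := continuous_fourierZ h.summable_g
    have a3 := continuous_rdotZ x
    fun_prop
  have hint1 : Integrable ((torus d).indicator Φ) :=
    (integrable_indicator_iff measurableSet_torus).2 (integrableOn_torus hΦc)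
  have hsem : semiI Q g t x = (((2 * π) ^ d : ℝ) : ℂ)⁻¹ * ∫ k, (torus d).indicator Φ k := by
    rw [integral_indicator measurableSet_torus]; rfl
  rw [hsem, hrho, ← mul_sub, ← integral_sub hint1 hint2, norm_mul]
  have hc : ‖(((2 * π) ^ d : ℝ) : ℂ)⁻¹‖ ≤ 1 := by
    rw [norm_inv, Complex.norm_real, Real.norm_eq_abs, abs_of_pos (by positivity)]
    apply inv_le_one_of_one_le₀
    apply one_le_pow₀
    linarith [Real.pi_gt_three]
  set E : (Fin d → ℝ) → ℝ := fun k => B * t ^ (-(θ / 2)) * Real.exp (-(t * K / 2) * enormR k ^ 2) with hE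
  have hgi := integrable_gaussian_enormR (d := d) (t * K / 2) (by positivity)
  have hθ1 : ∀ k : Fin d → ℝ, enormR k ^ θ * Real.exp (-(t * K) * enormR k ^ 2) ≤
      (1 + 8 / K ^ 2) * t ^ (-(θ / 2)) * Real.exp (-(t * K / 2) * enormR k ^ 2) := by
    intro k
    have hk := enormR_nonneg k
    have := rpow_mul_exp_le (show 0 ≤ t * enormR k ^ 2 by positivity) (show 0 ≤ θ / 2 by linarith)
      (by linarith) hK
    rw [Real.mul_rpow ht.le (by positivity), ← Real.rpow_natCast, ← Real.rpow_mul hk] at this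
    rw [show ((2 : ℕ) : ℝ) * (θ / 2) = θ by push_cast; ring, Real.rpow_natCast] at this
    calc _ = t ^ (-(θ / 2)) * (t ^ (θ / 2) * enormR k ^ θ * Real.exp (-(K * (t * enormR k ^ 2)))) := by
          rw [Real.rpow_neg ht.le, ← mul_assoc, ← mul_assoc, inv_mul_cancel₀ (by positivity), one_mul]
          congr 2; ring
      _ ≤ t ^ (-(θ / 2)) * ((1 + 8 / K ^ 2) * Real.exp (-(K / 2 * (t * enormR k ^ 2)))) := by gcongr
      _ = _ := by
        rw [show -(K / 2 * (t * enormR k ^ 2)) = -(t * K / 2) * enormR k ^ 2 by ring]; ring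
  have hθ2 : ∀ k : Fin d → ℝ, t * enormR k ^ (2 + θ) * Real.exp (-(t * K) * enormR k ^ 2) ≤
      (1 + 8 / K ^ 2) * t ^ (-(θ / 2)) * Real.exp (-(t * K / 2) * enormR k ^ 2) := by
    intro k
    have hk := enormR_nonneg k
    have := rpow_mul_exp_le (show 0 ≤ t * enormR k ^ 2 by positivity) (show 0 ≤ 1 + θ / 2 by linarith)
      (by linarith) hK
    rw [Real.mul_rpow ht.le (by positivity), ← Real.rpow_natCast, ← Real.rpow_mul hk] at this
    rw [show ((2 : ℕ) : ℝ) * (1 + θ / 2) = 2 + θ by push_cast; ring, Real.rpow_natCast,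
      Real.rpow_add ht, Real.rpow_one] at this
    calc _ = t ^ (-(θ / 2)) * (t * t ^ (θ / 2) * enormR k ^ (2 + θ) *
            Real.exp (-(K * (t * enormR k ^ 2)))) := by
          rw [show -(t * K) * enormR k ^ 2 = -(K * (t * enormR k ^ 2)) by ring, Real.rpow_neg ht.le]
          field_simp
      _ ≤ t ^ (-(θ / 2)) * ((1 + 8 / K ^ 2) * Real.exp (-(K / 2 * (t * enormR k ^ 2)))) := by gcongr
      _ = _ := by
        rw [show -(K / 2 * (t * enormR k ^ 2)) = -(t * K / 2) * enormR k ^ 2 by ring]; ring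
  have hbound : ∀ k, ‖(torus d).indicator Φ k - (G : ℂ) * (Complex.exp (Complex.I * (rdotZ k x : ℂ)) *
      Complex.exp (-(t * quadSymbol Q k)))‖ ≤ E k := by
    intro k
    have hk0 := enormR_nonneg k
    have hkθ : 0 ≤ enormR k ^ θ := Real.rpow_nonneg hk0 _
    set X := Real.exp (-(t * K) * enormR k ^ 2) with hX
    have hX0 : 0 < X := Real.exp_pos _
    have hkey : ‖(torus d).indicator Φ k - (G : ℂ) * (Complex.exp (Complex.I * (rdotZ k x : ℂ)) *
      Complex.exp (-(t * quadSymbol Q k)))‖ ≤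
        4 * M ^ 2 * (t * enormR k ^ (2 + θ) * X) + 2 * M * (enormR k ^ θ * X) := by
      by_cases hk : k ∈ torus d
      · rw [Set.indicator_of_mem hk, hΦ]
        have e : Complex.exp (Complex.I * (rdotZ k x : ℂ)) *
            (Complex.exp (-t * (1 - fourierZ Q k)) * fourierZ g k) -
            (G : ℂ) * (Complex.exp (Complex.I * (rdotZ k x : ℂ)) * Complex.exp (-(t * quadSymbol Q k))) =
            Complex.exp (Complex.I * (rdotZ k x : ℂ)) *
            ((Complex.exp (-(t * (1 - fourierZ Q k))) - Complex.exp (-(t * quadSymbol Q k))) * fourierZ g k +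
              Complex.exp (-(t * quadSymbol Q k)) * (fourierZ g k - (G : ℂ))) := by
          rw [neg_mul]; ring
        simp only []
        rw [e, norm_mul, norm_exp_I_mul, one_mul]
        refine (norm_add_le _ _).trans ?_
        rw [norm_mul, norm_mul]
        gcongr ?_ + ?_
        · have u1 := norm_exp_neg_sub_exp_neg_le (a := t * (1 - fourierZ Q k)) (b := t * quadSymbol Q k)
            (c := t * (K * enormR k ^ 2))
            (by rw [Complex.re_ofReal_mul]; have := h.kern.re_fourierZ_ge hk; gcongr)
            (by rw [Complex.re_ofReal_mul]; have := hre k; gcongr)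
          rw [← mul_sub, norm_mul, Complex.norm_real, Real.norm_eq_abs, abs_of_pos ht] at u1
          have u2 := h.norm_symbol_sub_le hθ0 hθ k
          rw [fourierZ_zero, h1, Complex.ofReal_one] at u2
          have u3 := (norm_fourierZ_le h.summable_g k).trans h.g_le
          calc _ ≤ (Real.exp (-(t * (K * enormR k ^ 2))) * (t * (4 * M * enormR k ^ (2 + θ)))) * M := by
                gcongr; exact u1.trans (by gcongr)
            _ = _ := by
              rw [hX, show -(t * (K * enormR k ^ 2)) = -(t * K) * enormR k ^ 2 by ring]; ring
        · calc _ ≤ X * (2 * M * enormR k ^ θ) := by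
                gcongr
                · exact hnq k
                · exact h.norm_fourier_g_sub_le hθ0 hθ k
            _ = _ := by ring
      · rw [Set.indicator_of_notMem hk, zero_sub, norm_neg, norm_mul, norm_mul, norm_exp_I_mul, one_mul,
          Complex.norm_real, Real.norm_eq_abs]
        have hk1 : 1 ≤ enormR k := by
          rw [mem_torus_iff] at hk
          push Not at hk
          obtain ⟨i, hi⟩ := hk
          have : |k i| ≤ enormR k := by
            rw [← Real.sqrt_sq_eq_abs]
            exact Real.sqrt_le_sqrt (Finset.single_le_sum (f := fun i => k i ^ 2)
              (fun i _ => sq_nonneg _) (Finset.mem_univ i))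
          linarith [Real.pi_gt_three]
        have h3 : 1 ≤ enormR k ^ θ := Real.one_le_rpow hk1 hθ0.le
        have h4 : 0 ≤ 4 * M ^ 2 * (t * enormR k ^ (2 + θ) * X) := by positivity
        calc |G| * _ ≤ M * X := by gcongr; exact hnq k
          _ ≤ 2 * M * (enormR k ^ θ * X) := by nlinarith [mul_pos hM0 hX0]
          _ ≤ _ := by linarith
    refine hkey.trans ?_
    calc _ ≤ 4 * M ^ 2 * ((1 + 8 / K ^ 2) * t ^ (-(θ / 2)) * Real.exp (-(t * K / 2) * enormR k ^ 2)) +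
          2 * M * ((1 + 8 / K ^ 2) * t ^ (-(θ / 2)) * Real.exp (-(t * K / 2) * enormR k ^ 2)) := by
          exact add_le_add (mul_le_mul_of_nonneg_left (hθ2 k) (by positivity))
            (mul_le_mul_of_nonneg_left (hθ1 k) (by positivity))
      _ = E k := by rw [hE, hB]; ring
  have hfin := norm_integral_le_of_norm_le (hgi.const_mul (B * t ^ (-(θ / 2)))) (ae_of_all _ hbound)
  rw [integral_const_mul, integral_gaussian_enormR _ (by positivity)] at hfin
  refine (mul_le_mul hc hfin (norm_nonneg _) zero_le_one).trans (le_of_eq ?_)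
  rw [one_mul]
  rw [show π / (t * K / 2) = 2 * π / K * t⁻¹ by field_simp, Real.mul_rpow (by positivity) (by positivity),
    Real.inv_rpow ht.le, ← Real.rpow_neg ht.le,
    show -(d : ℝ) / 2 - θ / 2 = -(θ / 2) + -((d : ℝ) / 2) by ring, Real.rpow_add ht]
  ring

theorem continuous_semiI_integrand {Q g : (Fin d → ℤ) → ℝ} (hQ : Summable fun y => |Q y|)
    (hg : Summable fun y => |g y|) (x : Fin d → ℤ) :
    Continuous (Function.uncurry fun (t : ℝ) (k : Fin d → ℝ) =>
      Complex.exp (Complex.I * (rdotZ k x : ℂ)) *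
        (Complex.exp (-t * (1 - fourierZ Q k)) * fourierZ g k)) := by
  have h1 := (continuous_fourierZ hQ).comp (continuous_snd (X := ℝ))
  have h2 := (continuous_fourierZ hg).comp (continuous_snd (X := ℝ))
  have h3 := (continuous_rdotZ x).comp (continuous_snd (X := ℝ))
  have h4 : Continuous fun p : ℝ × (Fin d → ℝ) => (p.1 : ℂ) :=
    Complex.continuous_ofReal.comp continuous_fst
  have h5 : Continuous fun p : ℝ × (Fin d → ℝ) => ((rdotZ p.2 x : ℝ) : ℂ) :=
    Complex.continuous_ofReal.comp h3
  exact (Complex.continuous_exp.comp (continuous_const.mul h5)).mul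
    ((Complex.continuous_exp.comp (h4.neg.mul (continuous_const.sub h1))).mul h2)

theorem continuous_semiI {Q g : (Fin d → ℤ) → ℝ} (hQ : Summable fun y => |Q y|)
    (hg : Summable fun y => |g y|) (x : Fin d → ℤ) : Continuous fun t => semiI Q g t x := by
  unfold semiI invF
  exact continuous_const.mul (continuous_parametric_integral_of_continuous
    (continuous_semiI_integrand hQ hg x) isCompact_torus)

theorem integral_semiI_of_gap {Q g S : (Fin d → ℤ) → ℝ} (hQ : Summable fun y => |Q y|)
    (hg : Summable fun y => |g y|) (hS : Summable fun y => |S y|)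
    (hOZ : ∀ x, S x = g x + conv Q S x) {δ : ℝ} (hδ : 0 < δ)
    (hre : ∀ k ∈ torus d, δ ≤ (1 - fourierZ Q k).re) (x : Fin d → ℤ) :
    ∫ t in Set.Ioi (0 : ℝ), semiI Q g t x = S x := by
  have hF : ∀ k, fourierZ S k * (1 - fourierZ Q k) = fourierZ g k := by
    intro k
    have h1 : fourierZ S k = fourierZ g k + fourierZ Q k * fourierZ S k := by
      rw [← fourierZ_conv hQ hS, ← fourierZ_add hg (summable_conv hQ hS)]
      congr 1
      ext y
      exact hOZ y
    linear_combination h1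
  have hcont := continuous_semiI_integrand hQ hg x
  have hint : Integrable (Function.uncurry fun (t : ℝ) (k : Fin d → ℝ) =>
      Complex.exp (Complex.I * (rdotZ k x : ℂ)) *
        (Complex.exp (-t * (1 - fourierZ Q k)) * fourierZ g k))
      ((volume.restrict (Set.Ioi (0 : ℝ))).prod (volume.restrict (torus d))) := by
    have hb : Integrable (fun p : ℝ × (Fin d → ℝ) => Real.exp (-δ * p.1) * ∑' y, |g y|)
        ((volume.restrict (Set.Ioi (0 : ℝ))).prod (volume.restrict (torus d))) := by
      refine Integrable.mul_prod (f := fun t : ℝ => Real.exp (-δ * t))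
        (g := fun _ : Fin d → ℝ => ∑' y, |g y|)
        (integrableOn_exp_mul_Ioi (by linarith) 0) ?_
      exact integrableOn_const volume_torus_lt_top.ne
    refine hb.mono' hcont.aestronglyMeasurable ?_
    rw [Measure.prod_restrict]
    filter_upwards [ae_restrict_mem (measurableSet_Ioi.prod measurableSet_torus)] with p hp
    obtain ⟨hp1, hp2⟩ := hp
    simp only [Function.uncurry]
    rw [norm_mul, norm_exp_I_mul, one_mul, norm_mul, Complex.norm_exp]
    have hp1 : 0 < p.1 := hp1
    refine mul_le_mul (Real.exp_le_exp.2 ?_) (norm_fourierZ_le hg _) (norm_nonneg _)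
      (Real.exp_nonneg _)
    have : (-(p.1 : ℂ) * (1 - fourierZ Q p.2)).re = -(p.1 * (1 - fourierZ Q p.2).re) := by
      simp [Complex.mul_re]
    rw [this]
    nlinarith [hre _ hp2]
  have hswap := integral_integral_swap hint
  have : ∫ k in torus d, ∫ t in Set.Ioi (0 : ℝ), Complex.exp (Complex.I * (rdotZ k x : ℂ)) *
        (Complex.exp (-t * (1 - fourierZ Q k)) * fourierZ g k) =
      ∫ k in torus d, Complex.exp (Complex.I * (rdotZ k x : ℂ)) * fourierZ S k := by
    refine setIntegral_congr_fun measurableSet_torus fun k hk => ?_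
    have hψ : 0 < (1 - fourierZ Q k).re := hδ.trans_le (hre k hk)
    have hψ0 : (1 - fourierZ Q k) ≠ 0 := fun h => by simp [h] at hψ
    rw [integral_const_mul, integral_mul_const]
    have e : ∀ t : ℝ, -(t : ℂ) * (1 - fourierZ Q k) = -(1 - fourierZ Q k) * t := fun t => by ring
    simp_rw [e]
    rw [integral_exp_mul_complex_Ioi (by simpa using hψ), ← hF k]
    simp only [Complex.ofReal_zero, mul_zero, Complex.exp_zero]
    field_simp
  rw [this] at hswap
  unfold semiI invF
  rw [integral_const_mul, hswap]
  exact invF_fourierZ hS x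

theorem mem_Omega_iff {S : (Fin d → ℤ) → ℝ} (hS : ∀ x, 0 ≤ S x) (μ : Fin d → ℝ) :
    μ ∈ Omega S ↔ Summable (tilt S μ) := by
  have h0 : ∀ x, 0 ≤ tilt S μ x := fun x => mul_nonneg (hS x) (Real.exp_nonneg _)
  constructor
  · intro h
    have := ENNReal.summable_toReal (ne_of_lt h)
    refine this.congr fun x => ?_
    exact ENNReal.toReal_ofReal (h0 x)
  · intro h
    exact h.tsum_ofReal_lt_top

theorem rdotZ_combo (a b : ℝ) (μ ν : Fin d → ℝ) (x : Fin d → ℤ) :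
    rdotZ (a • μ + b • ν) x = a * rdotZ μ x + b * rdotZ ν x := by
  simp only [rdotZ, Pi.add_apply, Pi.smul_apply, smul_eq_mul, Finset.mul_sum,
    ← Finset.sum_add_distrib]
  exact Finset.sum_congr rfl fun i _ => by ring

theorem rdotZ_smul (a : ℝ) (μ : Fin d → ℝ) (x : Fin d → ℤ) :
    rdotZ (a • μ) x = a * rdotZ μ x := by
  simpa using rdotZ_combo a 0 μ 0 x

theorem convex_Omega {S : (Fin d → ℤ) → ℝ} (hS : ∀ x, 0 ≤ S x) : Convex ℝ (Omega S) := by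
  intro μ hμ ν hν a b ha hb hab
  rw [mem_Omega_iff hS] at *
  refine Summable.of_nonneg_of_le (fun x => mul_nonneg (hS x) (Real.exp_nonneg _)) (fun x => ?_)
    ((hμ.mul_left a).add (hν.mul_left b))
  have := convexOn_exp.2 (Set.mem_univ (rdotZ μ x)) (Set.mem_univ (rdotZ ν x)) ha hb hab
  simp only [smul_eq_mul] at this
  simp only [tilt, rdotZ_combo]
  nlinarith [hS x]

theorem AssumptionOmega.smul_mem {S : (Fin d → ℤ) → ℝ} (h : AssumptionOmega S) {μ : Fin d → ℝ}
    (hμ : μ ∈ closure (Omega S)) {s : ℝ} (hs0 : 0 ≤ s) (hs : s < 1) : s • μ ∈ Omega S := by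
  have h0 : (0 : Fin d → ℝ) ∈ interior (Omega S) := by
    rw [h.open_Omega.interior_eq]; exact h.zero_mem
  have := (convex_Omega h.nonneg).combo_interior_closure_mem_interior h0 hμ
    (a := 1 - s) (b := s) (by linarith) hs0 (by ring)
  rw [smul_zero, zero_add] at this
  exact interior_subset this

theorem exp_smul_le {s : ℝ} (hs0 : 0 ≤ s) (hs : s ≤ 1) (μ : Fin d → ℝ) (y : Fin d → ℤ) :
    Real.exp (rdotZ (s • μ) y) ≤ 1 + Real.exp (rdotZ μ y) := by
  rw [rdotZ_smul]
  rcases le_total 0 (rdotZ μ y) with h | h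
  · have : Real.exp (s * rdotZ μ y) ≤ Real.exp (rdotZ μ y) := Real.exp_le_exp.2 (by nlinarith)
    linarith
  · have : Real.exp (s * rdotZ μ y) ≤ 1 := Real.exp_le_one_iff.2 (by nlinarith)
    linarith [Real.exp_nonneg (rdotZ μ y)]

theorem tendsto_tsum_exp_smul {E : Type*} [NormedAddCommGroup E] [NormedSpace ℝ E] [CompleteSpace E]
    {w : (Fin d → ℤ) → E} {μ : Fin d → ℝ} (hw : Summable fun y => ‖w y‖)
    (hw' : Summable fun y => Real.exp (rdotZ μ y) * ‖w y‖) :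
    Tendsto (fun s : ℝ => ∑' y, Real.exp (rdotZ (s • μ) y) • w y) (𝓝[<] 1)
      (𝓝 (∑' y, Real.exp (rdotZ μ y) • w y)) := by
  refine tendsto_tsum_of_dominated_convergence (hw.add hw') (fun y => ?_) ?_
  · have : ContinuousAt (fun s : ℝ => Real.exp (rdotZ (s • μ) y) • w y) 1 := by
      simp_rw [rdotZ_smul]
      fun_prop
    have := this.tendsto
    rw [one_smul] at this
    exact this.mono_left nhdsWithin_le_nhds
  · filter_upwards [Ico_mem_nhdsLT (show (0 : ℝ) < 1 by norm_num)] with s hs y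
    rw [norm_smul, Real.norm_of_nonneg (Real.exp_nonneg _)]
    nlinarith [exp_smul_le hs.1 hs.2.le μ y, norm_nonneg (w y)]

theorem AssumptionJ.summable_J {S J h : (Fin d → ℤ) → ℝ} {M K ζ : ℝ}
    (hJ : AssumptionJ S J h M K ζ) {μ : Fin d → ℝ} (hμ : μ ∈ closure (Omega S)) :
    (Summable fun y => |tilt J μ y|) ∧ ∑' y, |tilt J μ y| ≤ M :=
  (lpNorm_one_iff hJ.M_pos.le).1 (hJ.memQ μ hμ).Q_l1

theorem AssumptionJ.summable_h {S J h : (Fin d → ℤ) → ℝ} {M K ζ : ℝ}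
    (hJ : AssumptionJ S J h M K ζ) {μ : Fin d → ℝ} (hμ : μ ∈ closure (Omega S)) :
    (Summable fun y => |tilt h μ y|) ∧ ∑' y, |tilt h μ y| ≤ M :=
  (lpNorm_one_iff hJ.M_pos.le).1 (hJ.memQ μ hμ).g_l1

theorem AssumptionJ.tilt_OZ {S J h : (Fin d → ℤ) → ℝ} {M K ζ : ℝ}
    (hJ : AssumptionJ S J h M K ζ) (μ : Fin d → ℝ) (x : Fin d → ℤ) :
    tilt S μ x = tilt h μ x + conv (tilt J μ) (tilt S μ) x := by
  rw [conv_tilt]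
  simp only [tilt]
  rw [← add_mul, ← hJ.OZ_eq]

theorem AssumptionOmega.tilt_nonneg {S : (Fin d → ℤ) → ℝ} (hΩ : AssumptionOmega S)
    (μ : Fin d → ℝ) (x : Fin d → ℤ) : 0 ≤ tilt S μ x :=
  mul_nonneg (hΩ.nonneg x) (Real.exp_nonneg _)

theorem AssumptionJ.susceptibility_mul {S J h : (Fin d → ℤ) → ℝ} {M K ζ : ℝ}
    (hΩ : AssumptionOmega S) (hJ : AssumptionJ S J h M K ζ) {μ : Fin d → ℝ} (hμ : μ ∈ Omega S) :
    (∑' y, tilt S μ y) * (1 - ∑' y, tilt J μ y) = tiltSum h μ := by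
  have hμ' := subset_closure hμ
  have hS : Summable fun y => |tilt S μ y| := ((mem_Omega_iff hΩ.nonneg μ).1 hμ).abs
  have h1 : fourierZ (tilt S μ) 0 =
      fourierZ (tilt h μ) 0 + fourierZ (tilt J μ) 0 * fourierZ (tilt S μ) 0 := by
    rw [← fourierZ_conv (hJ.summable_J hμ').1 hS,
      ← fourierZ_add (hJ.summable_h hμ').1 (summable_conv (hJ.summable_J hμ').1 hS)]
    congr 1
    ext y
    exact hJ.tilt_OZ μ y
  simp only [fourierZ_zero] at h1
  have h2 : ∑' y, tilt S μ y = ∑' y, tilt h μ y + (∑' y, tilt J μ y) * ∑' y, tilt S μ y := by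
    exact_mod_cast h1
  change _ = ∑' y, tilt h μ y
  linear_combination h2

theorem AssumptionJ.tsum_J_lt_one {S J h : (Fin d → ℤ) → ℝ} {M K ζ : ℝ}
    (hΩ : AssumptionOmega S) (hJ : AssumptionJ S J h M K ζ) {μ : Fin d → ℝ} (hμ : μ ∈ Omega S) :
    ∑' y, tilt J μ y < 1 := by
  have h1 := hJ.susceptibility_mul hΩ hμ
  have h2 := hJ.hhat_pos μ (subset_closure hμ)
  have h3 : 0 ≤ ∑' y, tilt S μ y := tsum_nonneg fun y => hΩ.tilt_nonneg μ y
  by_contra hcon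
  nlinarith

theorem tendsto_tsum_tilt_smul {f : (Fin d → ℤ) → ℝ} {μ : Fin d → ℝ} (hw : Summable fun y => |f y|)
    (hw' : Summable fun y => |tilt f μ y|) :
    Tendsto (fun s : ℝ => ∑' y, tilt f (s • μ) y) (𝓝[<] 1) (𝓝 (∑' y, tilt f μ y)) := by
  have := tendsto_tsum_exp_smul (w := f) (μ := μ) hw
    (hw'.congr fun y => by
      simp only [tilt, abs_mul, Real.norm_eq_abs, abs_of_nonneg (Real.exp_nonneg _), mul_comm])
  simpa only [tilt, smul_eq_mul, mul_comm] using this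

theorem tendsto_fourierZ_tilt_smul {f : (Fin d → ℤ) → ℝ} {μ : Fin d → ℝ}
    (hw : Summable fun y => |f y|) (hw' : Summable fun y => |tilt f μ y|) (k : Fin d → ℝ) :
    Tendsto (fun s : ℝ => fourierZ (tilt f (s • μ)) k) (𝓝[<] 1) (𝓝 (fourierZ (tilt f μ) k)) := by
  have := tendsto_tsum_exp_smul (w := fun y => (f y : ℂ) * Complex.exp (-Complex.I * (rdotZ k y : ℂ)))
    (μ := μ) (hw.congr fun y => (norm_fourier_term f k y).symm)
    (hw'.congr fun y => by
      simp only [tilt, abs_mul, norm_fourier_term, abs_of_nonneg (Real.exp_nonneg _), mul_comm])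
  refine (this.congr fun s => ?_).trans (le_of_eq ?_)
  · refine tsum_congr fun y => ?_
    simp only [tilt, Complex.real_smul]
    push_cast
    ring
  · congr 1
    refine tsum_congr fun y => ?_
    simp only [tilt, Complex.real_smul]
    push_cast
    ring

theorem AssumptionOmega.zero_mem_closure {S : (Fin d → ℤ) → ℝ} (hΩ : AssumptionOmega S) :
    (0 : Fin d → ℝ) ∈ closure (Omega S) := subset_closure hΩ.zero_mem

theorem AssumptionJ.tendsto_tsum_J {S J h : (Fin d → ℤ) → ℝ} {M K ζ : ℝ}
    (hJ : AssumptionJ S J h M K ζ) {μ : Fin d → ℝ}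
    (hμ : μ ∈ closure (Omega S)) :
    Tendsto (fun s : ℝ => ∑' y, tilt J (s • μ) y) (𝓝[<] 1) (𝓝 (∑' y, tilt J μ y)) :=
  tendsto_tsum_tilt_smul hJ.J_summable (hJ.summable_J hμ).1

theorem AssumptionJ.tsum_J_le_one {S J h : (Fin d → ℤ) → ℝ} {M K ζ : ℝ}
    (hΩ : AssumptionOmega S) (hJ : AssumptionJ S J h M K ζ) {μ : Fin d → ℝ}
    (hμ : μ ∈ closure (Omega S)) : ∑' y, tilt J μ y ≤ 1 := by
  refine le_of_tendsto (hJ.tendsto_tsum_J hμ) ?_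
  filter_upwards [Ico_mem_nhdsLT (show (0 : ℝ) < 1 by norm_num)] with s hs
  exact (hJ.tsum_J_lt_one hΩ (hΩ.smul_mem hμ hs.1 hs.2)).le

theorem AssumptionJ.tsum_J_eq_one {S J h : (Fin d → ℤ) → ℝ} {M K ζ : ℝ}
    (hΩ : AssumptionOmega S) (hJ : AssumptionJ S J h M K ζ) {μ : Fin d → ℝ}
    (hμ : μ ∈ frontier (Omega S)) : ∑' y, tilt J μ y = 1 := by
  have hμc : μ ∈ closure (Omega S) := frontier_subset_closure hμ
  refine le_antisymm (hJ.tsum_J_le_one hΩ hμc) ?_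
  by_contra! hlt
  set F := ∑' y, tilt J μ y with hF
  have hev : ∀ᶠ s in 𝓝[<] (1 : ℝ), ∑' y, tilt S (s • μ) y ≤ M / ((1 - F) / 2) := by
    filter_upwards [Ico_mem_nhdsLT (show (0 : ℝ) < 1 by norm_num),
      (hJ.tendsto_tsum_J hμc).eventually_lt_const (show F < (1 + F) / 2 by linarith)] with s hs hs2
    have hm := hΩ.smul_mem hμc hs.1 hs.2
    have h1 := hJ.susceptibility_mul hΩ hm
    obtain ⟨h4, h5⟩ := hJ.summable_h (subset_closure hm)
    have h2 : tiltSum h (s • μ) ≤ M :=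
      (h4.of_abs.tsum_le_tsum (fun y => le_abs_self _) h4).trans h5
    have h3 : 0 ≤ ∑' y, tilt S (s • μ) y := tsum_nonneg fun y => hΩ.tilt_nonneg _ y
    rw [le_div_iff₀ (by linarith)]
    nlinarith
  have hsum : Summable (tilt S μ) := by
    refine summable_of_sum_le (c := M / ((1 - F) / 2)) (hΩ.tilt_nonneg μ) fun u => ?_
    have ht : Tendsto (fun s : ℝ => ∑ y ∈ u, tilt S (s • μ) y) (𝓝[<] 1) (𝓝 (∑ y ∈ u, tilt S μ y)) := by
      have : ContinuousAt (fun s : ℝ => ∑ y ∈ u, tilt S (s • μ) y) 1 := by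
        simp only [tilt, rdotZ_smul]
        fun_prop
      have := this.tendsto
      rw [one_smul] at this
      exact this.mono_left nhdsWithin_le_nhds
    refine le_of_tendsto ht ?_
    filter_upwards [hev, Ico_mem_nhdsLT (show (0 : ℝ) < 1 by norm_num)] with s hs hs'
    have hm := (mem_Omega_iff hΩ.nonneg _).1 (hΩ.smul_mem hμc hs'.1 hs'.2)
    exact (hm.sum_le_tsum u fun y _ => hΩ.tilt_nonneg _ y).trans hs
  have := hΩ.open_Omega.inter_frontier_eq
  exact (this.subset ⟨(mem_Omega_iff hΩ.nonneg μ).2 hsum, hμ⟩).elim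

theorem AssumptionJ.kernPair {S J h : (Fin d → ℤ) → ℝ} {M K ζ : ℝ}
    (hΩ : AssumptionOmega S) (hJ : AssumptionJ S J h M K ζ) (hd : 1 ≤ d) {μ : Fin d → ℝ}
    (hμ : μ ∈ closure (Omega S)) :
    KernPair (max M 1) K (min ζ 1) (min (pExp d ζ) 2) (tilt J μ) (tilt h μ) :=
  (hJ.memQ μ hμ).kernPair hJ.K_pos hJ.zeta_pos hd (hJ.tsum_J_le_one hΩ hμ)

theorem exists_dominator (hd : 1 ≤ d) {M K θ p : ℝ} (hM : 1 ≤ M) (hK : 0 < K) (hp : TailExp d p)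
    {e : ℝ} (he : 0 < e) (x : Fin d → ℤ) :
    ∃ b : ℝ → ℝ, IntegrableOn b (Set.Ioi 0) ∧ ∀ Q g : (Fin d → ℤ) → ℝ, KernPair M K θ p Q g →
      e ≤ enormR (drift Q) → ∀ t ∈ Set.Ioi (0 : ℝ), ‖semiI Q g t x‖ ≤ b t := by
  obtain ⟨C₁, hC₁, H₁⟩ := exists_semiI_bound d M K hM hK
  obtain ⟨C₂, hC₂, H₂⟩ := exists_semiI_tail_two d M K θ p hM hK hp
  have hd' : (1 : ℝ) ≤ d := by exact_mod_cast hd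
  set r := enormR (toR x) with hr
  have hr0 : 0 ≤ r := enormR_nonneg _
  set t₁ := max 1 (2 * r / e) with ht₁
  have ht₁1 : 1 ≤ t₁ := le_max_left _ _
  set b₂ : ℝ → ℝ := fun t => 4 * C₂ / e ^ 2 * t ^ (-1 - (d : ℝ) / 2) with hb₂
  set b₁ : ℝ → ℝ := (Set.Ioc 0 t₁).indicator fun _ => C₁ with hb₁
  set b₃ : ℝ → ℝ := (Set.Ioi t₁).indicator b₂ with hb₃
  have h1 : Integrable b₁ := by
    rw [hb₁, integrable_indicator_iff measurableSet_Ioc]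
    exact integrableOn_const (by simp)
  have h3 : Integrable b₃ := by
    rw [hb₃, integrable_indicator_iff measurableSet_Ioi]
    exact (integrableOn_Ioi_rpow_of_lt (by linarith) (by linarith)).const_mul _
  refine ⟨fun t => b₁ t + b₃ t, (h1.add h3).integrableOn, fun Q g h he' t ht => ?_⟩
  have ht0 : 0 < t := ht
  rcases le_or_gt t t₁ with hlt | hlt
  · have e1 : b₁ t = C₁ := Set.indicator_of_mem (show t ∈ Set.Ioc 0 t₁ from ⟨ht0, hlt⟩) _
    have e3 : b₃ t = 0 := Set.indicator_of_notMem (by simpa using hlt) _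
    simp only [e1, e3, add_zero]
    refine (H₁ Q g h.kern h.summable_g h.g_le t ht0.le x).trans ?_
    refine mul_le_of_le_one_right hC₁.le ?_
    exact Real.rpow_le_one_of_one_le_of_nonpos (le_max_left _ _) (by linarith)
  · have e1 : b₁ t = 0 := Set.indicator_of_notMem (by simp [hlt]) _
    have e3 : b₃ t = b₂ t := Set.indicator_of_mem (show t ∈ Set.Ioi t₁ from hlt) _
    simp only [e1, e3, zero_add]
    have ht1 : 1 ≤ t := ht₁1.trans hlt.le
    have h4 := H₂ Q g h t ht0.le x
    rw [max_eq_right ht1] at h4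
    have h5 : t * e ≤ enormR (toR x - t • drift Q) + r := by
      have h6 := enormR_add_le (t • drift Q - toR x) (toR x)
      rw [sub_add_cancel, enormR_smul, abs_of_pos ht0] at h6
      have h7 : enormR (t • drift Q - toR x) = enormR (toR x - t • drift Q) := by
        rw [enormR_eq_norm, enormR_eq_norm, ← norm_neg, ← WithLp.toLp_neg, neg_sub]
      rw [h7] at h6
      nlinarith
    have h8 : 2 * r < t * e := by
      have : 2 * r / e < t := (le_max_right _ _).trans_lt hlt
      rwa [div_lt_iff₀ he] at this
    have h9 : (t * e / 2) ^ 2 ≤ enormR (toR x - t • drift Q) ^ 2 := by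
      refine pow_le_pow_left₀ (by positivity) ?_ 2
      linarith
    have h10 : (t * e / 2) ^ 2 * ‖semiI Q g t x‖ ≤ C₂ * t ^ (1 - (d : ℝ) / 2) :=
      (mul_le_mul_of_nonneg_right h9 (norm_nonneg _)).trans h4
    have h11 : t ^ (1 - (d : ℝ) / 2) = t ^ 2 * t ^ (-1 - (d : ℝ) / 2) := by
      rw [← Real.rpow_natCast, ← Real.rpow_add ht0]; congr 1; push_cast; ring
    rw [h11] at h10
    have h12 : 0 < t ^ 2 * e ^ 2 / 4 := by positivity
    refine le_of_mul_le_mul_left ?_ h12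
    calc t ^ 2 * e ^ 2 / 4 * ‖semiI Q g t x‖ = (t * e / 2) ^ 2 * ‖semiI Q g t x‖ := by ring
      _ ≤ _ := h10
      _ = _ := by simp only [hb₂]; field_simp

theorem tendsto_semiI {ι : Type*} {l : Filter ι} [l.IsCountablyGenerated] {M : ℝ}
    {Q g : ι → (Fin d → ℤ) → ℝ}
    {Q₀ g₀ : (Fin d → ℤ) → ℝ} {t : ℝ} (ht : 0 ≤ t) (x : Fin d → ℤ)
    (hQ : ∀ᶠ i in l, Summable fun y => |Q i y|) (hg : ∀ᶠ i in l, Summable fun y => |g i y|)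
    (hgM : ∀ᶠ i in l, ∑' y, |g i y| ≤ M)
    (hre : ∀ᶠ i in l, ∀ k ∈ torus d, 0 ≤ (1 - fourierZ (Q i) k).re)
    (hQl : ∀ k, Tendsto (fun i => fourierZ (Q i) k) l (𝓝 (fourierZ Q₀ k)))
    (hgl : ∀ k, Tendsto (fun i => fourierZ (g i) k) l (𝓝 (fourierZ g₀ k))) :
    Tendsto (fun i => semiI (Q i) (g i) t x) l (𝓝 (semiI Q₀ g₀ t x)) := by
  unfold semiI invF
  refine Tendsto.const_mul _ ?_
  refine tendsto_integral_filter_of_dominated_convergence (fun _ => M) ?_ ?_ ?_ ?_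
  · filter_upwards [hQ, hg] with i h1 h2
    have := (continuous_semiI_integrand h1 h2 x).comp
      (Continuous.prodMk_right t : Continuous fun k : Fin d → ℝ => (t, k))
    exact this.aestronglyMeasurable
  · filter_upwards [hg, hgM, hre] with i h2 h3 h4
    filter_upwards [ae_restrict_mem measurableSet_torus] with k hk
    rw [norm_mul, norm_exp_I_mul, one_mul, norm_mul, Complex.norm_exp]
    have e : (-(t : ℂ) * (1 - fourierZ (Q i) k)).re = -(t * (1 - fourierZ (Q i) k).re) := by
      simp [Complex.mul_re]
    have h5 : Real.exp (-(t : ℂ) * (1 - fourierZ (Q i) k)).re ≤ 1 := by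
      rw [e, Real.exp_le_one_iff]
      nlinarith [mul_nonneg ht (h4 k hk)]
    exact (mul_le_of_le_one_left (norm_nonneg _) h5).trans ((norm_fourierZ_le h2 k).trans h3)
  · exact integrableOn_const volume_torus_lt_top.ne
  · refine Eventually.of_forall fun k => ?_
    have h1 := (hQl k).const_sub 1
    have h2 := (h1.const_mul (-(t : ℂ))).cexp
    exact (h2.mul (hgl k)).const_mul _

theorem AssumptionJ.tendsto_drift {S J h : (Fin d → ℤ) → ℝ} {M K ζ : ℝ}
    (hΩ : AssumptionOmega S) (hJ : AssumptionJ S J h M K ζ) (hd : 1 ≤ d) {μ : Fin d → ℝ}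
    (hμ : μ ∈ closure (Omega S)) :
    Tendsto (fun s : ℝ => enormR (drift (tilt J (s • μ)))) (𝓝[<] 1)
      (𝓝 (enormR (drift (tilt J μ)))) := by
  refine (continuous_enormR.tendsto _).comp (tendsto_pi_nhds.2 fun j => ?_)
  have h0 := (hJ.kernPair hΩ hd hΩ.zero_mem_closure).kern.summable_sq
  have h1 := (hJ.kernPair hΩ hd hμ).kern.summable_sq
  have e : tilt J 0 = J := by ext y; simp [tilt, rdotZ]
  rw [e] at h0
  have := tendsto_tsum_tilt_smul (f := fun y => (y j : ℝ) * J y) (μ := μ)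
    (summable_coord_mul h0 j).abs
    ((summable_coord_mul h1 j).abs.congr fun y => by simp only [tilt, mul_assoc])
  simpa only [drift, tilt, mul_assoc] using this

theorem AssumptionJ.integral_semiI {S J h : (Fin d → ℤ) → ℝ} {M K ζ : ℝ}
    (hΩ : AssumptionOmega S) (hJ : AssumptionJ S J h M K ζ) (hd : 1 ≤ d) {μ : Fin d → ℝ}
    (hμ : μ ∈ frontier (Omega S)) (hη : 0 < enormR (drift (tilt J μ))) (x : Fin d → ℤ) :
    IntegrableOn (fun t => semiI (tilt J μ) (tilt h μ) t x) (Set.Ioi 0) ∧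
      ∫ t in Set.Ioi (0 : ℝ), semiI (tilt J μ) (tilt h μ) t x = tilt S μ x := by
  have hμc : μ ∈ closure (Omega S) := frontier_subset_closure hμ
  have hp := hJ.kernPair hΩ hd hμc
  have hM1 : 1 ≤ max M 1 := le_max_right _ _
  obtain ⟨b, hb, H⟩ := exists_dominator (θ := min ζ 1) hd hM1 hJ.K_pos
    (tailExp_min_pExp hd hJ.zeta_pos) (half_pos hη) x
  have hs01 := Ico_mem_nhdsLT (show (0 : ℝ) < 1 by norm_num)
  have hcl : ∀ s ∈ Set.Ico (0 : ℝ) 1, s • μ ∈ closure (Omega S) := fun s hs =>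
    subset_closure (hΩ.smul_mem hμc hs.1 hs.2)
  refine ⟨?_, ?_⟩
  · refine Integrable.mono' hb
      (continuous_semiI hp.kern.summable hp.summable_g x).aestronglyMeasurable ?_
    filter_upwards [ae_restrict_mem measurableSet_Ioi] with t ht
    exact H _ _ hp (by linarith) t ht
  have hlim : Tendsto (fun s : ℝ => ∫ t in Set.Ioi (0 : ℝ),
      semiI (tilt J (s • μ)) (tilt h (s • μ)) t x) (𝓝[<] 1)
      (𝓝 (∫ t in Set.Ioi (0 : ℝ), semiI (tilt J μ) (tilt h μ) t x)) := by
    refine tendsto_integral_filter_of_dominated_convergence b ?_ ?_ hb ?_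
    · filter_upwards [hs01] with s hs
      have hp' := hJ.kernPair hΩ hd (hcl s hs)
      exact (continuous_semiI hp'.kern.summable hp'.summable_g x).aestronglyMeasurable
    · filter_upwards [hs01, (hJ.tendsto_drift hΩ hd hμc).eventually_const_lt (half_lt_self hη)]
        with s hs hs2
      filter_upwards [ae_restrict_mem measurableSet_Ioi] with t ht
      exact H _ _ (hJ.kernPair hΩ hd (hcl s hs)) hs2.le t ht
    · filter_upwards [ae_restrict_mem measurableSet_Ioi] with t ht
      refine tendsto_semiI (M := max M 1) (le_of_lt ht) x ?_ ?_ ?_ ?_ ?_ ?_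
      · filter_upwards [hs01] with s hs
        exact (hJ.kernPair hΩ hd (hcl s hs)).kern.summable
      · filter_upwards [hs01] with s hs
        exact (hJ.kernPair hΩ hd (hcl s hs)).summable_g
      · filter_upwards [hs01] with s hs
        exact (hJ.kernPair hΩ hd (hcl s hs)).g_le
      · filter_upwards [hs01] with s hs k hk
        refine le_trans ?_ ((hJ.kernPair hΩ hd (hcl s hs)).kern.re_fourierZ_ge hk)
        have := hJ.K_pos
        positivity
      · exact fun k => tendsto_fourierZ_tilt_smul hJ.J_summable hp.kern.summable k
      · exact fun k => tendsto_fourierZ_tilt_smul hJ.h_summable hp.summable_g k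
  have hlim2 : Tendsto (fun s : ℝ => ((tilt S (s • μ) x : ℝ) : ℂ)) (𝓝[<] 1)
      (𝓝 ((tilt S μ x : ℝ) : ℂ)) := by
    have : ContinuousAt (fun s : ℝ => ((tilt S (s • μ) x : ℝ) : ℂ)) 1 := by
      simp only [tilt, rdotZ_smul]
      fun_prop
    have := this.tendsto
    rw [one_smul] at this
    exact this.mono_left nhdsWithin_le_nhds
  refine tendsto_nhds_unique hlim (hlim2.congr' ?_)
  filter_upwards [hs01] with s hs
  have hm := hΩ.smul_mem hμc hs.1 hs.2
  have hp' := hJ.kernPair hΩ hd (hcl s hs)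
  refine (integral_semiI_of_gap hp'.kern.summable hp'.summable_g
    ((mem_Omega_iff hΩ.nonneg _).1 hm).abs (hJ.tilt_OZ _)
    (δ := 1 - ∑' y, tilt J (s • μ) y) (by linarith [hJ.tsum_J_lt_one hΩ hm]) (fun k hk => ?_) x).symm
  have h1 := hp'.kern.infrared k hk
  rw [fourierZ_zero, Complex.sub_re, Complex.ofReal_re] at h1
  rw [Complex.sub_re, Complex.one_re]
  have : 0 ≤ K * enormR k ^ 2 := by have := hJ.K_pos; positivity
  linarith

theorem integral_taylor_exp (u : ℝ) :
    ∫ s in (0 : ℝ)..1, (1 - s) * (u ^ 2 * Real.exp (s * u)) = Real.exp u - 1 - u := by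
  have h : ∀ s ∈ Set.uIcc (0 : ℝ) 1,
      HasDerivAt (fun s => (1 - s) * u * Real.exp (s * u) + Real.exp (s * u))
        ((1 - s) * (u ^ 2 * Real.exp (s * u))) s := by
    intro s _
    have h1 : HasDerivAt (fun s : ℝ => Real.exp (s * u)) (Real.exp (s * u) * u) s := by
      simpa using ((hasDerivAt_id s).mul_const u).exp
    have h2 : HasDerivAt (fun s : ℝ => (1 - s) * u) (-1 * u) s := by
      simpa using ((hasDerivAt_id s).const_sub 1).mul_const u
    exact ((h2.mul h1).add h1).congr_deriv (by ring)
  rw [intervalIntegral.integral_eq_sub_of_hasDerivAt h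
    (Continuous.intervalIntegrable (by fun_prop) _ _)]
  simp
  ring

theorem tilt_tilt (f : (Fin d → ℤ) → ℝ) (μ ν : Fin d → ℝ) : tilt (tilt f μ) ν = tilt f (μ + ν) := by
  ext y
  have : rdotZ (μ + ν) y = rdotZ μ y + rdotZ ν y := by
    simpa using rdotZ_combo 1 1 μ ν y
  simp only [tilt]
  rw [this, Real.exp_add]
  ring

theorem taylor_tsum_bounds {Q : (Fin d → ℤ) → ℝ} {v : Fin d → ℝ} {a b : ℝ}
    (h0 : Summable fun y => |Q y|)
    (h1 : Summable fun y => |tilt Q v y|)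
    (h2 : Summable fun y => enormZ y ^ 2 * |Q y|)
    (h3 : Summable fun y => enormZ y ^ 2 * |tilt Q v y|)
    (hF : ∀ s ∈ Set.Icc (0 : ℝ) 1, (Summable fun y => enormZ y ^ 2 * |tilt Q (s • v) y|) ∧
      FormBounds a b (covar (tilt Q (s • v)))) :
    a / 2 * enormR v ^ 2 ≤ ∑' y, tilt Q v y - ∑' y, Q y - rdot v (drift Q) ∧
      ∑' y, tilt Q v y - ∑' y, Q y - rdot v (drift Q) ≤ b / 2 * enormR v ^ 2 := by
  set f : ℝ → ℝ := fun s => (1 - s) * rdot v (covar (tilt Q (s • v)) *ᵥ v) with hf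
  set F : (Fin d → ℤ) → ℝ → ℝ := fun y s =>
    (1 - s) * (rdotZ v y ^ 2 * tilt Q (s • v) y) with hFdef
  have hFs : ∀ s ∈ Set.Icc (0 : ℝ) 1, HasSum (fun y => F y s) (f s) := fun s hs =>
    (hasSum_rdotZ_sq_mul (hF s hs).1 v).mul_left _
  set B : (Fin d → ℤ) → ℝ := fun y =>
    enormR v ^ 2 * (enormZ y ^ 2 * |Q y| + enormZ y ^ 2 * |tilt Q v y|) with hB
  have hBs : Summable B := (h2.add h3).mul_left _
  have hbound : ∀ y, ∀ s ∈ Set.Icc (0 : ℝ) 1, ‖F y s‖ ≤ B y := by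
    intro y s hs
    have e1 : |rdotZ v y| ^ 2 ≤ (enormR v * enormZ y) ^ 2 :=
      pow_le_pow_left₀ (abs_nonneg _) (abs_rdotZ_le v y) 2
    have e2 : |1 - s| ≤ 1 := by rw [abs_le]; constructor <;> linarith [hs.1, hs.2]
    have e3 : |tilt Q (s • v) y| ≤ |Q y| + |tilt Q v y| := by
      simp only [tilt, abs_mul, abs_of_nonneg (Real.exp_nonneg _)]
      nlinarith [exp_smul_le hs.1 hs.2 v y, abs_nonneg (Q y)]
    rw [Real.norm_eq_abs, hFdef]
    simp only [abs_mul, abs_pow]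
    calc _ ≤ 1 * ((enormR v * enormZ y) ^ 2 * (|Q y| + |tilt Q v y|)) :=
          mul_le_mul e2 (mul_le_mul e1 e3 (abs_nonneg _) (by positivity)) (by positivity) one_pos.le
      _ = B y := by simp only [hB]; ring
  have hcont : ∀ y, Continuous (F y) := fun y => by
    simp only [hFdef, tilt, rdotZ_smul]
    fun_prop
  have hsub : Set.uIoc (0 : ℝ) 1 ⊆ Set.Icc 0 1 := by
    rw [Set.uIoc_of_le zero_le_one]; exact Set.Ioc_subset_Icc_self
  have hsum := intervalIntegral.hasSum_integral_of_dominated_convergence (μ := volume)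
    (a := (0 : ℝ)) (b := 1) (F := F) (f := f) (fun y _ => B y)
    (fun y => (hcont y).aestronglyMeasurable)
    (fun y => Eventually.of_forall fun s hs => hbound y s (hsub hs))
    (Eventually.of_forall fun s _ => hBs) (by simp)
    (Eventually.of_forall fun s hs => hFs s (hsub hs))
  have hterm : ∀ y, ∫ s in (0 : ℝ)..1, F y s = tilt Q v y - Q y - rdotZ v y * Q y := by
    intro y
    have e : ∀ s, F y s = Q y * ((1 - s) * (rdotZ v y ^ 2 * Real.exp (s * rdotZ v y))) := by
      intro s
      simp only [hFdef, tilt, rdotZ_smul]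
      ring
    simp_rw [e]
    rw [intervalIntegral.integral_const_mul, integral_taylor_exp]
    simp only [tilt]
    ring
  simp_rw [hterm] at hsum
  have hval : ∫ s in (0 : ℝ)..1, f s = ∑' y, tilt Q v y - ∑' y, Q y - rdot v (drift Q) :=
    hsum.unique (((h1.of_abs.hasSum).sub h0.of_abs.hasSum).sub (hasSum_rdotZ_mul h2 v))
  have hfc : ContinuousOn f (Set.Icc 0 1) := by
    refine (continuousOn_tsum (fun y => (hcont y).continuousOn) hBs hbound).congr fun s hs => ?_
    exact (hFs s hs).tsum_eq.symm
  have hfi : IntervalIntegrable f volume 0 1 := by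
    refine ContinuousOn.intervalIntegrable ?_
    rwa [Set.uIcc_of_le zero_le_one]
  have hlin : ∀ c : ℝ, ∫ s in (0 : ℝ)..1, (1 - s) * c = c / 2 := by
    intro c
    rw [intervalIntegral.integral_mul_const, intervalIntegral.integral_sub (by simp) (by simp)]
    simp
    ring
  have hli : ∀ c : ℝ, IntervalIntegrable (fun s => (1 - s) * c) volume 0 1 := fun c =>
    Continuous.intervalIntegrable (by fun_prop) _ _
  rw [← hval]
  constructor
  · rw [show a / 2 * enormR v ^ 2 = (a * enormR v ^ 2) / 2 by ring, ← hlin]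
    exact intervalIntegral.integral_mono_on zero_le_one (hli _) hfi fun s hs =>
      mul_le_mul_of_nonneg_left ((hF s hs).2.lower v) (by linarith [hs.2])
  · rw [show b / 2 * enormR v ^ 2 = (b * enormR v ^ 2) / 2 by ring, ← hlin]
    exact intervalIntegral.integral_mono_on zero_le_one hfi (hli _) fun s hs =>
      mul_le_mul_of_nonneg_left ((hF s hs).2.upper v) (by linarith [hs.2])

theorem AssumptionJ.taylor {S J h : (Fin d → ℤ) → ℝ} {M K ζ : ℝ}
    (hΩ : AssumptionOmega S) (hJ : AssumptionJ S J h M K ζ) (hd : 1 ≤ d) {μ ν : Fin d → ℝ}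
    (hμ : μ ∈ closure (Omega S)) (hν : ν ∈ closure (Omega S)) :
    K * enormR (ν - μ) ^ 2 ≤
        ∑' y, tilt J ν y - ∑' y, tilt J μ y - rdot (ν - μ) (drift (tilt J μ)) ∧
      ∑' y, tilt J ν y - ∑' y, tilt J μ y - rdot (ν - μ) (drift (tilt J μ)) ≤
        max M 1 / 2 * enormR (ν - μ) ^ 2 := by
  have hθ0 : 0 < min ζ 1 := lt_min hJ.zeta_pos one_pos
  have hcl : ∀ s ∈ Set.Icc (0 : ℝ) 1, tilt (tilt J μ) (s • (ν - μ)) = tilt J (μ + s • (ν - μ)) ∧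
      μ + s • (ν - μ) ∈ closure (Omega S) := fun s hs =>
    ⟨tilt_tilt _ _ _, (convex_Omega hΩ.nonneg).closure.add_smul_sub_mem hμ hν hs⟩
  have e1 : tilt (tilt J μ) (ν - μ) = tilt J ν := by rw [tilt_tilt, add_sub_cancel]
  have hp := hJ.kernPair hΩ hd hμ
  have hq := hJ.kernPair hΩ hd hν
  have := taylor_tsum_bounds (Q := tilt J μ) (v := ν - μ) (a := 2 * K) (b := max M 1)
    hp.kern.summable (by rw [e1]; exact hq.kern.summable) hp.kern.summable_sq
    (by rw [e1]; exact hq.kern.summable_sq) fun s hs => by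
      obtain ⟨h1, h2⟩ := hcl s hs
      rw [h1]
      have hr := hJ.kernPair hΩ hd h2
      exact ⟨hr.kern.summable_sq, hr.formBounds hθ0 (min_le_right _ _)⟩
  rw [e1] at this
  refine ⟨le_trans (le_of_eq ?_) this.1, this.2⟩
  ring

theorem ZdSymmetric.neg_apply {f : (Fin d → ℤ) → ℝ} (hf : ZdSymmetric f) (x : Fin d → ℤ) :
    f (-x) = f x := by
  exact hf.2 (fun _ => true) x

theorem ZdSymmetric.drift_eq_zero {f : (Fin d → ℤ) → ℝ} (hf : ZdSymmetric f) : drift f = 0 := by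
  ext j
  have h : ∑' y : Fin d → ℤ, (y j : ℝ) * f y = ∑' y : Fin d → ℤ, -((y j : ℝ) * f y) := by
    rw [← (Equiv.neg (Fin d → ℤ)).tsum_eq]
    refine tsum_congr fun y => ?_
    simp [hf.neg_apply]
  rw [tsum_neg] at h
  simp only [drift, Pi.zero_apply]
  linarith

theorem tilt_zero (f : (Fin d → ℤ) → ℝ) : tilt f 0 = f := by ext y; simp [tilt, rdotZ]

theorem rdot_comm (v w : Fin d → ℝ) : rdot v w = rdot w v := dotProduct_comm v w

theorem rdot_add_left (u v w : Fin d → ℝ) : rdot (u + v) w = rdot u w + rdot v w :=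
  add_dotProduct u v w

theorem rdot_sub_left (u v w : Fin d → ℝ) : rdot (u - v) w = rdot u w - rdot v w :=
  sub_dotProduct u v w

theorem rdot_neg_left (v w : Fin d → ℝ) : rdot (-v) w = -rdot v w := neg_dotProduct v w

theorem rdot_self (v : Fin d → ℝ) : rdot v v = enormR v ^ 2 := (enormR_sq_eq_dotProduct v).symm

theorem enormR_neg (v : Fin d → ℝ) : enormR (-v) = enormR v := by
  rw [enormR_eq_norm, enormR_eq_norm, WithLp.toLp_neg, norm_neg]

theorem AssumptionJ.rdot_drift_ge {S J h : (Fin d → ℤ) → ℝ} {M K ζ : ℝ}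
    (hΩ : AssumptionOmega S) (hJ : AssumptionJ S J h M K ζ) (hd : 1 ≤ d) {μ : Fin d → ℝ}
    (hμ : μ ∈ frontier (Omega S)) : 2 * K * enormR μ ^ 2 ≤ rdot μ (drift (tilt J μ)) := by
  have hμc : μ ∈ closure (Omega S) := frontier_subset_closure hμ
  have h1 := (hJ.taylor hΩ hd hΩ.zero_mem_closure hμc).1
  have h2 := (hJ.taylor hΩ hd hμc hΩ.zero_mem_closure).1
  rw [tilt_zero, hJ.J_symm.drift_eq_zero, sub_zero] at h1
  have h3 : rdot μ 0 = 0 := dotProduct_zero μ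
  rw [zero_sub, enormR_neg, rdot_neg_left, tilt_zero] at h2
  rw [h3] at h1
  linarith

theorem AssumptionOmega.frontier_notMem {S : (Fin d → ℤ) → ℝ} (hΩ : AssumptionOmega S)
    {μ : Fin d → ℝ} (hμ : μ ∈ frontier (Omega S)) : μ ∉ Omega S := fun h =>
  (hΩ.open_Omega.inter_frontier_eq.subset ⟨h, hμ⟩).elim

theorem AssumptionOmega.enormR_pos {S : (Fin d → ℤ) → ℝ} (hΩ : AssumptionOmega S)
    {μ : Fin d → ℝ} (hμ : μ ∈ frontier (Omega S)) : 0 < enormR μ :=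
  OZpaper.enormR_pos fun h => hΩ.frontier_notMem hμ (h ▸ hΩ.zero_mem)

theorem AssumptionJ.enormR_drift_ge {S J h : (Fin d → ℤ) → ℝ} {M K ζ : ℝ}
    (hΩ : AssumptionOmega S) (hJ : AssumptionJ S J h M K ζ) (hd : 1 ≤ d) {μ : Fin d → ℝ}
    (hμ : μ ∈ frontier (Omega S)) : 2 * K * enormR μ ≤ enormR (drift (tilt J μ)) := by
  have h0 := hΩ.enormR_pos hμ
  have h1 := hJ.rdot_drift_ge hΩ hd hμ
  have h2 := (le_abs_self _).trans (abs_rdot_le μ (drift (tilt J μ)))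
  refine le_of_mul_le_mul_left ?_ h0
  nlinarith

theorem Kern.enormR_drift_le {M K : ℝ} {Q : (Fin d → ℤ) → ℝ} (h : Kern M K Q) :
    enormR (drift Q) ≤ M := by
  rcases eq_or_ne (drift Q) 0 with h0 | h0
  · rw [h0]
    simp only [enormR, Pi.zero_apply]
    simpa using (zero_le_one.trans h.one_le)
  have he := OZpaper.enormR_pos h0
  have h1 := hasSum_rdotZ_mul h.summable_sq (drift Q)
  rw [rdot_self] at h1
  have h2 : enormR (drift Q) ^ 2 ≤ enormR (drift Q) * ∑' y, enormZ y ^ 2 * |Q y| := by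
    rw [← tsum_mul_left]
    refine hasSum_le (fun y => ?_) h1 (h.summable_sq.mul_left _).hasSum
    calc rdotZ (drift Q) y * Q y ≤ |rdotZ (drift Q) y * Q y| := le_abs_self _
      _ = |rdotZ (drift Q) y| * |Q y| := abs_mul _ _
      _ ≤ (enormR (drift Q) * enormZ y ^ 2) * |Q y| :=
        mul_le_mul_of_nonneg_right ((abs_rdotZ_le _ y).trans
          (mul_le_mul_of_nonneg_left (enormZ_le_sq y) he.le)) (abs_nonneg _)
      _ = _ := by ring
  have h3 := h.sq_le
  nlinarith

theorem rdotZ_le_l1R_mul {μ : Fin d → ℝ} {x : Fin d → ℤ} {m : ℝ} (h : ∀ i, |(x i : ℝ)| ≤ m) :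
    rdotZ μ x ≤ l1R μ * m := by
  rw [rdotZ, l1R, Finset.sum_mul]
  refine Finset.sum_le_sum fun i _ => (le_abs_self _).trans ?_
  rw [abs_mul]
  exact mul_le_mul_of_nonneg_left (h i) (abs_nonneg _)

theorem rdotZ_e1R (hd : 0 < d) (t : ℝ) (x : Fin d → ℤ) : rdotZ (e1R d t) x = t * x ⟨0, hd⟩ := by
  rw [rdotZ, Finset.sum_eq_single ⟨0, hd⟩]
  · simp [e1R]
  · intro b _ hb
    have : (b : ℕ) ≠ 0 := fun h => hb (Fin.ext h)
    simp [e1R, this]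
  · simp

theorem AssumptionOmega.mem_of_l1R_le {S : (Fin d → ℤ) → ℝ} (hΩ : AssumptionOmega S) (hd : 1 ≤ d)
    {μ : Fin d → ℝ} {t : ℝ} (ht : e1R d t ∈ Omega S) (h : l1R μ ≤ t) :
    μ ∈ Omega S := by
  rw [mem_Omega_iff hΩ.nonneg] at *
  have hd0 : 0 < d := hd
  have h1 : ∀ i : Fin d, Summable fun x : Fin d → ℤ => S x * Real.exp (t * x i) := by
    intro i
    have e : (fun x => tilt S (e1R d t) x) ∘ ((Equiv.swap i ⟨0, hd0⟩).arrowCongr (Equiv.refl ℤ)) =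
        fun x : Fin d → ℤ => S x * Real.exp (t * x i) := by
      ext x
      simp only [Function.comp, tilt, rdotZ_e1R hd0]
      congr 1
      · exact hΩ.symm.1 (Equiv.swap i ⟨0, hd0⟩).symm x
      · simp [Equiv.arrowCongr]
    rw [← e]
    exact (Equiv.summable_iff _).2 ht
  have h2 : ∀ i : Fin d, Summable fun x : Fin d → ℤ => S x * Real.exp (-(t * x i)) := by
    intro i
    have := (Equiv.summable_iff (Equiv.neg (Fin d → ℤ))).2 (h1 i)
    refine this.congr fun x => ?_
    simp [hΩ.symm.neg_apply]
  have h3 := summable_sum (s := Finset.univ) fun i _ => (h1 i).add (h2 i)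
  refine Summable.of_nonneg_of_le (hΩ.tilt_nonneg μ) (fun x => ?_) h3
  obtain ⟨j, -, hj⟩ := Finset.exists_max_image Finset.univ (fun i => |(x i : ℝ)|)
    ⟨⟨0, hd0⟩, Finset.mem_univ _⟩
  have h4 : rdotZ μ x ≤ t * |(x j : ℝ)| :=
    (rdotZ_le_l1R_mul fun i => hj i (Finset.mem_univ _)).trans
      (mul_le_mul_of_nonneg_right h (abs_nonneg _))
  have h5 : Real.exp (rdotZ μ x) ≤ Real.exp (t * x j) + Real.exp (-(t * x j)) := by
    rcases abs_cases (x j : ℝ) with ⟨h6, -⟩ | ⟨h6, -⟩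
    · rw [h6] at h4
      linarith [Real.exp_le_exp.2 h4, Real.exp_nonneg (-(t * x j))]
    · rw [h6, mul_neg] at h4
      linarith [Real.exp_le_exp.2 h4, Real.exp_nonneg (t * x j)]
  refine le_trans ?_ (Finset.single_le_sum
    (f := fun i => S x * Real.exp (t * x i) + S x * Real.exp (-(t * x i)))
    (fun i _ => add_nonneg (mul_nonneg (hΩ.nonneg x) (Real.exp_nonneg _))
      (mul_nonneg (hΩ.nonneg x) (Real.exp_nonneg _))) (Finset.mem_univ j))
  rw [← mul_add]
  exact mul_le_mul_of_nonneg_left h5 (hΩ.nonneg x)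

theorem e1R_smul (s t : ℝ) : e1R d (s * t) = s • e1R d t := by
  ext i
  simp [e1R]

theorem AssumptionOmega.bddAbove_mass {S : (Fin d → ℤ) → ℝ} (hΩ : AssumptionOmega S) :
    BddAbove {t : ℝ | 0 ≤ t ∧ chi S (e1R d t) < ⊤} := by
  obtain ⟨μ₁, h0, h1⟩ := hΩ.exists_not_mem
  refine ⟨μ₁, fun t ht => ?_⟩
  by_contra! hlt
  have ht0 : 0 < t := h0.trans hlt
  apply h1
  have := hΩ.smul_mem (subset_closure (show e1R d t ∈ Omega S from ht.2)) (s := μ₁ / t)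
    (by positivity) ((div_lt_one ht0).2 hlt)
  rwa [← e1R_smul, div_mul_cancel₀ _ ht0.ne'] at this

theorem AssumptionOmega.mass_pos {S : (Fin d → ℤ) → ℝ} (hΩ : AssumptionOmega S) :
    0 < mass S := by
  have hc : Continuous fun t : ℝ => e1R d t := by
    refine continuous_pi fun i => ?_
    by_cases h : (i : ℕ) = 0 <;> simp only [e1R, h, if_true, if_false] <;> fun_prop
  have h0 : e1R d 0 = 0 := by ext i; simp [e1R]
  have hm : (fun t : ℝ => e1R d t) ⁻¹' Omega S ∈ 𝓝 (0 : ℝ) :=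
    (hΩ.open_Omega.preimage hc).mem_nhds (by simp only [Set.mem_preimage, h0]; exact hΩ.zero_mem)
  obtain ⟨ε, hε, hb⟩ := Metric.mem_nhds_iff.1 hm
  have h2 : chi S (e1R d (ε / 2)) < ⊤ := hb (by
    rw [Metric.mem_ball, Real.dist_eq, sub_zero, abs_of_pos (by positivity)]; linarith)
  exact (half_pos hε).trans_le (le_csSup hΩ.bddAbove_mass ⟨(half_pos hε).le, h2⟩)

theorem AssumptionOmega.mass_le {S : (Fin d → ℤ) → ℝ} (hΩ : AssumptionOmega S) (hd : 1 ≤ d)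
    {μ : Fin d → ℝ} (hμ : μ ∈ frontier (Omega S)) : mass S ≤ d * enormR μ := by
  have h1 : l1R μ ≤ d * enormR μ := by
    have : ∀ i ∈ Finset.univ, |μ i| ≤ enormR μ := fun i _ => by
      refine Real.le_sqrt_of_sq_le ?_
      rw [sq_abs]
      exact Finset.single_le_sum (f := fun i => μ i ^ 2) (fun i _ => sq_nonneg _) (Finset.mem_univ i)
    simpa [l1R] using Finset.sum_le_card_nsmul _ _ _ this
  have h0 : e1R d 0 ∈ Omega S := by
    have h0 : e1R d 0 = 0 := by ext i; simp [e1R]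
    rw [h0]
    exact hΩ.zero_mem
  refine le_trans (csSup_le ⟨(0 : ℝ), ⟨le_rfl, h0⟩⟩ fun t ht => ?_) h1
  by_contra! hlt
  exact hΩ.frontier_notMem hμ (hΩ.mem_of_l1R_le hd ht.2 hlt.le)

theorem AssumptionOmega.mass_mul_normS {S : (Fin d → ℤ) → ℝ} (hΩ : AssumptionOmega S)
    {x μ : Fin d → ℝ} (h : IsOptTilt S x μ) : mass S * normS S x = rdot μ x := by
  have : sSup ((fun μ => rdot μ x) '' closure (Omega S)) = rdot μ x := by
    refine IsGreatest.csSup_eq ⟨⟨μ, frontier_subset_closure h.1, rfl⟩, ?_⟩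
    rintro _ ⟨ν, hν, rfl⟩
    exact h.2 ν hν
  rw [normS, this, mul_div_cancel₀ _ hΩ.mass_pos.ne']

theorem exists_frontier_mem_Icc {E : Type*} [TopologicalSpace E] {U : Set E} (hU : IsOpen U)
    {f : ℝ → E} (hf : Continuous f) {b : ℝ} (hb : 0 ≤ b) (h0 : f 0 ∈ U)
    (h1 : f b ∉ closure U) : ∃ τ ∈ Set.Icc 0 b, f τ ∈ frontier U := by
  by_contra! hcon
  obtain ⟨τ, -, h2, h3⟩ := (isPreconnected_Icc (a := (0 : ℝ)) (b := b)) (f ⁻¹' U)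
    (f ⁻¹' (closure U)ᶜ) (hU.preimage hf) (isClosed_closure.isOpen_compl.preimage hf)
    (fun τ hτ => by
      by_cases h : f τ ∈ closure U
      · left
        by_contra h4
        exact hcon τ hτ (hU.frontier_eq ▸ ⟨h, h4⟩)
      · exact Or.inr h)
    ⟨0, ⟨le_rfl, hb⟩, h0⟩ ⟨b, ⟨hb, le_rfl⟩, h1⟩
  exact h3 (subset_closure h2)

theorem AssumptionJ.rdot_le_zero {S J h : (Fin d → ℤ) → ℝ} {M K ζ : ℝ}
    (hΩ : AssumptionOmega S) (hJ : AssumptionJ S J h M K ζ) (hd : 1 ≤ d) {x μ : Fin d → ℝ}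
    (hx : IsOptTilt S x μ) {v : Fin d → ℝ} (hv : rdot v (drift (tilt J μ)) ≤ 0) :
    rdot v x ≤ 0 := by
  by_contra! hvx
  obtain ⟨hμ, hmax⟩ := hx
  have hμc : μ ∈ closure (Omega S) := frontier_subset_closure hμ
  set p := rdot μ x with hp
  have hp0 : 0 ≤ p := by
    have := hmax 0 hΩ.zero_mem_closure
    rwa [show rdot 0 x = 0 from zero_dotProduct x] at this
  set c := 2 * p / rdot v x + 1 with hc
  have hc0 : 0 < c := by positivity
  have hcv : c * rdot v x = 2 * p + rdot v x := by rw [hc]; field_simp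
  set A := 2 * K * enormR μ ^ 2 with hA
  have hA0 : 0 < A := by
    have := hJ.K_pos
    have := hΩ.enormR_pos hμ
    positivity
  set B := max M 1 / 2 * (enormR μ + c * enormR v) ^ 2 with hB
  have hB0 : 0 ≤ B := by positivity
  set δ := min 1 (A / (2 * (B + 1))) with hδ
  have hδ0 : 0 < δ := lt_min one_pos (by positivity)
  have hδ1 : δ ≤ 1 := min_le_left _ _
  have hδB : δ * (2 * (B + 1)) ≤ A := (le_div_iff₀ (by positivity)).1 (min_le_right _ _)
  obtain ⟨τ, ⟨hτ0, hτ⟩, hfr⟩ := exists_frontier_mem_Icc hΩ.open_Omega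
    (f := fun τ : ℝ => (1 - δ) • μ + τ • v) (by fun_prop) (b := δ * c) (by positivity)
    (by simpa using hΩ.smul_mem hμc (by linarith : 0 ≤ 1 - δ) (by linarith)) (fun hcon => by
      have := hmax _ hcon
      rw [rdot_add_left, rdot_smul_left, rdot_smul_left, mul_assoc, hcv] at this
      nlinarith)
  have h1 := (hJ.taylor hΩ hd hμc (frontier_subset_closure hfr)).2
  rw [hJ.tsum_J_eq_one hΩ hμ, hJ.tsum_J_eq_one hΩ hfr] at h1
  have e1 : (1 - δ) • μ + τ • v - μ = (-δ) • μ + τ • v := by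
    ext i; simp; ring
  rw [e1, rdot_add_left, rdot_smul_left, rdot_smul_left] at h1
  have h2 : enormR ((-δ) • μ + τ • v) ≤ δ * (enormR μ + c * enormR v) := by
    refine (enormR_add_le _ _).trans ?_
    rw [enormR_smul, enormR_smul, abs_neg, abs_of_pos hδ0, abs_of_nonneg hτ0]
    nlinarith [enormR_nonneg v]
  have h3 := pow_le_pow_left₀ (enormR_nonneg _) h2 2
  have h4 := hJ.rdot_drift_ge hΩ hd hμ
  have hM0 : 0 ≤ max M 1 / 2 := by positivity
  have h5 : δ * A ≤ δ ^ 2 * B := by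
    have := mul_le_mul_of_nonneg_left h3 hM0
    rw [mul_pow] at this
    have h6 : τ * rdot v (drift (tilt J μ)) ≤ 0 := mul_nonpos_of_nonneg_of_nonpos hτ0 hv
    have h7 := mul_le_mul_of_nonneg_left h4 hδ0.le
    simp only [hB, hA]
    nlinarith
  nlinarith

theorem AssumptionJ.eq_smul_drift {S J h : (Fin d → ℤ) → ℝ} {M K ζ : ℝ}
    (hΩ : AssumptionOmega S) (hJ : AssumptionJ S J h M K ζ) (hd : 1 ≤ d) {x μ : Fin d → ℝ}
    (hx : IsOptTilt S x μ) :
    x = (enormR x / enormR (drift (tilt J μ))) • drift (tilt J μ) := by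
  set η := drift (tilt J μ) with hη
  have he : 0 < enormR η := by
    have h1 := hJ.enormR_drift_ge hΩ hd hx.1
    have h2 := hΩ.enormR_pos hx.1
    have h3 := hJ.K_pos
    exact (by positivity : 0 < 2 * K * enormR μ).trans_le h1
  set c := rdot x η / enormR η ^ 2 with hc
  have hce : c * enormR η ^ 2 = rdot x η := by rw [hc]; field_simp
  have e0 : rdot (x - c • η) η = 0 := by
    rw [rdot_sub_left, rdot_smul_left, rdot_self, hce, sub_self]
  have e1 : x - c • η = 0 := by
    by_contra hne
    have h1 := hJ.rdot_le_zero hΩ hd hx (v := x - c • η) e0.le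
    have h2 : rdot (x - c • η) x = enormR (x - c • η) ^ 2 := by
      have e : rdot x (x - c • η) = rdot (x - c • η + c • η) (x - c • η) := by
        rw [sub_add_cancel]
      rw [rdot_comm, e, rdot_add_left, rdot_smul_left, rdot_comm η, e0, rdot_self, mul_zero,
        add_zero]
    have := OZpaper.enormR_pos hne
    rw [h2] at h1
    nlinarith
  have e2 : x = c • η := sub_eq_zero.1 e1
  have h3 := hJ.rdot_le_zero hΩ hd hx (v := -η) (by
    rw [rdot_neg_left, rdot_self]; nlinarith [sq_nonneg (enormR η)])
  have hc0 : 0 ≤ c := by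
    rw [rdot_neg_left, rdot_comm] at h3
    rw [hc]
    exact div_nonneg (by linarith) (by positivity)
  have e3 : enormR x = c * enormR η := by
    conv_lhs => rw [e2]
    rw [enormR_smul, abs_of_nonneg hc0]
  rw [e3, mul_div_cancel_right₀ _ he.ne']
  exact e2

theorem setIntegral_Ioc_le_const {D : ℝ → ℝ} {a b c : ℝ} (hab : a ≤ b)
    (hD : IntegrableOn D (Set.Ioc a b)) (h : ∀ t ∈ Set.Ioc a b, D t ≤ c) :
    ∫ t in Set.Ioc a b, D t ≤ c * (b - a) := by
  calc ∫ t in Set.Ioc a b, D t ≤ ∫ _ in Set.Ioc a b, c :=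
        setIntegral_mono_on hD (integrableOn_const (by simp)) measurableSet_Ioc h
    _ = c * (b - a) := by simp [hab, mul_comm]

theorem setIntegral_Ioc_le_rpow {D : ℝ → ℝ} {s c : ℝ} (hs : 0 ≤ s)
    (hD : IntegrableOn D (Set.Ioc 0 s)) (h : ∀ t ∈ Set.Ioc 0 s, D t ≤ c * t ^ (-(1 / 2) : ℝ)) :
    ∫ t in Set.Ioc 0 s, D t ≤ 2 * c * s ^ (1 / 2 : ℝ) := by
  have hi : IntervalIntegrable (fun t : ℝ => t ^ (-(1 / 2) : ℝ)) volume 0 s :=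
    intervalIntegral.intervalIntegrable_rpow' (by norm_num)
  calc ∫ t in Set.Ioc 0 s, D t ≤ ∫ t in Set.Ioc 0 s, c * t ^ (-(1 / 2) : ℝ) :=
        setIntegral_mono_on hD (((intervalIntegrable_iff_integrableOn_Ioc_of_le hs).1 hi).const_mul c)
          measurableSet_Ioc h
    _ = c * ∫ t in (0 : ℝ)..s, t ^ (-(1 / 2) : ℝ) := by
        rw [integral_const_mul, intervalIntegral.integral_of_le hs]
    _ = 2 * c * s ^ (1 / 2 : ℝ) := by
        rw [integral_rpow (Or.inl (by norm_num)), show (-(1 / 2) + 1 : ℝ) = 1 / 2 by norm_num,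
          Real.zero_rpow (by norm_num)]
        ring

theorem setIntegral_Ioi_le_rpow {D : ℝ → ℝ} {s c p : ℝ} (hs : 0 < s) (hp : 1 < p)
    (hD : IntegrableOn D (Set.Ioi s)) (h : ∀ t ∈ Set.Ioi s, D t ≤ c * t ^ (-p)) :
    ∫ t in Set.Ioi s, D t ≤ c * s ^ (1 - p) / (p - 1) := by
  calc ∫ t in Set.Ioi s, D t ≤ ∫ t in Set.Ioi s, c * t ^ (-p) :=
        setIntegral_mono_on hD ((integrableOn_Ioi_rpow_of_lt (by linarith) hs).const_mul c)
          measurableSet_Ioi h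
    _ = c * s ^ (1 - p) / (p - 1) := by
        rw [integral_const_mul, integral_Ioi_rpow_of_lt (by linarith) hs,
          show -p + 1 = 1 - p by ring, neg_div, ← div_neg, neg_sub]
        ring

theorem setIntegral_le_lorentzian {D : ℝ → ℝ} {s : Set ℝ} (hs : MeasurableSet s) {A k T : ℝ}
    (hk : 0 < k) (hA : 0 ≤ A) (hD : IntegrableOn D s) (h₁ : ∀ t ∈ s, D t ≤ A)
    (h₂ : ∀ t ∈ s, (k * (t - T)) ^ 2 * D t ≤ A) :
    ∫ t in s, D t ≤ 2 * π * A / k := by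
  have hi : Integrable (fun t : ℝ => (1 + (k * (t - T)) ^ 2)⁻¹) :=
    ((integrable_inv_one_add_sq).comp_mul_left' hk.ne').comp_sub_right T
  have hn : ∀ t : ℝ, 0 < 1 + (k * (t - T)) ^ 2 := fun t => by positivity
  calc ∫ t in s, D t ≤ ∫ t in s, 2 * A * (1 + (k * (t - T)) ^ 2)⁻¹ := by
        refine setIntegral_mono_on hD (hi.const_mul _).integrableOn hs fun t ht => ?_
        rw [← div_eq_mul_inv, le_div_iff₀ (hn t)]
        linarith [h₁ t ht, h₂ t ht]
    _ ≤ ∫ t, 2 * A * (1 + (k * (t - T)) ^ 2)⁻¹ :=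
        setIntegral_le_integral (hi.const_mul _)
          (Eventually.of_forall fun t => by have := hn t; simp only [Pi.zero_apply]; positivity)
    _ = 2 * π * A / k := by
        rw [integral_const_mul, integral_sub_right_eq_self (fun t => (1 + (k * t) ^ 2)⁻¹) T,
          Measure.integral_comp_mul_left (fun t => (1 + t ^ 2)⁻¹) k,
          integral_univ_inv_one_add_sq, abs_of_pos (inv_pos.2 hk), smul_eq_mul]
        ring

theorem rpow_le_two_rpow_mul {t T b : ℝ} (a : ℝ) (hT : 0 < T) (h₁ : T / 2 ≤ t) (h₂ : t ≤ 2 * T)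
    (hb : |a| ≤ b) : t ^ a ≤ 2 ^ b * T ^ a := by
  have ht : 0 < t := by linarith
  have hq : (t / T) ^ a ≤ 2 ^ b := by
    rcases le_total 0 a with ha | ha
    · calc (t / T) ^ a ≤ 2 ^ a :=
            Real.rpow_le_rpow (by positivity) (by rwa [div_le_iff₀ hT]) ha
        _ ≤ 2 ^ b := Real.rpow_le_rpow_of_exponent_le (by norm_num) ((le_abs_self a).trans hb)
    · calc (t / T) ^ a ≤ (1 / 2) ^ a :=
            Real.rpow_le_rpow_of_nonpos (by norm_num) (by rw [le_div_iff₀ hT]; linarith) ha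
        _ = 2 ^ (-a) := by rw [one_div, Real.inv_rpow (by norm_num), Real.rpow_neg (by norm_num)]
        _ ≤ 2 ^ b := Real.rpow_le_rpow_of_exponent_le (by norm_num) ((neg_le_abs a).trans hb)
  calc t ^ a = (t / T) ^ a * T ^ a := by
        rw [← Real.mul_rpow (by positivity) hT.le, div_mul_cancel₀ _ hT.ne']
    _ ≤ 2 ^ b * T ^ a := mul_le_mul_of_nonneg_right hq (by positivity)

/-- Pointwise decay of the difference between a lattice semigroup and its Gaussian approximation,
along a ray moving at speed `e` that reaches the origin at time `T`. -/
structure DecayBounds (d : ℕ) (C θ e T : ℝ) (D : ℝ → ℝ) : Prop where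
  nonneg : ∀ t, 0 ≤ D t
  integrableOn : IntegrableOn D (Set.Ioi 0)
  le_rpow : ∀ t, 0 < t → D t ≤ C * t ^ (-(d : ℝ) / 2 - θ / 2)
  sq_mul_le : ∀ t, 0 < t → (d ≤ 2 ∨ 1 ≤ t) →
    (e * (t - T)) ^ 2 * D t ≤ C * (max 1 t) ^ (1 - (d : ℝ) / 2)
  pow_mul_le : 3 ≤ d → ∀ t, 0 < t → (e * |t - T|) ^ (d - 1) * D t ≤ C * t ^ (-(1 / 2) : ℝ)

namespace DecayBounds

variable {C θ e T : ℝ} {D : ℝ → ℝ}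

theorem setIntegral_Ioi_le (h : DecayBounds d C θ e T D) (hd : 1 ≤ d) (hC : 0 ≤ C) (he : 0 < e)
    {s : ℝ} (hs : 1 ≤ s) (hT : 2 * T ≤ s) :
    ∫ t in Set.Ioi s, D t ≤ 8 * C * s ^ (-(d : ℝ) / 2) / e ^ 2 := by
  have hd' : (1 : ℝ) ≤ d := by exact_mod_cast hd
  have hs0 : 0 < s := by linarith
  calc ∫ t in Set.Ioi s, D t
      ≤ (4 * C / e ^ 2) * s ^ (1 - (1 + (d : ℝ) / 2)) / ((1 + (d : ℝ) / 2) - 1) := by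
        refine setIntegral_Ioi_le_rpow hs0 (by linarith)
          (h.integrableOn.mono_set (Set.Ioi_subset_Ioi hs0.le)) fun t ht => ?_
        have ht' : s < t := ht
        have ht0 : 0 < t := by linarith
        have h1 := h.sq_mul_le t ht0 (Or.inr (by linarith))
        rw [max_eq_right (by linarith)] at h1
        have h2 : (e * (t / 2)) ^ 2 * D t ≤ (e * (t - T)) ^ 2 * D t := by
          refine mul_le_mul_of_nonneg_right ?_ (h.nonneg t)
          exact pow_le_pow_left₀ (by positivity) (mul_le_mul_of_nonneg_left (by linarith) he.le) 2
        have h3 : t ^ (1 - (d : ℝ) / 2) = t ^ (-(1 + (d : ℝ) / 2)) * t ^ 2 := by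
          rw [← Real.rpow_natCast t 2, ← Real.rpow_add ht0]; congr 1; push_cast; ring
        rw [h3] at h1
        have h4 : D t * (e ^ 2 * t ^ 2 / 4)
            ≤ 4 * C / e ^ 2 * t ^ (-(1 + (d : ℝ) / 2)) * (e ^ 2 * t ^ 2 / 4) := by
          calc D t * (e ^ 2 * t ^ 2 / 4) = (e * (t / 2)) ^ 2 * D t := by ring
            _ ≤ C * (t ^ (-(1 + (d : ℝ) / 2)) * t ^ 2) := h2.trans h1
            _ = _ := by field_simp
        exact le_of_mul_le_mul_right h4 (by positivity)
    _ = 4 * C * s ^ (-(d : ℝ) / 2) / e ^ 2 * (2 / d) := by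
        rw [show 1 - (1 + (d : ℝ) / 2) = -(d : ℝ) / 2 by ring,
          show (1 + (d : ℝ) / 2) - 1 = d / 2 by ring]
        field_simp
    _ ≤ 4 * C * s ^ (-(d : ℝ) / 2) / e ^ 2 * 2 := by
        refine mul_le_mul_of_nonneg_left ?_ (by positivity)
        rw [div_le_iff₀ (by linarith)]; linarith
    _ = _ := by ring

theorem setIntegral_Ioc_le_of_three_le (h : DecayBounds d C θ e T D) (hd : 3 ≤ d)
    {s q : ℝ} (hs : 0 ≤ s) (hq : 0 < q) (hsT : ∀ t ∈ Set.Ioc 0 s, q ≤ e * |t - T|) :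
    ∫ t in Set.Ioc 0 s, D t ≤ 2 * (C / q ^ (d - 1)) * s ^ (1 / 2 : ℝ) := by
  refine setIntegral_Ioc_le_rpow hs
    (h.integrableOn.mono_set Set.Ioc_subset_Ioi_self) fun t ht => ?_
  have h1 := h.pow_mul_le hd t ht.1
  have h2 : q ^ (d - 1) * D t ≤ (e * |t - T|) ^ (d - 1) * D t :=
    mul_le_mul_of_nonneg_right (pow_le_pow_left₀ hq.le (hsT t ht) _) (h.nonneg t)
  rw [div_mul_eq_mul_div, le_div_iff₀ (by positivity), mul_comm]
  exact h2.trans h1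

theorem setIntegral_Ioc_le_of_le_two (h : DecayBounds d C θ e T D) (hd : d ≤ 2) (hC : 0 ≤ C)
    {s m q : ℝ} (hs : 0 ≤ s) (hm : 1 ≤ m) (hsm : s ≤ m) (hq : 0 < q)
    (hsT : ∀ t ∈ Set.Ioc 0 s, q ≤ e * |t - T|) :
    ∫ t in Set.Ioc 0 s, D t ≤ C * m ^ (1 - (d : ℝ) / 2) / q ^ 2 * s := by
  have hd' : (d : ℝ) ≤ 2 := by exact_mod_cast hd
  calc ∫ t in Set.Ioc 0 s, D t ≤ C * m ^ (1 - (d : ℝ) / 2) / q ^ 2 * (s - 0) := by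
        refine setIntegral_Ioc_le_const hs
          (h.integrableOn.mono_set Set.Ioc_subset_Ioi_self) fun t ht => ?_
        have h1 := h.sq_mul_le t ht.1 (Or.inl hd)
        have h2 : q ^ 2 * D t ≤ (e * (t - T)) ^ 2 * D t := by
          refine mul_le_mul_of_nonneg_right ?_ (h.nonneg t)
          rw [mul_pow, ← sq_abs (t - T), ← mul_pow]
          exact pow_le_pow_left₀ hq.le (hsT t ht) _
        have h3 : (max 1 t) ^ (1 - (d : ℝ) / 2) ≤ m ^ (1 - (d : ℝ) / 2) :=
          Real.rpow_le_rpow (by positivity) (max_le hm (ht.2.trans hsm)) (by linarith)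
        rw [le_div_iff₀ (by positivity), mul_comm]
        exact (h2.trans h1).trans (mul_le_mul_of_nonneg_left h3 hC)
    _ = _ := by rw [sub_zero]

theorem integral_eq (h : DecayBounds d C θ e T D) {s s' : ℝ} (hs : 0 ≤ s) (hs' : s ≤ s') :
    ∫ t in Set.Ioi 0, D t = (∫ t in Set.Ioc 0 s, D t) + (∫ t in Set.Ioc s s', D t) +
      ∫ t in Set.Ioi s', D t := by
  have h1 : Set.Ioi (0 : ℝ) = Set.Ioc 0 s' ∪ Set.Ioi s' := (Set.Ioc_union_Ioi_eq_Ioi (hs.trans hs')).symm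
  have h2 : Set.Ioc (0 : ℝ) s' = Set.Ioc 0 s ∪ Set.Ioc s s' := (Set.Ioc_union_Ioc_eq_Ioc hs hs').symm
  have hi := h.integrableOn
  rw [h1, setIntegral_union (Set.Ioc_disjoint_Ioi le_rfl) measurableSet_Ioi
    (hi.mono_set Set.Ioc_subset_Ioi_self) (hi.mono_set (Set.Ioi_subset_Ioi (hs.trans hs'))), h2,
    setIntegral_union (Set.Ioc_disjoint_Ioc_of_le le_rfl) measurableSet_Ioc
    (hi.mono_set Set.Ioc_subset_Ioi_self)
    (hi.mono_set (Set.Ioc_subset_Ioi_self.trans (Set.Ioi_subset_Ioi hs)))]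

end DecayBounds

theorem half_le_mul_abs_sub {e T δ t : ℝ} (he : 0 < e) (hr0 : 0 < e * T)
    (hr : (e * T) ^ (-(3 * δ)) ≤ 1 / 2) (hL : e * (e * T) ≤ (e * T) ^ δ)
    (ht : t ≤ (e * T) ^ (2 - 4 * δ)) : e * T / 2 ≤ e * |t - T| := by
  set r := e * T with hrdef
  have hes : e * r ^ (2 - 4 * δ) ≤ r / 2 := by
    rw [show 2 - 4 * δ = 1 + -(3 * δ) + (1 - δ) by ring, Real.rpow_add hr0,
      Real.rpow_add hr0, Real.rpow_sub hr0, Real.rpow_one]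
    calc e * (r * r ^ (-(3 * δ)) * (r / r ^ δ)) = r * r ^ (-(3 * δ)) * (e * r / r ^ δ) := by ring
      _ ≤ r * (1 / 2) * 1 := by
          refine mul_le_mul (mul_le_mul_of_nonneg_left hr hr0.le) ?_ (by positivity) (by positivity)
          rw [div_le_one (by positivity)]; exact hL
      _ = r / 2 := by ring
  have h1 := mul_le_mul_of_nonneg_left ht he.le
  calc r / 2 ≤ e * (T - t) := by rw [mul_sub]; linarith
    _ ≤ e * |t - T| := by
      rw [abs_sub_comm]; exact mul_le_mul_of_nonneg_left (le_abs_self _) he.le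

namespace DecayBounds

variable {C θ e T : ℝ} {D : ℝ → ℝ}

theorem setIntegral_early_le (h : DecayBounds d C θ e T D) (hd : 1 ≤ d) (hC : 0 ≤ C) (he : 0 < e)
    (hT : 2 ≤ T) (hL : 1 ≤ e ^ 2 * T) :
    ∫ t in Set.Ioc 0 (T / 2), D t ≤ 2 ^ d * C * (T ^ (-(d : ℝ) / 2) / e ^ 2) := by
  have hT0 : 0 < T := by linarith
  have hq : 0 < e * (T / 2) := by positivity
  have hsT : ∀ t ∈ Set.Ioc 0 (T / 2), e * (T / 2) ≤ e * |t - T| := fun t ht => by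
    refine mul_le_mul_of_nonneg_left ?_ he.le
    rw [abs_sub_comm]; exact le_trans (by linarith [ht.2]) (le_abs_self _)
  by_cases hd2 : d ≤ 2
  · calc ∫ t in Set.Ioc 0 (T / 2), D t
        ≤ C * T ^ (1 - (d : ℝ) / 2) / (e * (T / 2)) ^ 2 * (T / 2) :=
          h.setIntegral_Ioc_le_of_le_two hd2 hC (by linarith) (by linarith) (by linarith) hq hsT
      _ = 2 * C * (T ^ (-(d : ℝ) / 2) / e ^ 2) := by
          rw [show 1 - (d : ℝ) / 2 = 1 + -(d : ℝ) / 2 by ring, Real.rpow_add hT0, Real.rpow_one]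
          field_simp
      _ ≤ 2 ^ d * C * (T ^ (-(d : ℝ) / 2) / e ^ 2) := by
          refine mul_le_mul_of_nonneg_right (mul_le_mul_of_nonneg_right ?_ hC) (by positivity)
          simpa using pow_le_pow_right₀ (one_le_two (α := ℝ)) hd
  · have hd3 : 3 ≤ d := by omega
    have h1 := h.setIntegral_Ioc_le_of_three_le hd3 (by linarith) hq hsT
    obtain ⟨k, rfl⟩ : ∃ k, d = k + 3 := ⟨d - 3, by omega⟩
    have h2 : e ^ 2 * T ^ (((k + 3 : ℕ) : ℝ) / 2 + 1 / 2) ≤ (e * T) ^ (k + 2) := by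
      have hs : Real.sqrt T ^ 2 = T := Real.sq_sqrt hT0.le
      have h3 : 1 ≤ e * Real.sqrt T := by
        refine le_of_pow_le_pow_left₀ two_ne_zero (by positivity) ?_
        rw [mul_pow, hs, one_pow]; exact hL
      have h4 : T ^ (((k + 3 : ℕ) : ℝ) / 2 + 1 / 2) = Real.sqrt T ^ (k + 4) := by
        rw [Real.sqrt_eq_rpow, ← Real.rpow_natCast, ← Real.rpow_mul hT0.le]
        congr 1; push_cast; ring
      calc e ^ 2 * T ^ (((k + 3 : ℕ) : ℝ) / 2 + 1 / 2)
          = (e * Real.sqrt T) ^ 2 * Real.sqrt T ^ (k + 2) * 1 := by rw [h4]; ring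
        _ ≤ (e * Real.sqrt T) ^ 2 * Real.sqrt T ^ (k + 2) * (e * Real.sqrt T) ^ k :=
            mul_le_mul_of_nonneg_left (one_le_pow₀ h3) (by positivity)
        _ = (e * Real.sqrt T ^ 2) ^ (k + 2) := by ring
        _ = _ := by rw [hs]
    have h5 : (T / 2) ^ (1 / 2 : ℝ) ≤ T ^ (1 / 2 : ℝ) :=
      Real.rpow_le_rpow (by positivity) (by linarith) (by norm_num)
    calc ∫ t in Set.Ioc 0 (T / 2), D t
        ≤ 2 * (C / (e * (T / 2)) ^ (k + 2)) * (T / 2) ^ (1 / 2 : ℝ) := h1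
      _ ≤ 2 * (C / (e * (T / 2)) ^ (k + 2)) * T ^ (1 / 2 : ℝ) :=
          mul_le_mul_of_nonneg_left h5 (by positivity)
      _ = 2 ^ (k + 3) * C * (T ^ (1 / 2 : ℝ) / (e * T) ^ (k + 2)) := by
          rw [show e * (T / 2) = e * T / 2 by ring, div_pow]
          field_simp
          ring
      _ ≤ 2 ^ (k + 3) * C * (T ^ (1 / 2 : ℝ) / (e ^ 2 * T ^ (((k + 3 : ℕ) : ℝ) / 2 + 1 / 2))) :=
          mul_le_mul_of_nonneg_left (div_le_div_of_nonneg_left (by positivity) (by positivity) h2)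
            (by positivity)
      _ = _ := by
          congr 1
          rw [Real.rpow_add hT0, neg_div, Real.rpow_neg hT0.le]
          have : 0 < T ^ (1 / 2 : ℝ) := by positivity
          field_simp

theorem setIntegral_middle_le (h : DecayBounds d C θ e T D) (hC : 0 ≤ C) (hθ0 : 0 < θ)
    (hθ : θ ≤ 1) (he : 0 < e) (hT : 2 ≤ T) :
    ∫ t in Set.Ioc (T / 2) (2 * T), D t ≤
      2 * π * (2 ^ ((d : ℝ) + 1) * C) * (T ^ ((1 - (d : ℝ)) / 2 - θ / 4) / e) := by
  have hT0 : 0 < T := by linarith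
  have hd0 : (0 : ℝ) ≤ d := Nat.cast_nonneg d
  set k : ℝ := e * T ^ (-(1 / 2) - θ / 4) with hk
  have hk0 : 0 < k := by positivity
  have hsub : Set.Ioc (T / 2) (2 * T) ⊆ Set.Ioi 0 := fun t ht => by
    have := ht.1; exact lt_trans (by positivity) this
  have key := setIntegral_le_lorentzian (D := D) (s := Set.Ioc (T / 2) (2 * T)) (T := T)
    (A := 2 ^ ((d : ℝ) + 1) * C * T ^ (-(d : ℝ) / 2 - θ / 2)) measurableSet_Ioc hk0 (by positivity)
    (h.integrableOn.mono_set hsub) (fun t ht => ?_) fun t ht => ?_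
  · refine key.trans (le_of_eq ?_)
    have h1 : T ^ (-(d : ℝ) / 2 - θ / 2)
        = T ^ ((1 - (d : ℝ)) / 2 - θ / 4) * T ^ (-(1 / 2) - θ / 4) := by
      rw [← Real.rpow_add hT0]; congr 1; ring
    rw [h1, hk]
    have : 0 < T ^ (-(1 / 2) - θ / 4) := by positivity
    field_simp
  · have h1 := h.le_rpow t (hsub ht)
    have h2 : t ^ (-(d : ℝ) / 2 - θ / 2) ≤ 2 ^ ((d : ℝ) + 1) * T ^ (-(d : ℝ) / 2 - θ / 2) :=
      rpow_le_two_rpow_mul _ hT0 ht.1.le ht.2 (abs_le.2 ⟨by linarith, by linarith⟩)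
    calc D t ≤ C * t ^ (-(d : ℝ) / 2 - θ / 2) := h1
      _ ≤ C * (2 ^ ((d : ℝ) + 1) * T ^ (-(d : ℝ) / 2 - θ / 2)) := mul_le_mul_of_nonneg_left h2 hC
      _ = _ := by ring
  · have ht1 : 1 ≤ t := by linarith [ht.1]
    have h1 := h.sq_mul_le t (hsub ht) (Or.inr ht1)
    rw [max_eq_right ht1] at h1
    have h2 : t ^ (1 - (d : ℝ) / 2) ≤ 2 ^ ((d : ℝ) + 1) * T ^ (1 - (d : ℝ) / 2) :=
      rpow_le_two_rpow_mul _ hT0 ht.1.le ht.2 (abs_le.2 ⟨by linarith, by linarith⟩)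
    have h3 : T ^ (1 - (d : ℝ) / 2) * (T ^ (-(1 / 2) - θ / 4)) ^ 2
        = T ^ (-(d : ℝ) / 2 - θ / 2) := by
      rw [← Real.rpow_natCast, ← Real.rpow_mul hT0.le, ← Real.rpow_add hT0]
      congr 1; push_cast; ring
    calc (k * (t - T)) ^ 2 * D t
        = (T ^ (-(1 / 2) - θ / 4)) ^ 2 * ((e * (t - T)) ^ 2 * D t) := by rw [hk]; ring
      _ ≤ (T ^ (-(1 / 2) - θ / 4)) ^ 2 * (C * (2 ^ ((d : ℝ) + 1) * T ^ (1 - (d : ℝ) / 2))) :=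
          mul_le_mul_of_nonneg_left (h1.trans (mul_le_mul_of_nonneg_left h2 hC)) (by positivity)
      _ = 2 ^ ((d : ℝ) + 1) * C * (T ^ (1 - (d : ℝ) / 2) * (T ^ (-(1 / 2) - θ / 4)) ^ 2) := by ring
      _ = _ := by rw [h3]

/-- The bound on the total error when the drift is strong. -/
theorem integral_le_of_strong_drift (h : DecayBounds d C θ e T D) (hd : 1 ≤ d) (hC : 0 ≤ C)
    (hθ0 : 0 < θ) (hθ : θ ≤ 1) (he : 0 < e) (hT : 2 ≤ T) (hL : 1 ≤ e ^ 2 * T) :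
    ∫ t in Set.Ioi 0, D t ≤ (2 ^ d + 8 + 2 * π * 2 ^ ((d : ℝ) + 1)) * C *
      (T ^ (-(d : ℝ) / 2) / e ^ 2 + T ^ ((1 - (d : ℝ)) / 2 - θ / 4) / e) := by
  have hT0 : 0 < T := by linarith
  have h1 := h.setIntegral_early_le hd hC he hT hL
  have h2 := h.setIntegral_middle_le hC hθ0 hθ he hT
  have h3 := h.setIntegral_Ioi_le hd hC he (s := 2 * T) (by linarith) le_rfl
  have h4 : 8 * C * (2 * T) ^ (-(d : ℝ) / 2) / e ^ 2 ≤ 8 * C * (T ^ (-(d : ℝ) / 2) / e ^ 2) := by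
    rw [← mul_div_assoc]
    refine div_le_div_of_nonneg_right (mul_le_mul_of_nonneg_left ?_ (by positivity)) (by positivity)
    refine Real.rpow_le_rpow_of_nonpos hT0 (by linarith) ?_
    have : (0 : ℝ) ≤ d := Nat.cast_nonneg d
    linarith
  rw [h.integral_eq (s := T / 2) (s' := 2 * T) (by linarith) (by linarith)]
  set P := T ^ (-(d : ℝ) / 2) / e ^ 2
  set Q := T ^ ((1 - (d : ℝ)) / 2 - θ / 4) / e
  have hP : 0 ≤ P := by positivity
  have hQ : 0 ≤ Q := by positivity
  have e1 : 0 ≤ 2 * π * (2 ^ ((d : ℝ) + 1) * C) * P := by positivity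
  have e2 : 0 ≤ (2 ^ d + 8) * C * Q := by positivity
  linarith

/-- The bound on the total error when the drift is weak, in high dimension. -/
theorem integral_le_of_weak_drift_of_three_le (h : DecayBounds d C θ e T D) (hd : 3 ≤ d)
    (hC : 0 ≤ C) (hθ0 : 0 < θ) (hθ : θ ≤ 1) (he : 0 < e) {δ : ℝ} (hδ : δ = θ / (12 * d))
    (hr1 : 1 ≤ e * T) (hr : (e * T) ^ (-(3 * δ)) ≤ 1 / 2) (hL : e * (e * T) ≤ (e * T) ^ δ) :
    ∫ t in Set.Ioi 0, D t ≤ (2 ^ d + 2) * C * (e * T) ^ (2 - (d : ℝ) - 2 * δ) := by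
  set r := e * T with hrdef
  have hr0 : 0 < r := by linarith
  have hd' : (3 : ℝ) ≤ d := by exact_mod_cast hd
  have hδd : 12 * (δ * d) = θ := by rw [hδ]; field_simp
  have hδ0 : 0 < δ := by rw [hδ]; positivity
  have hδθ : 36 * δ ≤ θ := by nlinarith
  set s := r ^ (2 - 4 * δ) with hs
  have hs0 : 0 < s := by positivity
  have hsT : ∀ t ∈ Set.Ioc 0 s, r / 2 ≤ e * |t - T| := fun t ht =>
    half_le_mul_abs_sub he hr0 hr hL ht.2
  have h1 := h.setIntegral_Ioc_le_of_three_le hd hs0.le (by positivity) hsT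
  have h2 : 2 * (C / (r / 2) ^ (d - 1)) * s ^ (1 / 2 : ℝ) = 2 ^ d * C * r ^ (2 - (d : ℝ) - 2 * δ) := by
    obtain ⟨k, rfl⟩ : ∃ k, d = k + 1 := ⟨d - 1, by omega⟩
    rw [hs, ← Real.rpow_mul hr0.le, Nat.add_sub_cancel, div_pow,
      show 2 - ((k + 1 : ℕ) : ℝ) - 2 * δ = (2 - 4 * δ) * (1 / 2) - (k : ℝ) by push_cast; ring,
      Real.rpow_sub hr0, Real.rpow_natCast]
    field_simp
    ring
  have h3 : ∫ t in Set.Ioi s, D t ≤ C * s ^ (1 - ((d : ℝ) / 2 + θ / 2)) / ((d : ℝ) / 2 + θ / 2 - 1) :=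
    setIntegral_Ioi_le_rpow hs0 (by linarith)
      (h.integrableOn.mono_set (Set.Ioi_subset_Ioi hs0.le)) fun t ht => by
        have := h.le_rpow t (hs0.trans ht)
        rwa [show -(d : ℝ) / 2 - θ / 2 = -((d : ℝ) / 2 + θ / 2) by ring] at this
  have h4 : C * s ^ (1 - ((d : ℝ) / 2 + θ / 2)) / ((d : ℝ) / 2 + θ / 2 - 1)
      ≤ 2 * C * r ^ (2 - (d : ℝ) - 2 * δ) := by
    have h5 : s ^ (1 - ((d : ℝ) / 2 + θ / 2)) ≤ r ^ (2 - (d : ℝ) - 2 * δ) := by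
      rw [hs, ← Real.rpow_mul hr0.le]
      refine Real.rpow_le_rpow_of_exponent_le hr1 ?_
      nlinarith
    rw [div_le_iff₀ (by linarith)]
    calc C * s ^ (1 - ((d : ℝ) / 2 + θ / 2)) ≤ C * r ^ (2 - (d : ℝ) - 2 * δ) :=
          mul_le_mul_of_nonneg_left h5 hC
      _ = 2 * C * r ^ (2 - (d : ℝ) - 2 * δ) * (1 / 2) := by ring
      _ ≤ _ := mul_le_mul_of_nonneg_left (by linarith) (by positivity)
  rw [h.integral_eq (s := s) (s' := s) hs0.le le_rfl]
  simp only [Set.Ioc_self, Measure.restrict_empty, integral_zero_measure, add_zero]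
  rw [h2] at h1
  linarith [h3.trans h4]

/-- The bound on the total error when the drift is weak, in low dimension. -/
theorem integral_le_of_weak_drift_of_le_two (h : DecayBounds d C θ e T D) (hd1 : 1 ≤ d) (hd : d ≤ 2)
    (hC : 0 ≤ C) (hθ0 : 0 < θ) (hθ : θ ≤ 1) (he : 0 < e) {δ a : ℝ} (hδ : δ = θ / (12 * d))
    (hr1 : 1 ≤ e * T) (hr : (e * T) ^ (-(3 * δ)) ≤ 1 / 2) (hL : e * (e * T) ≤ (e * T) ^ δ)
    (ha : 0 < a) (haL : a ≤ e * (e * T)) (har : 2 / a ≤ (e * T) ^ (4 * δ)) :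
    ∫ t in Set.Ioi 0, D t ≤ (5 + 8 / a ^ 2) * C * (e * T) ^ (2 - (d : ℝ) - 2 * δ) := by
  set r := e * T with hrdef
  have hr0 : 0 < r := by linarith
  have hd' : (1 : ℝ) ≤ d := by exact_mod_cast hd1
  have hd2' : (d : ℝ) ≤ 2 := by exact_mod_cast hd
  have hδd : 12 * (δ * d) = θ := by rw [hδ]; field_simp
  have hδ0 : 0 < δ := by rw [hδ]; positivity
  have hδθ : 12 * δ ≤ θ := by nlinarith
  set s := r ^ (2 - 4 * δ) with hs
  set s' := r ^ (2 + 4 * δ) with hs'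
  have hs0 : 0 < s := by positivity
  have hs1 : 1 ≤ s := Real.one_le_rpow hr1 (by linarith)
  have hss' : s ≤ s' := Real.rpow_le_rpow_of_exponent_le hr1 (by linarith)
  have hsT : ∀ t ∈ Set.Ioc 0 s, r / 2 ≤ e * |t - T| := fun t ht =>
    half_le_mul_abs_sub he hr0 hr hL ht.2
  have h1 : ∫ t in Set.Ioc 0 s, D t ≤ 4 * C * r ^ (2 - (d : ℝ) - 2 * δ) := by
    refine (h.setIntegral_Ioc_le_of_le_two hd hC hs0.le hs1 le_rfl (by positivity) hsT).trans ?_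
    have h2 : s ^ (1 - (d : ℝ) / 2) * s ≤ r ^ (2 - (d : ℝ) - 2 * δ) * r ^ 2 := by
      rw [← Real.rpow_add_one hs0.ne', hs, ← Real.rpow_mul hr0.le, ← Real.rpow_natCast,
        ← Real.rpow_add hr0]
      refine Real.rpow_le_rpow_of_exponent_le hr1 ?_
      push_cast
      nlinarith
    calc C * s ^ (1 - (d : ℝ) / 2) / (r / 2) ^ 2 * s
        = 4 * C * (s ^ (1 - (d : ℝ) / 2) * s / r ^ 2) := by field_simp; ring
      _ ≤ 4 * C * r ^ (2 - (d : ℝ) - 2 * δ) := by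
        refine mul_le_mul_of_nonneg_left ?_ (by positivity)
        rw [div_le_iff₀ (by positivity)]; exact h2
  have h2 : ∫ t in Set.Ioc s s', D t ≤ C * r ^ (2 - (d : ℝ) - 2 * δ) := by
    have hsub : Set.Ioc s s' ⊆ Set.Ioi 0 := fun t ht => hs0.trans ht.1
    refine (setIntegral_Ioc_le_const (c := C * s ^ (-(d : ℝ) / 2 - θ / 2)) hss'
      (h.integrableOn.mono_set hsub) fun t ht => ?_).trans ?_
    · refine (h.le_rpow t (hsub ht)).trans (mul_le_mul_of_nonneg_left ?_ hC)
      exact Real.rpow_le_rpow_of_nonpos hs0 ht.1.le (by linarith)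
    · rw [mul_assoc]
      refine mul_le_mul_of_nonneg_left ?_ hC
      calc s ^ (-(d : ℝ) / 2 - θ / 2) * (s' - s) ≤ s ^ (-(d : ℝ) / 2 - θ / 2) * s' :=
            mul_le_mul_of_nonneg_left (by linarith) (by positivity)
        _ ≤ r ^ (2 - (d : ℝ) - 2 * δ) := by
            rw [hs, hs', ← Real.rpow_mul hr0.le, ← Real.rpow_add hr0]
            refine Real.rpow_le_rpow_of_exponent_le hr1 ?_
            nlinarith
  have h3 : ∫ t in Set.Ioi s', D t ≤ 8 / a ^ 2 * C * r ^ (2 - (d : ℝ) - 2 * δ) := by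
    have hTs : 2 * T ≤ s' := by
      have h4 : s' = r ^ 2 * r ^ (4 * δ) := by
        rw [hs', Real.rpow_add hr0]; norm_cast
      have h5 : a * T ≤ r ^ 2 := by
        have : 0 ≤ T := by
          by_contra hT; push Not at hT
          nlinarith [mul_neg_of_pos_of_neg he hT]
        calc a * T ≤ e * r * T := mul_le_mul_of_nonneg_right haL this
          _ = r ^ 2 := by rw [hrdef]; ring
      calc 2 * T = a * T * (2 / a) := by field_simp
        _ ≤ r ^ 2 * r ^ (4 * δ) := mul_le_mul h5 har (by positivity) (by positivity)
        _ = s' := h4.symm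
    refine (h.setIntegral_Ioi_le hd1 hC he (hs1.trans hss') hTs).trans ?_
    have h5 : a ^ 2 ≤ r ^ 2 * e ^ 2 := by
      rw [← mul_pow]; exact pow_le_pow_left₀ ha.le (by rwa [mul_comm r e]) 2
    have h6 : r ^ 2 * s' ^ (-(d : ℝ) / 2) ≤ r ^ (2 - (d : ℝ) - 2 * δ) := by
      rw [hs', ← Real.rpow_mul hr0.le, ← Real.rpow_natCast, ← Real.rpow_add hr0]
      refine Real.rpow_le_rpow_of_exponent_le hr1 ?_
      push_cast
      nlinarith
    calc 8 * C * s' ^ (-(d : ℝ) / 2) / e ^ 2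
        = 8 * C * (r ^ 2 * s' ^ (-(d : ℝ) / 2)) / (r ^ 2 * e ^ 2) := by field_simp
      _ ≤ 8 * C * (r ^ 2 * s' ^ (-(d : ℝ) / 2)) / a ^ 2 :=
          div_le_div_of_nonneg_left (by positivity) (by positivity) h5
      _ = 8 / a ^ 2 * C * (r ^ 2 * s' ^ (-(d : ℝ) / 2)) := by ring
      _ ≤ _ := mul_le_mul_of_nonneg_left h6 (by positivity)
  rw [h.integral_eq hs0.le hss']
  linarith

end DecayBounds

/-- A Gaussian lower bound for a heat kernel along a ray moving at speed `e` that reaches the origin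
at time `T`. -/
structure GaussLower (d : ℕ) (c a e T : ℝ) (ρ : ℝ → ℝ) : Prop where
  nonneg : ∀ t, 0 < t → 0 ≤ ρ t
  integrableOn : IntegrableOn ρ (Set.Ioi 0)
  le : ∀ t, 0 < t → c * t ^ (-(d : ℝ) / 2) * Real.exp (-((e * (t - T)) ^ 2 / (2 * a * t))) ≤ ρ t

namespace GaussLower

variable {c a e T : ℝ} {ρ : ℝ → ℝ}

theorem le_integral_of_window (h : GaussLower d c a e T ρ) (hc : 0 < c) (ha : 0 < a) {b w : ℝ}
    (hb : 0 < b) (hw : 0 ≤ w) (hwb : w ≤ b)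
    (hwin : ∀ t ∈ Set.Ioc b (b + w), (e * (t - T)) ^ 2 ≤ t) :
    c * 2 ^ (-(d : ℝ) / 2) * Real.exp (-(1 / (2 * a))) * (b ^ (-(d : ℝ) / 2) * w)
      ≤ ∫ t in Set.Ioi 0, ρ t := by
  have hsub : Set.Ioc b (b + w) ⊆ Set.Ioi 0 := fun t ht => hb.trans ht.1
  have hd0 : (0 : ℝ) ≤ d := Nat.cast_nonneg d
  calc c * 2 ^ (-(d : ℝ) / 2) * Real.exp (-(1 / (2 * a))) * (b ^ (-(d : ℝ) / 2) * w)
      = ∫ _ in Set.Ioc b (b + w),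
          c * (2 * b) ^ (-(d : ℝ) / 2) * Real.exp (-(1 / (2 * a))) := by
        rw [Real.mul_rpow (by norm_num) hb.le]
        simp [hw]
        ring
    _ ≤ ∫ t in Set.Ioc b (b + w), ρ t := by
        refine setIntegral_mono_on (integrableOn_const (by simp)) (h.integrableOn.mono_set hsub)
          measurableSet_Ioc fun t ht => ?_
        have ht0 : 0 < t := hsub ht
        refine le_trans (mul_le_mul (mul_le_mul_of_nonneg_left ?_ hc.le) ?_ (by positivity)
          (by positivity)) (h.le t ht0)
        · exact Real.rpow_le_rpow_of_nonpos ht0 (by linarith [ht.2]) (by linarith)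
        · refine Real.exp_le_exp.2 (neg_le_neg ?_)
          rw [div_le_div_iff₀ (by positivity) (by positivity)]
          nlinarith [hwin t ht]
    _ ≤ ∫ t in Set.Ioi 0, ρ t :=
        setIntegral_mono_set h.integrableOn
          ((ae_restrict_iff' measurableSet_Ioi).2 (Eventually.of_forall h.nonneg))
          (LE.le.eventuallyLE hsub)

theorem le_integral_of_strong_drift (h : GaussLower d c a e T ρ) (hc : 0 < c) (ha : 0 < a)
    (he : 0 < e) (hT : 0 < T) (hL : 1 ≤ e ^ 2 * T) :
    c * 2 ^ (-(d : ℝ) / 2) * Real.exp (-(1 / (2 * a))) * (T ^ ((1 - (d : ℝ)) / 2) / e)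
      ≤ ∫ t in Set.Ioi 0, ρ t := by
  have hs : Real.sqrt T ^ 2 = T := Real.sq_sqrt hT.le
  have h1 : 1 ≤ e * Real.sqrt T := by
    refine le_of_pow_le_pow_left₀ two_ne_zero (by positivity) ?_
    rw [mul_pow, hs, one_pow]; exact hL
  have key := h.le_integral_of_window hc ha (b := T) (w := Real.sqrt T / e) hT (by positivity) ?_ ?_
  · refine le_trans (le_of_eq ?_) key
    rw [show (1 - (d : ℝ)) / 2 = -(d : ℝ) / 2 + 1 / 2 by ring, Real.rpow_add hT,
      ← Real.sqrt_eq_rpow, mul_div_assoc]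
  · rw [div_le_iff₀ he]
    nlinarith [Real.sqrt_nonneg T]
  · intro t ht
    have h2 : e * (t - T) ≤ Real.sqrt T := by
      have h3 : t - T ≤ Real.sqrt T / e := by linarith [ht.2]
      rwa [le_div_iff₀ he, mul_comm] at h3
    calc (e * (t - T)) ^ 2 ≤ Real.sqrt T ^ 2 :=
          pow_le_pow_left₀ (mul_nonneg he.le (by linarith [ht.1])) h2 2
      _ ≤ t := by rw [hs]; exact ht.1.le

theorem le_integral_of_weak_drift (h : GaussLower d c a e T ρ) (hd : 1 ≤ d) (hc : 0 < c) (ha : 0 < a)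
    (he : 0 < e) (hT : 0 < T) {δ : ℝ} (hδ : 0 ≤ δ) (hr1 : 1 ≤ e * T)
    (hL : e * (e * T) ≤ (e * T) ^ δ) :
    c * 2 ^ (-(d : ℝ) / 2) * Real.exp (-(1 / (2 * a))) * (e * T) ^ (2 - (d : ℝ) - δ)
      ≤ ∫ t in Set.Ioi 0, ρ t := by
  have hr0 : 0 < e * T := by positivity
  rcases le_total (e * (e * T)) 1 with h1 | h1
  · refine le_trans ?_ (h.le_integral_of_window hc ha (b := (e * T) ^ 2) (w := (e * T) ^ 2)
      (by positivity) (by positivity) le_rfl fun t ht => ?_)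
    · refine mul_le_mul_of_nonneg_left ?_ (by positivity)
      rw [← Real.rpow_natCast, ← Real.rpow_mul hr0.le, ← Real.rpow_add hr0]
      refine Real.rpow_le_rpow_of_exponent_le hr1 ?_
      push_cast
      linarith
    · have ht0 : 0 < t := lt_trans (by positivity) ht.1
      have h2 : e * t ≤ 2 * (e * T) := by
        calc e * t ≤ e * ((e * T) ^ 2 + (e * T) ^ 2) := mul_le_mul_of_nonneg_left ht.2 he.le
          _ = 2 * (e * T) * (e * (e * T)) := by ring
          _ ≤ 2 * (e * T) * 1 := mul_le_mul_of_nonneg_left h1 (by positivity)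
          _ = _ := mul_one _
      have h3 : 0 < e * t := by positivity
      refine le_trans (sq_le_sq' (b := e * T) ?_ ?_) ht.1.le
      · rw [mul_sub]; linarith
      · rw [mul_sub]; linarith
  · refine le_trans ?_ (h.le_integral_of_strong_drift hc ha he hT (by linarith))
    refine mul_le_mul_of_nonneg_left ?_ (by positivity)
    set r := e * T with hr
    have hTr : T = r / e := by rw [hr]; field_simp
    have h2 : T ^ ((1 - (d : ℝ)) / 2) / e = r ^ (2 - (d : ℝ)) * (e * r) ^ (((d : ℝ) - 3) / 2) := by
      rw [hTr, Real.div_rpow hr0.le he.le, Real.mul_rpow he.le hr0.le,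
        show ((d : ℝ) - 3) / 2 = -((1 - (d : ℝ)) / 2) - 1 by ring, Real.rpow_sub he,
        Real.rpow_neg he.le, Real.rpow_one, mul_comm (_ / _), ← mul_assoc, ← Real.rpow_add hr0,
        show 2 - (d : ℝ) + (-((1 - (d : ℝ)) / 2) - 1) = (1 - (d : ℝ)) / 2 by ring]
      field_simp
    rw [h2, Real.rpow_sub hr0 (2 - (d : ℝ)), div_eq_mul_inv]
    refine mul_le_mul_of_nonneg_left ?_ (by positivity)
    have hd' : (1 : ℝ) ≤ d := by exact_mod_cast hd
    calc (r ^ δ)⁻¹ = (r ^ δ) ^ (-1 : ℝ) := (Real.rpow_neg_one _).symm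
      _ ≤ (e * r) ^ (-1 : ℝ) := Real.rpow_le_rpow_of_nonpos (by positivity) hL (by norm_num)
      _ ≤ _ := Real.rpow_le_rpow_of_exponent_le h1 (by linarith)

end GaussLower

/-- The total error is negligible with respect to the Gaussian Green function, uniformly in the
strength of the drift. -/
theorem exists_integral_le (hd : 1 ≤ d) {C θ B c a s₀ : ℝ} (hC : 0 < C) (hθ0 : 0 < θ) (hθ : θ ≤ 1)
    (hB : 1 ≤ B) (hc : 0 < c) (ha : 0 < a) (hs₀ : 0 < s₀) :
    ∃ ε C' R : ℝ, 0 < ε ∧ 0 < C' ∧ 0 < R ∧ ∀ (e T : ℝ) (D ρ : ℝ → ℝ), 0 < e → e ≤ B →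
      R ≤ e * T → (d ≤ 2 → s₀ ≤ e * (e * T)) → DecayBounds d C θ e T D → GaussLower d c a e T ρ →
      ∫ t in Set.Ioi 0, D t ≤ C' * (∫ t in Set.Ioi 0, ρ t) * (e * T) ^ (-ε) := by
  have hd' : (1 : ℝ) ≤ d := by exact_mod_cast hd
  set δ : ℝ := θ / (12 * d) with hδ
  have hδ0 : 0 < δ := by positivity
  have hδd : 12 * (δ * d) = θ := by rw [hδ]; field_simp
  have hδθ : 12 * δ ≤ θ := by nlinarith
  set c' := c * 2 ^ (-(d : ℝ) / 2) * Real.exp (-(1 / (2 * a))) with hc'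
  have hc'0 : 0 < c' := by positivity
  set C₁ := (2 ^ d + 2 + (5 + 8 / s₀ ^ 2)) * C with hC₁
  set C₂ := (2 ^ d + 8 + 2 * π * 2 ^ ((d : ℝ) + 1)) * C with hC₂
  have hC₁0 : 0 < C₁ := by positivity
  have hC₂0 : 0 < C₂ := by positivity
  obtain ⟨R, hR⟩ := eventually_atTop.1 (((eventually_ge_atTop (1 : ℝ)).and
    (eventually_ge_atTop (2 * B))).and ((((tendsto_rpow_neg_atTop (y := 3 * δ) (by positivity)).eventually_le_const
      (show (0 : ℝ) < 1 / 2 by norm_num))).and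
      ((tendsto_rpow_atTop (y := 4 * δ) (by positivity)).eventually_ge_atTop (2 / s₀))))
  refine ⟨δ / 2, (C₁ + C₂ * (1 + B)) / c', max R 1, by positivity, by positivity, by positivity,
    fun e T D ρ he heB hRr hs hD hρ => ?_⟩
  obtain ⟨⟨hr1, hrB⟩, hr3, hr4⟩ := hR (e * T) ((le_max_left _ _).trans hRr)
  set r := e * T with hr
  have hr0 : 0 < r := by linarith
  have hT0 : 0 < T := pos_of_mul_pos_right hr0 he.le
  set G := ∫ t in Set.Ioi 0, ρ t with hG
  have hsplit : ∀ x y : ℝ, c' * y ≤ G → 0 ≤ y → 0 ≤ x → ∀ u v : ℝ, u ≤ x * y * v → 0 ≤ v →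
      u ≤ x / c' * G * v := fun x y h1 _ hx u v h2 hv => by
    refine h2.trans (mul_le_mul_of_nonneg_right ?_ hv)
    calc x * y = x / c' * (c' * y) := by field_simp
      _ ≤ x / c' * G := mul_le_mul_of_nonneg_left h1 (by positivity)
  rcases le_total (e * r) (r ^ δ) with hL | hL
  · have h1 : ∫ t in Set.Ioi 0, D t ≤ C₁ * r ^ (2 - (d : ℝ) - 2 * δ) := by
      by_cases hd2 : d ≤ 2
      · refine (hD.integral_le_of_weak_drift_of_le_two hd hd2 hC.le hθ0 hθ he hδ hr1 hr3 hL hs₀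
          (hs hd2) hr4).trans ?_
        refine mul_le_mul_of_nonneg_right (mul_le_mul_of_nonneg_right ?_ hC.le) (by positivity)
        have : (0 : ℝ) < 2 ^ d := by positivity
        linarith
      · refine (hD.integral_le_of_weak_drift_of_three_le (by omega) hC.le hθ0 hθ he hδ hr1 hr3
          hL).trans ?_
        refine mul_le_mul_of_nonneg_right (mul_le_mul_of_nonneg_right ?_ hC.le) (by positivity)
        have : (0 : ℝ) < 8 / s₀ ^ 2 := by positivity
        linarith
    have h2 := hρ.le_integral_of_weak_drift hd hc ha he hT0 hδ0.le hr1 hL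
    refine hsplit _ _ h2 (by positivity) (by positivity) _ _ (h1.trans ?_) (by positivity)
    rw [mul_assoc (C₁ + C₂ * (1 + B)), ← Real.rpow_add hr0]
    refine mul_le_mul ?_ (Real.rpow_le_rpow_of_exponent_le hr1 (by linarith)) (by positivity)
      (by positivity)
    have : 0 < C₂ * (1 + B) := by positivity
    linarith
  · have hTB : r / B ≤ T := by
      rw [div_le_iff₀ (by linarith), hr, mul_comm]
      exact mul_le_mul_of_nonneg_left heB hT0.le
    have hT2 : 2 ≤ T := le_trans (by rw [le_div_iff₀ (by linarith)]; exact hrB) hTB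
    have hL1 : 1 ≤ e ^ 2 * T := by
      have := (Real.one_le_rpow hr1 hδ0.le).trans hL
      rwa [hr, ← mul_assoc, ← sq] at this
    have h1 := hD.integral_le_of_strong_drift hd hC.le hθ0 hθ he hT2 hL1
    have h2 := hρ.le_integral_of_strong_drift hc ha he hT0 hL1
    set P := T ^ ((1 - (d : ℝ)) / 2) / e with hP
    have hP0 : 0 < P := by positivity
    have h3 : T ^ (-(d : ℝ) / 2) / e ^ 2 ≤ P * r ^ (-(δ / 2)) := by
      have h4 : T ^ (-(d : ℝ) / 2) / e ^ 2 = P * (e * r) ^ (-(1 / 2) : ℝ) := by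
        rw [hP, hr, show e * (e * T) = e ^ 2 * T by ring, Real.mul_rpow (by positivity) hT0.le,
          ← Real.rpow_natCast e 2, ← Real.rpow_mul he.le,
          show (-(d : ℝ) / 2) = (1 - (d : ℝ)) / 2 + -(1 / 2) by ring, Real.rpow_add hT0,
          show ((2 : ℕ) : ℝ) * -(1 / 2) = -1 by norm_num, Real.rpow_neg_one, Real.rpow_natCast]
        field_simp
      rw [h4]
      refine mul_le_mul_of_nonneg_left ?_ hP0.le
      calc (e * r) ^ (-(1 / 2) : ℝ) ≤ (r ^ δ) ^ (-(1 / 2) : ℝ) :=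
            Real.rpow_le_rpow_of_nonpos (by positivity) hL (by norm_num)
        _ = r ^ (-(δ / 2)) := by rw [← Real.rpow_mul hr0.le]; congr 1; ring
    have h5 : T ^ ((1 - (d : ℝ)) / 2 - θ / 4) / e ≤ P * (B * r ^ (-(δ / 2))) := by
      rw [sub_eq_add_neg, Real.rpow_add hT0, mul_div_right_comm]
      refine mul_le_mul_of_nonneg_left ?_ hP0.le
      calc T ^ (-(θ / 4)) ≤ (r / B) ^ (-(θ / 4)) :=
            Real.rpow_le_rpow_of_nonpos (by positivity) hTB (by linarith)
        _ = B ^ (θ / 4) * r ^ (-(θ / 4)) := by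
            rw [Real.div_rpow hr0.le (by linarith), Real.rpow_neg (by linarith : (0 : ℝ) ≤ B)]
            field_simp
        _ ≤ B ^ (1 : ℝ) * r ^ (-(δ / 2)) :=
            mul_le_mul (Real.rpow_le_rpow_of_exponent_le hB (by linarith))
              (Real.rpow_le_rpow_of_exponent_le hr1 (by linarith)) (by positivity) (by positivity)
        _ = _ := by rw [Real.rpow_one]
    refine hsplit _ _ h2 hP0.le (by positivity) _ _ (h1.trans ?_) (by positivity)
    calc C₂ * (T ^ (-(d : ℝ) / 2) / e ^ 2 + T ^ ((1 - (d : ℝ)) / 2 - θ / 4) / e)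
        ≤ C₂ * (P * r ^ (-(δ / 2)) + P * (B * r ^ (-(δ / 2)))) :=
          mul_le_mul_of_nonneg_left (add_le_add h3 h5) hC₂0.le
      _ = C₂ * (1 + B) * P * r ^ (-(δ / 2)) := by ring
      _ ≤ _ := by
          refine mul_le_mul_of_nonneg_right (mul_le_mul_of_nonneg_right ?_ hP0.le) (by positivity)
          linarith

theorem exists_pow_mul_heatKer_le (d : ℕ) {a b : ℝ} (ha : 0 < a) (hb : 0 < b) (n : ℕ) :
    ∃ C : ℝ, 0 < C ∧ ∀ Λ : Matrix (Fin d) (Fin d) ℝ, FormBounds a b Λ → ∀ x η : Fin d → ℝ,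
      ∀ t : ℝ, 0 < t →
        enormR (x - t • η) ^ n * heatKer d t x η Λ ≤ C * t ^ (((n : ℝ) - d) / 2) := by
  have hpoly : ∀ y : ℝ, 0 ≤ y → y ^ n * Real.exp (-(y ^ 2 / (2 * b))) ≤ 1 + (2 * b) ^ n * n.factorial := by
    intro y hy
    have h1 := Real.pow_div_factorial_le_exp (y ^ 2 / (2 * b)) (by positivity) n
    have h2 : y ^ n ≤ 1 + (y ^ 2) ^ n := by
      rw [← pow_mul, mul_comm, pow_mul]
      nlinarith [sq_nonneg (y ^ n - 1)]
    have hf : (0 : ℝ) < n.factorial := by exact_mod_cast n.factorial_pos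
    rw [div_pow, div_div, div_le_iff₀ (by positivity)] at h1
    have h3 : 1 ≤ Real.exp (y ^ 2 / (2 * b)) := Real.one_le_exp (by positivity)
    rw [Real.exp_neg, ← div_eq_mul_inv, div_le_iff₀ (Real.exp_pos _)]
    linarith
  refine ⟨1 / Real.sqrt (a ^ d) * (1 + (2 * b) ^ n * n.factorial), by positivity,
    fun Λ hΛ x η t ht => ?_⟩
  set v := enormR (x - t • η) with hv
  have hv0 : 0 ≤ v := enormR_nonneg _
  have hs : Real.sqrt t ^ 2 = t := Real.sq_sqrt ht.le
  have hs0 : 0 < Real.sqrt t := Real.sqrt_pos.2 ht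
  have h1 := hpoly (v / Real.sqrt t) (by positivity)
  rw [div_pow v _ 2, hs, div_div, div_pow] at h1
  have h2 : (1 : ℝ) / (2 * π * t) ^ ((d : ℝ) / 2) ≤ t ^ (-(d : ℝ) / 2) := by
    rw [one_div, neg_div, Real.rpow_neg ht.le]
    refine inv_anti₀ (by positivity) (Real.rpow_le_rpow ht.le ?_ (by positivity))
    nlinarith [Real.pi_gt_three]
  have h3 : t ^ (((n : ℝ) - d) / 2) = t ^ (-(d : ℝ) / 2) * Real.sqrt t ^ n := by
    rw [Real.sqrt_eq_rpow, ← Real.rpow_natCast (t ^ (1 / 2 : ℝ)), ← Real.rpow_mul ht.le,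
      ← Real.rpow_add ht]
    congr 1; ring
  calc v ^ n * heatKer d t x η Λ
      ≤ v ^ n * (1 / Real.sqrt (a ^ d) * (1 / (2 * π * t) ^ ((d : ℝ) / 2)) *
          Real.exp (-(v ^ 2 / (2 * b * t)))) :=
        mul_le_mul_of_nonneg_left (hΛ.heatKer_le ha hb ht x η) (by positivity)
    _ = 1 / Real.sqrt (a ^ d) * (1 / (2 * π * t) ^ ((d : ℝ) / 2)) * Real.sqrt t ^ n *
          (v ^ n / Real.sqrt t ^ n * Real.exp (-(v ^ 2 / (t * (2 * b))))) := by
        rw [mul_comm t (2 * b)]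
        field_simp
    _ ≤ 1 / Real.sqrt (a ^ d) * t ^ (-(d : ℝ) / 2) * Real.sqrt t ^ n *
          (1 + (2 * b) ^ n * n.factorial) := by
        refine mul_le_mul ?_ h1 (by positivity) (by positivity)
        exact mul_le_mul_of_nonneg_right (mul_le_mul_of_nonneg_left h2 (by positivity)) (by positivity)
    _ = _ := by rw [h3]; ring

theorem measurable_heatKer (x η : Fin d → ℝ) (Λ : Matrix (Fin d) (Fin d) ℝ) :
    Measurable fun t => heatKer d t x η Λ := by
  have h : Continuous fun t : ℝ => rdot (x - t • η) (Λ⁻¹ *ᵥ (x - t • η)) := by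
    simp only [rdot_eq_dotProduct]
    fun_prop
  unfold heatKer
  have := h.measurable
  fun_prop

theorem FormBounds.integrableOn_heatKer {a b : ℝ} (ha : 0 < a) (hb : 0 < b) (hd : 1 ≤ d)
    {Λ : Matrix (Fin d) (Fin d) ℝ} (h : FormBounds a b Λ) {η : Fin d → ℝ} {T : ℝ} (hT : 0 < T)
    (he : 0 < enormR η) : IntegrableOn (fun t => heatKer d t (T • η) η Λ) (Set.Ioi 0) := by
  obtain ⟨C₀, hC₀, H₀⟩ := exists_pow_mul_heatKer_le d ha hb 0
  obtain ⟨C₁, hC₁, H₁⟩ := exists_pow_mul_heatKer_le d ha hb d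
  obtain ⟨C₂, hC₂, H₂⟩ := exists_pow_mul_heatKer_le d ha hb 2
  have hd' : (1 : ℝ) ≤ d := by exact_mod_cast hd
  set e := enormR η with hedef
  have hϱ : ∀ t : ℝ, enormR (T • η - t • η) = |T - t| * e := fun t => by
    rw [← sub_smul, enormR_smul]
  have hm := (measurable_heatKer (T • η) η Λ).aestronglyMeasurable (μ := volume)
  have hpos : ∀ t : ℝ, 0 < t → 0 ≤ heatKer d t (T • η) η Λ := fun t ht =>
    (h.heatKer_pos ha ht _ _).le
  have h1 : IntegrableOn (fun t => heatKer d t (T • η) η Λ) (Set.Ioc 0 (2 * T)) := by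
    refine Measure.integrableOn_of_bounded measure_Ioc_lt_top.ne
      (M := C₁ / (T / 2 * e) ^ d + C₀ * (T / 2) ^ (-(d : ℝ) / 2)) hm
      ((ae_restrict_iff' measurableSet_Ioc).2 (Eventually.of_forall fun t ht => ?_))
    rw [Real.norm_of_nonneg (hpos t ht.1)]
    rcases le_total t (T / 2) with h2 | h2
    · have h3 := H₁ Λ h (T • η) η t ht.1
      rw [hϱ, sub_self, zero_div, Real.rpow_zero, mul_one] at h3
      have h4 : (T / 2 * e) ^ d ≤ (|T - t| * e) ^ d := by
        refine pow_le_pow_left₀ (by positivity) (mul_le_mul_of_nonneg_right ?_ he.le) _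
        exact le_trans (by linarith) (le_abs_self _)
      have h5 : heatKer d t (T • η) η Λ ≤ C₁ / (T / 2 * e) ^ d := by
        rw [le_div_iff₀ (by positivity), mul_comm]
        exact (mul_le_mul_of_nonneg_right h4 (hpos t ht.1)).trans h3
      have : 0 < C₀ * (T / 2) ^ (-(d : ℝ) / 2) := by positivity
      linarith
    · have h3 := H₀ Λ h (T • η) η t ht.1
      rw [pow_zero, one_mul, Nat.cast_zero, zero_sub] at h3
      have h4 : t ^ (-(d : ℝ) / 2) ≤ (T / 2) ^ (-(d : ℝ) / 2) :=
        Real.rpow_le_rpow_of_nonpos (by positivity) h2 (by linarith)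
      have h5 := mul_le_mul_of_nonneg_left h4 hC₀.le
      have : 0 < C₁ / (T / 2 * e) ^ d := by positivity
      linarith
  have h2 : IntegrableOn (fun t => heatKer d t (T • η) η Λ) (Set.Ioi (2 * T)) := by
    refine Integrable.mono' ((integrableOn_Ioi_rpow_of_lt (a := -1 - (d : ℝ) / 2) (by linarith)
      (by positivity : 0 < 2 * T)).const_mul (4 * C₂ / e ^ 2)) hm.restrict
      ((ae_restrict_iff' measurableSet_Ioi).2 (Eventually.of_forall fun t ht => ?_))
    have ht' : 2 * T < t := ht
    have ht0 : 0 < t := by linarith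
    rw [Real.norm_of_nonneg (hpos t ht0)]
    have h3 := H₂ Λ h (T • η) η t ht0
    rw [hϱ, mul_pow, sq_abs] at h3
    have h4 : t ^ (((2 : ℕ) : ℝ) / 2 - (d : ℝ) / 2) = t ^ (-1 - (d : ℝ) / 2) * t ^ 2 := by
      rw [← Real.rpow_natCast t 2, ← Real.rpow_add ht0]; congr 1; push_cast; ring
    rw [sub_div, h4] at h3
    have h5 : (t / 2) ^ 2 ≤ (T - t) ^ 2 := by nlinarith
    have h6 : heatKer d t (T • η) η Λ * (e ^ 2 * t ^ 2 / 4) ≤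
        4 * C₂ / e ^ 2 * t ^ (-1 - (d : ℝ) / 2) * (e ^ 2 * t ^ 2 / 4) := by
      calc heatKer d t (T • η) η Λ * (e ^ 2 * t ^ 2 / 4)
          = (t / 2) ^ 2 * e ^ 2 * heatKer d t (T • η) η Λ := by ring
        _ ≤ (T - t) ^ 2 * e ^ 2 * heatKer d t (T • η) η Λ :=
            mul_le_mul_of_nonneg_right (mul_le_mul_of_nonneg_right h5 (by positivity)) (hpos t ht0)
        _ ≤ C₂ * (t ^ (-1 - (d : ℝ) / 2) * t ^ 2) := h3
        _ = _ := by field_simp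
    exact le_of_mul_le_mul_right h6 (by positivity)
  rw [← Set.Ioc_union_Ioi_eq_Ioi (by positivity : (0 : ℝ) ≤ 2 * T)]
  exact h1.union h2

theorem FormBounds.gaussLower {a b : ℝ} (ha : 0 < a) (hb : 0 < b) (hd : 1 ≤ d)
    {Λ : Matrix (Fin d) (Fin d) ℝ} (h : FormBounds a b Λ) {η : Fin d → ℝ} {T : ℝ} (hT : 0 < T)
    (he : 0 < enormR η) :
    GaussLower d (1 / Real.sqrt (b ^ d) * (2 * π) ^ (-(d : ℝ) / 2)) a (enormR η) T
      (fun t => heatKer d t (T • η) η Λ) where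
  nonneg t ht := (h.heatKer_pos ha ht _ _).le
  integrableOn := h.integrableOn_heatKer ha hb hd hT he
  le t ht := by
    refine le_trans (le_of_eq ?_) (h.le_heatKer ha hb ht _ _)
    rw [← sub_smul, enormR_smul, mul_pow |T - t|, sq_abs, mul_pow (enormR η), Real.mul_rpow (by positivity) ht.le,
      neg_div, Real.rpow_neg (by positivity), Real.rpow_neg ht.le,
      show (enormR η) ^ 2 * (t - T) ^ 2 = (T - t) ^ 2 * (enormR η) ^ 2 by ring]
    field_simp

theorem exists_decayBounds (hd : 1 ≤ d) {M K θ p : ℝ} (hM : 1 ≤ M) (hK : 0 < K) (hθ0 : 0 < θ)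
    (hθ : θ ≤ 1) (hp : TailExp d p) :
    ∃ C : ℝ, 0 < C ∧ ∀ Q g : (Fin d → ℤ) → ℝ, KernPair M K θ p Q g → ∑' y, Q y = 1 →
      ∀ (x : Fin d → ℤ) (T : ℝ), 0 < T → 0 < enormR (drift Q) → toR x = T • drift Q →
        IntegrableOn (fun t => semiI Q g t x) (Set.Ioi 0) →
        DecayBounds d C θ (enormR (drift Q)) T fun t =>
          ‖semiI Q g t x - (((∑' y, g y) * heatKer d t (toR x) (drift Q) (covar Q) : ℝ) : ℂ)‖ := by
  have hM0 : 0 < M := by linarith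
  have hd' : (1 : ℝ) ≤ d := by exact_mod_cast hd
  obtain ⟨A₀, hA₀, H₀⟩ := exists_lclt d M K θ p hM hK hθ0 hθ
  obtain ⟨A₁, hA₁, H₁⟩ := exists_semiI_tail_two d M K θ p hM hK hp
  obtain ⟨A₂, hA₂, H₂⟩ : ∃ C : ℝ, 0 < C ∧ (3 ≤ d → ∀ Q g : (Fin d → ℤ) → ℝ, KernPair M K θ p Q g →
      ∀ t : ℝ, 0 ≤ t → ∀ x : Fin d → ℤ, enormR (toR x - t • drift Q) ^ (d - 1) * ‖semiI Q g t x‖ ≤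
        C * (max 1 t) ^ (-(1 / 2) : ℝ)) := by
    by_cases hd3 : 3 ≤ d
    · obtain ⟨C, hC, H⟩ := exists_semiI_tail_dm1 d M K θ p hM hK hp hd3
      exact ⟨C, hC, fun _ => H⟩
    · exact ⟨1, one_pos, fun h => absurd h hd3⟩
  obtain ⟨B₁, hB₁, G₁⟩ := exists_pow_mul_heatKer_le d (by positivity : 0 < 2 * K) hM0 2
  obtain ⟨B₂, hB₂, G₂⟩ := exists_pow_mul_heatKer_le d (by positivity : 0 < 2 * K) hM0 (d - 1)
  set C := A₀ + (A₁ + M * B₁) + (A₂ + M * B₂) with hC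
  have hMB₁ : 0 < M * B₁ := by positivity
  have hMB₂ : 0 < M * B₂ := by positivity
  refine ⟨C, by positivity, fun Q g h h1 x T hT he hx hI => ?_⟩
  have hΛ := h.formBounds hθ0 hθ
  set η := drift Q with hη
  set G := ∑' y, g y with hG
  have hGM : |G| ≤ M := h.norm_tsum_g_le
  have hϱ : ∀ t : ℝ, enormR (toR x - t • η) = enormR η * |t - T| := fun t => by
    rw [hx, ← sub_smul, enormR_smul, abs_sub_comm, mul_comm]
  have hpos : ∀ t : ℝ, 0 < t → 0 ≤ heatKer d t (toR x) η (covar Q) := fun t ht =>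
    (hΛ.heatKer_pos (by positivity) ht _ _).le
  have hint : IntegrableOn (fun t => heatKer d t (toR x) η (covar Q)) (Set.Ioi 0) := by
    rw [hx]; exact hΛ.integrableOn_heatKer (by positivity) hM0 hd hT he
  have hsplit : ∀ t : ℝ, 0 < t → ∀ n : ℕ, ∀ u v : ℝ,
      (enormR η * |t - T|) ^ n * ‖semiI Q g t x‖ ≤ u →
      (enormR η * |t - T|) ^ n * heatKer d t (toR x) η (covar Q) ≤ v →
      (enormR η * |t - T|) ^ n * ‖semiI Q g t x - ((G * heatKer d t (toR x) η (covar Q) : ℝ) : ℂ)‖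
        ≤ u + M * v := fun t ht n u v hu hv => by
    set w := (enormR η * |t - T|) ^ n with hw
    have hw0 : 0 ≤ w := by positivity
    calc w * ‖semiI Q g t x - ((G * heatKer d t (toR x) η (covar Q) : ℝ) : ℂ)‖
        ≤ w * (‖semiI Q g t x‖ + M * heatKer d t (toR x) η (covar Q)) := by
          refine mul_le_mul_of_nonneg_left ((norm_sub_le _ _).trans (add_le_add le_rfl ?_)) hw0
          rw [Complex.norm_real, norm_mul, Real.norm_of_nonneg (hpos t ht), Real.norm_eq_abs]
          exact mul_le_mul_of_nonneg_right hGM (hpos t ht)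
      _ = w * ‖semiI Q g t x‖ + M * (w * heatKer d t (toR x) η (covar Q)) := by ring
      _ ≤ u + M * v := add_le_add hu (mul_le_mul_of_nonneg_left hv hM0.le)
  refine ⟨fun t => norm_nonneg _, (hI.sub (hint.const_mul G).ofReal).norm, fun t ht => ?_,
    fun t ht hdt => ?_, fun hd3 t ht => ?_⟩
  · exact (H₀ Q g h h1 t ht x).trans (mul_le_mul_of_nonneg_right (by rw [hC]; linarith) (by positivity))
  · rw [mul_pow, ← sq_abs (t - T), ← mul_pow]
    have h2 := H₁ Q g h t ht.le x
    have h3 := G₁ (covar Q) hΛ (toR x) η t ht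
    rw [hϱ] at h2 h3
    refine (hsplit t ht 2 _ _ h2 h3).trans ?_
    have h4 : t ^ ((((2 : ℕ) : ℝ) - d) / 2) ≤ (max 1 t) ^ (1 - (d : ℝ) / 2) := by
      rw [show (((2 : ℕ) : ℝ) - d) / 2 = 1 - (d : ℝ) / 2 by push_cast; ring]
      rcases hdt with hd2 | ht1
      · have : (d : ℝ) ≤ 2 := by exact_mod_cast hd2
        exact Real.rpow_le_rpow ht.le (le_max_right _ _) (by linarith)
      · rw [max_eq_right ht1]
    calc A₁ * (max 1 t) ^ (1 - (d : ℝ) / 2) + M * (B₁ * t ^ ((((2 : ℕ) : ℝ) - d) / 2))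
        ≤ A₁ * (max 1 t) ^ (1 - (d : ℝ) / 2) + M * (B₁ * (max 1 t) ^ (1 - (d : ℝ) / 2)) :=
          add_le_add le_rfl
            (mul_le_mul_of_nonneg_left (mul_le_mul_of_nonneg_left h4 hB₁.le) hM0.le)
      _ = (A₁ + M * B₁) * (max 1 t) ^ (1 - (d : ℝ) / 2) := by ring
      _ ≤ _ := mul_le_mul_of_nonneg_right (by rw [hC]; linarith) (by positivity)
  · have h2 := H₂ hd3 Q g h t ht.le x
    have h3 := G₂ (covar Q) hΛ (toR x) η t ht
    rw [hϱ] at h2 h3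
    refine (hsplit t ht (d - 1) _ _ h2 h3).trans ?_
    have h4 : (max 1 t) ^ (-(1 / 2) : ℝ) ≤ t ^ (-(1 / 2) : ℝ) :=
      Real.rpow_le_rpow_of_nonpos ht (le_max_right _ _) (by norm_num)
    rw [show (((d - 1 : ℕ) : ℝ) - d) / 2 = -(1 / 2) by rw [Nat.cast_sub hd]; push_cast; ring]
    calc A₂ * (max 1 t) ^ (-(1 / 2) : ℝ) + M * (B₂ * t ^ (-(1 / 2) : ℝ))
        ≤ A₂ * t ^ (-(1 / 2) : ℝ) + M * (B₂ * t ^ (-(1 / 2) : ℝ)) :=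
          add_le_add (mul_le_mul_of_nonneg_left h4 hA₂.le) le_rfl
      _ = (A₂ + M * B₂) * t ^ (-(1 / 2) : ℝ) := by ring
      _ ≤ _ := mul_le_mul_of_nonneg_right (by rw [hC]; linarith) (by positivity)

/-- The crossover estimate in every dimension, with a lower bound on `m_S ‖x‖` assumed only when
`d ≤ 2`. -/
theorem exists_crossover (hd : 1 ≤ d) {M K ζ s₀ : ℝ} (hK : 0 < K) (hζ : 0 < ζ) (hs₀ : 0 < s₀) :
    ∃ ε C R : ℝ, 0 < ε ∧ 0 < C ∧ 0 < R ∧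
      ∀ S J h : (Fin d → ℤ) → ℝ, AssumptionOmega S → AssumptionJ S J h M K ζ →
      ∀ x : Fin d → ℤ, R ≤ enormZ x → (d ≤ 2 → s₀ ≤ mass S * enormZ x) →
      ∀ μx : Fin d → ℝ, IsOptTilt S (toR x) μx →
        |S x - greenC d (toR x) (etaOf J μx) (LambdaOf J μx) *
            Real.exp (-(mass S * normS S (toR x))) * tiltSum h μx| ≤
          C * greenC d (toR x) (etaOf J μx) (LambdaOf J μx) *
            Real.exp (-(mass S * normS S (toR x))) * enormZ x ^ (-ε) := by
  have hM1 : 1 ≤ max M 1 := le_max_right _ _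
  have hM0 : 0 < max M 1 := by linarith
  have hd' : (0 : ℝ) < d := by exact_mod_cast hd
  have hθ0 : 0 < min ζ 1 := lt_min hζ one_pos
  have hθ1 : min ζ 1 ≤ 1 := min_le_right _ _
  obtain ⟨A, hA, HA⟩ := exists_decayBounds hd hM1 hK hθ0 hθ1 (tailExp_min_pExp hd hζ)
  obtain ⟨ε, C, R, hε, hC, hR, H⟩ := exists_integral_le hd hA hθ0 hθ1 hM1
    (c := 1 / Real.sqrt (max M 1 ^ d) * (2 * π) ^ (-(d : ℝ) / 2)) (by positivity)
    (by positivity : 0 < 2 * K) (by positivity : 0 < 2 * K * s₀ / d)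
  refine ⟨ε, C, R, hε, hC, hR, fun S J h hΩ hJ x hx hxs μ hμ => ?_⟩
  have hp := hJ.kernPair hΩ hd (frontier_subset_closure hμ.1)
  have h1 := hJ.tsum_J_eq_one hΩ hμ.1
  have hge := hJ.enormR_drift_ge hΩ hd hμ.1
  have hμ0 := hΩ.enormR_pos hμ.1
  have heta : etaOf J μ = drift (tilt J μ) := by
    ext j; simp only [etaOf, drift, tilt, mul_assoc]
  have hLam : LambdaOf J μ = covar (tilt J μ) := by
    simp only [LambdaOf, covar, tilt, mul_assoc]
  have hG : tiltSum h μ = ∑' y, tilt h μ y := rfl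
  rw [heta, hLam, hG, hΩ.mass_mul_normS hμ, rdot_toR]
  set η := drift (tilt J μ) with hη
  set Λ := covar (tilt J μ) with hΛ
  set G := ∑' y, tilt h μ y with hGdef
  have he : 0 < enormR η := lt_of_lt_of_le (by positivity) hge
  have hr : 0 < enormZ x := hR.trans_le hx
  set T := enormZ x / enormR η with hTdef
  have hT : 0 < T := by positivity
  have heT : enormR η * T = enormZ x := by rw [hTdef]; field_simp
  have hxT : toR x = T • η := hJ.eq_smul_drift hΩ hd hμ
  have hI := hJ.integral_semiI hΩ hd hμ.1 he x
  have hform := hp.formBounds hθ0 hθ1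
  have hint : IntegrableOn (fun t => heatKer d t (toR x) η Λ) (Set.Ioi 0) := by
    rw [hxT]; exact hform.integrableOn_heatKer (by positivity) hM0 hd hT he
  have hintG : IntegrableOn (fun t => ((G * heatKer d t (toR x) η Λ : ℝ) : ℂ)) (Set.Ioi 0) :=
    (hint.const_mul G).ofReal
  have hdiff : ((tilt S μ x - greenC d (toR x) η Λ * G : ℝ) : ℂ) =
      ∫ t in Set.Ioi (0 : ℝ), (semiI (tilt J μ) (tilt h μ) t x -
        ((G * heatKer d t (toR x) η Λ : ℝ) : ℂ)) := by
    rw [integral_sub hI.1 hintG, hI.2, integral_complex_ofReal,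
      integral_const_mul, greenC]
    push_cast
    ring
  have hbound : |tilt S μ x - greenC d (toR x) η Λ * G| ≤
      C * greenC d (toR x) η Λ * enormZ x ^ (-ε) := by
    rw [← Real.norm_eq_abs, ← Complex.norm_real, hdiff]
    refine (norm_integral_le_integral_norm _).trans ?_
    have key := H (enormR η) T _ _ he hp.kern.enormR_drift_le (by rwa [heT]) (fun hd2 => ?_)
      (HA _ _ hp h1 x T hT he hxT hI.1) (hform.gaussLower (by positivity) hM0 hd hT he)
    · rwa [heT, ← hxT] at key
    · rw [heT, div_le_iff₀ hd']
      calc 2 * K * s₀ ≤ 2 * K * (mass S * enormZ x) :=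
            mul_le_mul_of_nonneg_left (hxs hd2) (by positivity)
        _ ≤ 2 * K * (d * enormR μ * enormZ x) :=
            mul_le_mul_of_nonneg_left (mul_le_mul_of_nonneg_right (hΩ.mass_le hd hμ.1) hr.le)
              (by positivity)
        _ = 2 * K * enormR μ * enormZ x * d := by ring
        _ ≤ enormR η * enormZ x * d :=
            mul_le_mul_of_nonneg_right (mul_le_mul_of_nonneg_right hge hr.le) hd'.le
  have hS : S x = Real.exp (-rdotZ μ x) * tilt S μ x := by
    rw [tilt, mul_comm, mul_assoc, ← Real.exp_add, add_neg_cancel, Real.exp_zero, mul_one]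
  calc |S x - greenC d (toR x) η Λ * Real.exp (-rdotZ μ x) * G|
      = Real.exp (-rdotZ μ x) * |tilt S μ x - greenC d (toR x) η Λ * G| := by
        rw [hS, ← abs_of_pos (Real.exp_pos (-rdotZ μ x)), ← abs_mul, abs_of_pos (Real.exp_pos _)]
        congr 1
        ring
    _ ≤ Real.exp (-rdotZ μ x) * (C * greenC d (toR x) η Λ * enormZ x ^ (-ε)) :=
        mul_le_mul_of_nonneg_left hbound (Real.exp_pos _).le
    _ = _ := by ring

theorem statement4 (d : ℕ) (hd : 1 ≤ d) (M K ζ : ℝ)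
    (hM : 0 < M) (hK : 0 < K) (hζ : 0 < ζ) :
    (2 < d → ∃ ε C R : ℝ, 0 < ε ∧ 0 < C ∧ 0 < R ∧
      ∀ S J h : (Fin d → ℤ) → ℝ, AssumptionOmega S → AssumptionJ S J h M K ζ →
      ∀ x : Fin d → ℤ, R ≤ enormZ x →
      ∀ μx : Fin d → ℝ, IsOptTilt S (toR x) μx →
        |S x - greenC d (toR x) (etaOf J μx) (LambdaOf J μx) *
            Real.exp (-(mass S * normS S (toR x))) * tiltSum h μx| ≤
          C * greenC d (toR x) (etaOf J μx) (LambdaOf J μx) *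
            Real.exp (-(mass S * normS S (toR x))) * enormZ x ^ (-ε)) ∧
    (d ≤ 2 → ∀ s₀ : ℝ, 0 < s₀ → ∃ ε C R : ℝ, 0 < ε ∧ 0 < C ∧ 0 < R ∧
      ∀ S J h : (Fin d → ℤ) → ℝ, AssumptionOmega S → AssumptionJ S J h M K ζ →
      ∀ x : Fin d → ℤ, R ≤ enormZ x → s₀ ≤ mass S * enormZ x →
      ∀ μx : Fin d → ℝ, IsOptTilt S (toR x) μx →
        |S x - greenC d (toR x) (etaOf J μx) (LambdaOf J μx) *
            Real.exp (-(mass S * normS S (toR x))) * tiltSum h μx| ≤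
          C * greenC d (toR x) (etaOf J μx) (LambdaOf J μx) *
            Real.exp (-(mass S * normS S (toR x))) * enormZ x ^ (-ε)) := by
  refine ⟨fun hd2 => ?_, fun _ s₀ hs₀ => ?_⟩
  · obtain ⟨ε, C, R, hε, hC, hR, H⟩ := exists_crossover (M := M) hd hK hζ one_pos
    exact ⟨ε, C, R, hε, hC, hR, fun S J h hΩ hJ x hx μx hμ =>
      H S J h hΩ hJ x hx (fun h2 => absurd h2 (by omega)) μx hμ⟩
  · obtain ⟨ε, C, R, hε, hC, hR, H⟩ := exists_crossover (M := M) hd hK hζ hs₀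
    exact ⟨ε, C, R, hε, hC, hR, fun S J h hΩ hJ x hx hxs μx hμ =>
      H S J h hΩ hJ x hx (fun _ => hxs) μx hμ⟩
end OZpaper
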